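/- Figalli–Jerison stability of Brunn–Minkowski without convexity: Let n ≥ 2. Set M_n(τ) = 2^{3^{n+2}} n^{3^n} |log τ|^{3^n} / τ^{3^n} and σ_n(τ) = τ^{3^n} / (2^{3^{n+1}} n^{3^n} |log τ|^{3^n}) for τ ∈ (0, 1/2]. There exists a constant N_n > 0, depending only on n, such that the following holds: for all measurable sets A, B ⊂ ℝⁿ with |A| = |B| = 1, all λ ∈ (0,1) with τ = min{λ, 1−λ}, and S = (1−λ)A + λB, if |S| ≤ 1 + δ for some δ ≤ e^{−M_n(τ)}, then there exist a convex set K ⊂ ℝⁿ and translation vectors a, b ∈ ℝⁿ such that A + a ⊆ K, B + b ⊆ K, and |K \ (A + a)| + |K \ (B + b)| ≤ τ^{−N_n} δ^{σ_n(τ)}. -/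

import Mathlib

open MeasureTheory
open scoped Pointwise ENNReal

/-- `M_n(τ) = 2^{3^{n+2}} n^{3^n} |log τ|^{3^n} / τ^{3^n}`. -/
noncomputable def FJM (n : ℕ) (τ : ℝ) : ℝ :=
  2 ^ (3 ^ (n + 2)) * (n : ℝ) ^ (3 ^ n) * |Real.log τ| ^ (3 ^ n) / τ ^ (3 ^ n)

/-- `σ_n(τ) = τ^{3^n} / (2^{3^{n+1}} n^{3^n} |log τ|^{3^n})`. -/
noncomputable def FJsigma (n : ℕ) (τ : ℝ) : ℝ :=
  τ ^ (3 ^ n) / (2 ^ (3 ^ (n + 1)) * (n : ℝ) ^ (3 ^ n) * |Real.log τ| ^ (3 ^ n))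

theorem add_volume_le_of_isCompact {K L W : Set ℝ} (hK : IsCompact K) (hL : IsCompact L)
    (hKn : K.Nonempty) (hLn : L.Nonempty) (h : K + L ⊆ W) :
    volume K + volume L ≤ volume W := by
  obtain ⟨x, hx, hxK⟩ := hK.exists_isGreatest hKn
  obtain ⟨y, hy, hyL⟩ := hL.exists_isLeast hLn
  have h1 : volume ((fun t => y + t) '' K) = volume K := by
    rw [Set.image_add_left, measure_preimage_add]
  have h2 : volume ((fun t => x + t) '' L) = volume L := by
    rw [Set.image_add_left, measure_preimage_add]
  have h3 : AEDisjoint volume ((fun t => y + t) '' K) ((fun t => x + t) '' L) := by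
    refine measure_mono_null (t := {x + y}) ?_ (by simp)
    rintro z ⟨⟨a, ha, rfl⟩, ⟨b, hb, hab⟩⟩
    have h1 := hxK ha
    have h2 := hyL hb
    simp only at hab ⊢
    rw [Set.mem_singleton_iff]
    linarith
  have h4 : NullMeasurableSet ((fun t => x + t) '' L) volume :=
    (hL.image (by fun_prop)).isClosed.measurableSet.nullMeasurableSet
  rw [← h1, ← h2, ← measure_union₀ h4 h3]
  refine measure_mono (Set.union_subset ?_ ?_)
  · rintro _ ⟨a, ha, rfl⟩
    exact h ⟨a, ha, y, hy, by simp [add_comm]⟩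
  · rintro _ ⟨a, ha, rfl⟩
    exact h ⟨x, hx, a, ha, by simp⟩

theorem measure_le_of_forall_isCompact {α : Type*} [MeasurableSpace α] [TopologicalSpace α]
    {μ : Measure α} [μ.InnerRegular] {U : Set α} (hU : MeasurableSet U) {c : ℝ≥0∞}
    (h : ∀ K ⊆ U, IsCompact K → μ K ≤ c) : μ U ≤ c := by
  refine le_of_forall_lt fun r hr => ?_
  obtain ⟨K, hKU, hK, hlt⟩ := hU.exists_lt_isCompact hr
  exact hlt.trans_le (h K hKU hK)

theorem add_volume_le_of_measurableSet {U V W : Set ℝ} (hU : MeasurableSet U)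
    (hV : MeasurableSet V) (hUn : U.Nonempty) (hVn : V.Nonempty) (h : U + V ⊆ W) :
    volume U + volume V ≤ volume W := by
  obtain ⟨u, hu⟩ := hUn
  obtain ⟨v, hv⟩ := hVn
  have h1 : ∀ K ⊆ U, IsCompact K → ∀ L ⊆ V, IsCompact L → volume K + volume L ≤ volume W := by
    intro K hKU hK L hLV hL
    refine le_trans (add_le_add (measure_mono (Set.subset_insert u K))
      (measure_mono (Set.subset_insert v L))) ?_
    refine add_volume_le_of_isCompact (hK.insert u) (hL.insert v) ⟨u, by simp⟩ ⟨v, by simp⟩ ?_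
    exact (Set.add_subset_add (Set.insert_subset hu hKU) (Set.insert_subset hv hLV)).trans h
  have h2 : ∀ L ⊆ V, IsCompact L → volume U + volume L ≤ volume W := by
    intro L hLV hL
    have hL' : volume L ≤ volume W := by simpa using h1 ∅ (by simp) isCompact_empty L hLV hL
    rw [← tsub_add_cancel_of_le hL']
    gcongr
    exact measure_le_of_forall_isCompact hU fun K hKU hK =>
      ENNReal.le_sub_of_add_le_right hL.measure_lt_top.ne (h1 K hKU hK L hLV hL)
  have hU' : volume U ≤ volume W := by simpa using h2 ∅ (by simp) isCompact_empty
  rcases eq_or_ne (volume U) ⊤ with h3 | h3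
  · rw [h3, top_le_iff] at hU'
    simp [hU']
  rw [← tsub_add_cancel_of_le hU', add_comm]
  gcongr
  exact measure_le_of_forall_isCompact hV fun L hLV hL =>
      ENNReal.le_sub_of_add_le_left h3 (h2 L hLV hL)

theorem ENNReal.rpow_mul_rpow_le_add {lam : ℝ} (h0 : 0 < lam) (h1 : lam < 1) (a b : ℝ≥0∞) :
    a ^ (1 - lam) * b ^ lam ≤ ENNReal.ofReal (1 - lam) * a + ENNReal.ofReal lam * b := by
  rcases eq_or_ne a ⊤ with rfl | ha
  · simp [ENNReal.mul_top, h1]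
  rcases eq_or_ne b ⊤ with rfl | hb
  · simp [ENNReal.mul_top, h0]
  lift a to NNReal using ha
  lift b to NNReal using hb
  have := Real.geom_mean_le_arith_mean2_weighted (sub_nonneg.2 h1.le) h0.le a.coe_nonneg
    b.coe_nonneg (by ring)
  rw [← ENNReal.ofReal_coe_nnreal, ← ENNReal.ofReal_coe_nnreal,
    ENNReal.ofReal_rpow_of_nonneg a.coe_nonneg (by linarith),
    ENNReal.ofReal_rpow_of_nonneg b.coe_nonneg h0.le,
    ← ENNReal.ofReal_mul (by positivity), ← ENNReal.ofReal_mul (by linarith),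
    ← ENNReal.ofReal_mul h0.le,
    ← ENNReal.ofReal_add (mul_nonneg (by linarith) a.coe_nonneg) (by positivity)]
  exact ENNReal.ofReal_le_ofReal this

theorem lintegral_add_le_of_levelSets {lam : ℝ} (h0 : 0 < lam) (h1 : lam < 1) {f g h : ℝ → ℝ}
    (hf : Measurable f) (hg : Measurable g) (hh : Measurable h) (hf0 : ∀ x, 0 ≤ f x)
    (hg0 : ∀ x, 0 ≤ g x) (hh0 : ∀ x, 0 ≤ h x) (hf1 : ∀ x, f x ≤ 1) (hg1 : ∀ x, g x ≤ 1)
    (hfs : ∀ t < 1, ∃ x, t < f x) (hgs : ∀ t < 1, ∃ x, t < g x)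
    (H : ∀ t x y, 0 < t → t < f x → t < g y → t < h ((1 - lam) * x + lam * y)) :
    ENNReal.ofReal (1 - lam) * (∫⁻ x, ENNReal.ofReal (f x)) +
      ENNReal.ofReal lam * (∫⁻ x, ENNReal.ofReal (g x)) ≤ ∫⁻ x, ENNReal.ofReal (h x) := by
  rw [lintegral_eq_lintegral_meas_lt _ (.of_forall hf0) hf.aemeasurable,
    lintegral_eq_lintegral_meas_lt _ (.of_forall hg0) hg.aemeasurable,
    lintegral_eq_lintegral_meas_lt _ (.of_forall hh0) hh.aemeasurable]
  have anti : ∀ f : ℝ → ℝ, Measurable fun t => volume {a | t < f a} := fun f =>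
    Antitone.measurable fun s t hst => measure_mono fun a ha => lt_of_le_of_lt hst ha
  rw [← lintegral_const_mul _ (anti f), ← lintegral_const_mul _ (anti g),
    ← lintegral_add_left ((anti f).const_mul _)]
  refine setLIntegral_mono (anti h) fun t ht => ?_
  rcases le_or_gt 1 t with h | ht1
  · have e1 : {a | t < f a} = ∅ := by
      ext a; simpa using (hf1 a).trans h
    have e2 : {a | t < g a} = ∅ := by
      ext a; simpa using (hg1 a).trans h
    simp [e1, e2]
  have s1 : ∀ c : ℝ, 0 < c → ∀ s : Set ℝ, ENNReal.ofReal c * volume s = volume (c • s) := by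
    intro c hc s
    rw [Measure.addHaar_smul]
    simp [abs_of_pos hc]
  rw [s1 _ (by linarith), s1 _ h0]
  refine add_volume_le_of_measurableSet ?_ ?_ ?_ ?_ ?_
  · exact (measurableSet_lt measurable_const hf).const_smul₀ _
  · exact (measurableSet_lt measurable_const hg).const_smul₀ _
  · exact Set.Nonempty.smul_set (hfs t ht1)
  · exact Set.Nonempty.smul_set (hgs t ht1)
  · rintro _ ⟨_, ⟨x, hx, rfl⟩, _, ⟨y, hy, rfl⟩, rfl⟩
    exact H t x y ht hx hy

/-- One-dimensional Prékopa–Leindler for bounded functions. -/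
theorem prekopa_leindler_real_of_bounded {lam : ℝ} (h0 : 0 < lam) (h1 : lam < 1)
    {f g h : ℝ → ℝ≥0∞}
    (hf : Measurable f) (hg : Measurable g) (hh : Measurable h) {M : ℝ≥0∞} (hM : M ≠ ⊤)
    (hfM : ∀ x, f x ≤ M) (hgM : ∀ x, g x ≤ M)
    (H : ∀ x y, f x ^ (1 - lam) * g y ^ lam ≤ h ((1 - lam) * x + lam * y)) :
    (∫⁻ x, f x) ^ (1 - lam) * (∫⁻ x, g x) ^ lam ≤ ∫⁻ x, h x := by
  have h1' : 0 < 1 - lam := by linarith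
  have hnorm : ∀ {f : ℝ → ℝ≥0∞}, Measurable f → (∀ x, f x ≤ M) → ∫⁻ x, f x ≠ 0 →
      ∃ m : ℝ≥0∞, m ≠ 0 ∧ m ≠ ⊤ ∧ ∃ F : ℝ → ℝ, Measurable F ∧ (∀ x, 0 ≤ F x) ∧ (∀ x, F x ≤ 1) ∧
        (∀ t < 1, ∃ x, t < F x) ∧ (∀ x, f x = m * ENNReal.ofReal (F x)) := by
    intro f hf hfM hf0
    have hm0 : ⨆ x, f x ≠ 0 := by
      intro h
      apply hf0
      rw [ENNReal.iSup_eq_zero] at h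
      simp [h]
    have hmt : ⨆ x, f x ≠ ⊤ := (lt_of_le_of_lt (iSup_le hfM) hM.lt_top).ne
    have hle : ∀ x, f x / (⨆ x, f x) ≤ 1 := fun x =>
      ENNReal.div_le_of_le_mul (by simpa using le_iSup f x)
    refine ⟨⨆ x, f x, hm0, hmt, fun x => (f x / ⨆ x, f x).toReal, (hf.div_const _).ennreal_toReal,
      fun x => by positivity, fun x => ENNReal.toReal_le_of_le_ofReal (by simp) (by simpa using hle x),
      fun t ht => ?_, fun x => ?_⟩
    · rcases lt_or_ge t 0 with htn | ht0
      · exact ⟨0, htn.trans_le (by positivity)⟩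
      have : ENNReal.ofReal t * (⨆ x, f x) < ⨆ x, f x := by
        conv_rhs => rw [← one_mul (⨆ x, f x)]
        exact ENNReal.mul_lt_mul_left hm0 hmt (by simpa using ht)
      obtain ⟨x, hx⟩ := lt_iSup_iff.1 this
      refine ⟨x, ?_⟩
      rw [← ENNReal.ofReal_lt_iff_lt_toReal ht0 ((hle x).trans_lt (by simp)).ne]
      rwa [ENNReal.lt_div_iff_mul_lt (Or.inl hm0) (Or.inl hmt)]
    · rw [ENNReal.ofReal_toReal ((hle x).trans_lt (by simp)).ne, ENNReal.mul_div_cancel hm0 hmt]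
  rcases eq_or_ne (∫⁻ x, f x) 0 with hf0 | hf0
  · simp [hf0, h1']
  rcases eq_or_ne (∫⁻ x, g x) 0 with hg0 | hg0
  · simp [hg0, h0]
  obtain ⟨m, hm0, hm, F, hF, hF0, hF1, hFs, hfF⟩ := hnorm hf hfM hf0
  obtain ⟨p, hp0, hp, G, hG, hG0, hG1, hGs, hgG⟩ := hnorm hg hgM hg0
  set q := m ^ (1 - lam) * p ^ lam with hq
  have hq0 : q ≠ 0 := by simp [hq, hm0, hp0, hm, hp]
  have hqt : q ≠ ⊤ := by
    exact ENNReal.mul_ne_top (ENNReal.rpow_ne_top_of_nonneg h1'.le hm)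
      (ENNReal.rpow_ne_top_of_nonneg h0.le hp)
  have key := lintegral_add_le_of_levelSets (h := fun z => (min 1 (h z / q)).toReal) h0 h1 hF hG
    (by fun_prop) hF0 hG0 (by intro x; positivity) hF1 hG1 hFs hGs (by
      intro t x y ht0 hx hy
      have := H x y
      have ht1 : t < 1 := hx.trans_le (hF1 x)
      rw [hfF, hgG, ENNReal.mul_rpow_of_nonneg _ _ h1'.le, ENNReal.mul_rpow_of_nonneg _ _ h0.le,
        mul_mul_mul_comm, ← hq, ENNReal.ofReal_rpow_of_nonneg (hF0 x) h1'.le,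
        ENNReal.ofReal_rpow_of_nonneg (hG0 y) h0.le,
        ← ENNReal.ofReal_mul (Real.rpow_nonneg (hF0 x) _), mul_comm,
        ← ENNReal.le_div_iff_mul_le (Or.inl hq0) (Or.inl hqt)] at this
      rw [← ENNReal.ofReal_lt_iff_lt_toReal ht0.le (by simp)]
      refine lt_min (by simpa using ht1) (lt_of_lt_of_le ?_ this)
      rw [ENNReal.ofReal_lt_ofReal_iff_of_nonneg ht0.le]
      calc t = t ^ (1 - lam) * t ^ lam := by rw [← Real.rpow_add ht0]; simp
        _ < _ := by gcongr)
  have key2 := (ENNReal.rpow_mul_rpow_le_add h0 h1 _ _).trans key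
  simp_rw [hfF, hgG]
  rw [lintegral_const_mul _ (by fun_prop), lintegral_const_mul _ (by fun_prop),
    ENNReal.mul_rpow_of_nonneg _ _ h1'.le, ENNReal.mul_rpow_of_nonneg _ _ h0.le,
        mul_mul_mul_comm, ← hq]
  calc _ ≤ q * ∫⁻ (x : ℝ), ENNReal.ofReal ((fun z => (min 1 (h z / q)).toReal) x) := by gcongr
    _ = ∫⁻ x, q * min 1 (h x / q) := by
      rw [lintegral_const_mul _ (by fun_prop)]
      congr 2; ext x
      rw [ENNReal.ofReal_toReal (by simp)]
    _ ≤ ∫⁻ x, h x := by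
      refine lintegral_mono fun x => ?_
      calc q * min 1 (h x / q) ≤ q * (h x / q) := by gcongr; exact min_le_right _ _
        _ ≤ h x := ENNReal.mul_div_le

theorem prekopa_leindler_real {lam : ℝ} (h0 : 0 < lam) (h1 : lam < 1) {f g h : ℝ → ℝ≥0∞}
    (hf : Measurable f) (hg : Measurable g) (hh : Measurable h)
    (H : ∀ x y, f x ^ (1 - lam) * g y ^ lam ≤ h ((1 - lam) * x + lam * y)) :
    (∫⁻ x, f x) ^ (1 - lam) * (∫⁻ x, g x) ^ lam ≤ ∫⁻ x, h x := by
  have h1' : 0 < 1 - lam := by linarith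
  rcases eq_or_ne (∫⁻ x, f x) 0 with hf0 | hf0
  · simp [hf0, h1']
  rcases eq_or_ne (∫⁻ x, g x) 0 with hg0 | hg0
  · simp [hg0, h0]
  have lim : ∀ {f : ℝ → ℝ≥0∞}, Measurable f →
      Filter.Tendsto (fun n : ℕ => ∫⁻ x, min (f x) n) Filter.atTop (nhds (∫⁻ x, f x)) := by
    intro f hf
    refine lintegral_tendsto_of_tendsto_of_monotone (fun n => by fun_prop)
      (.of_forall fun x m n hmn => min_le_min le_rfl (by exact_mod_cast hmn))
      (.of_forall fun x => ?_)
    have : Filter.Tendsto (fun n : ℕ => min (f x) (n : ℝ≥0∞)) Filter.atTop (nhds (min (f x) ⊤)) :=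
      tendsto_const_nhds.min ENNReal.tendsto_nat_nhds_top
    simpa using this
  have t1 := ((ENNReal.continuous_rpow_const (y := 1 - lam)).tendsto _).comp (lim hf)
  have t2 := ((ENNReal.continuous_rpow_const (y := lam)).tendsto _).comp (lim hg)
  have n1 : (∫⁻ x, f x) ^ (1 - lam) ≠ 0 := by
    simp only [ne_eq, ENNReal.rpow_eq_zero_iff, not_or, not_and_or]
    exact ⟨Or.inl hf0, Or.inr h1'.le.not_gt⟩
  have n2 : (∫⁻ x, g x) ^ lam ≠ 0 := by
    simp only [ne_eq, ENNReal.rpow_eq_zero_iff, not_or, not_and_or]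
    exact ⟨Or.inl hg0, Or.inr h0.le.not_gt⟩
  refine le_of_tendsto' (ENNReal.Tendsto.mul t1 (Or.inl n1) t2 (Or.inl n2)) fun n => ?_
  refine prekopa_leindler_real_of_bounded h0 h1 (by fun_prop) (by fun_prop) hh
    (M := n) (by simp) (fun x => min_le_right _ _) (fun x => min_le_right _ _) fun x y => ?_
  refine le_trans ?_ (H x y)
  gcongr <;> exact min_le_left _ _

theorem measurable_finCons {k : ℕ} :
    Measurable fun p : ℝ × (Fin k → ℝ) => (Fin.cons p.1 p.2 : Fin (k + 1) → ℝ) := by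
  have := (MeasurableEquiv.piFinSuccAbove (fun _ : Fin (k + 1) => ℝ) 0).symm.measurable
  convert this using 1
  ext p i
  refine Fin.cases ?_ (fun i => ?_) i <;> simp [MeasurableEquiv.piFinSuccAbove_symm_apply]

theorem lintegral_fin_succ {k : ℕ} {f : (Fin (k + 1) → ℝ) → ℝ≥0∞} (hf : Measurable f) :
    ∫⁻ z, f z = ∫⁻ y : Fin k → ℝ, ∫⁻ x : ℝ, f (Fin.cons x y) := by
  have h := (volume_preserving_piFinSuccAbove (fun _ : Fin (k + 1) => ℝ) 0).symm
  rw [← h.lintegral_comp hf, Measure.volume_eq_prod, lintegral_prod_symm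
    (fun p => f ((MeasurableEquiv.piFinSuccAbove (fun _ : Fin (k + 1) => ℝ) 0).symm p))
    (hf.comp h.measurable).aemeasurable]
  refine lintegral_congr fun y => lintegral_congr fun x => congrArg f ?_
  ext i
  refine Fin.cases ?_ (fun i => ?_) i <;> simp [MeasurableEquiv.piFinSuccAbove_symm_apply]

/-- The Prékopa–Leindler inequality. -/
theorem prekopa_leindler {lam : ℝ} (h0 : 0 < lam) (h1 : lam < 1) {k : ℕ}
    {f g h : (Fin k → ℝ) → ℝ≥0∞} (hf : Measurable f) (hg : Measurable g) (hh : Measurable h)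
    (H : ∀ x y, f x ^ (1 - lam) * g y ^ lam ≤ h ((1 - lam) • x + lam • y)) :
    (∫⁻ x, f x) ^ (1 - lam) * (∫⁻ x, g x) ^ lam ≤ ∫⁻ x, h x := by
  induction k with
  | zero =>
    have h1 : (volume : Measure (Fin 0 → ℝ)) Set.univ = 1 := by
      rw [volume_pi, Measure.pi_of_empty]; simp
    simp only [lintegral_unique, h1, mul_one]
    have aux (a b c) : f a ^ (1 - lam) * g b ^ lam ≤ h c := by
      have := H a b
      rwa [Subsingleton.elim ((1 - lam) • a + lam • b) c] at this
    exact aux _ _ _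
  | succ k ih =>
    rw [lintegral_fin_succ hf, lintegral_fin_succ hg, lintegral_fin_succ hh]
    have m : ∀ {f : (Fin (k + 1) → ℝ) → ℝ≥0∞}, Measurable f →
        Measurable fun y : Fin k → ℝ => ∫⁻ x : ℝ, f (Fin.cons x y) := fun {f} hf =>
      (hf.comp measurable_finCons).lintegral_prod_left'
    refine ih (m hf) (m hg) (m hh) fun y y' => ?_
    have m2 : ∀ y : Fin k → ℝ, Measurable fun x : ℝ => (Fin.cons x y : Fin (k + 1) → ℝ) :=
      fun y => measurable_finCons.comp (by fun_prop : Measurable fun x : ℝ => (x, y))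
    refine prekopa_leindler_real h0 h1 (hf.comp (m2 y)) (hg.comp (m2 y')) (hh.comp (m2 _))
      fun x x' => (H _ _).trans (le_of_eq (congrArg h ?_))
    ext i
    refine Fin.cases ?_ (fun i => ?_) i <;> simp

/-- Multiplicative Brunn–Minkowski inequality. -/
theorem brunn_minkowski {lam : ℝ} (h0 : 0 < lam) (h1 : lam < 1) {k : ℕ}
    {A B S : Set (Fin k → ℝ)} (hA : MeasurableSet A) (hB : MeasurableSet B) (hS : MeasurableSet S)
    (H : (1 - lam) • A + lam • B ⊆ S) :
    volume A ^ (1 - lam) * volume B ^ lam ≤ volume S := by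
  have h1' : 0 < 1 - lam := by linarith
  have := prekopa_leindler h0 h1 (f := A.indicator 1) (g := B.indicator 1) (h := S.indicator 1)
    (measurable_one.indicator hA) (measurable_one.indicator hB) (measurable_one.indicator hS) (by
      intro x y
      by_cases hx : x ∈ A
      · by_cases hy : y ∈ B
        · have : (1 - lam) • x + lam • y ∈ S :=
            H (Set.add_mem_add (Set.smul_mem_smul_set hx) (Set.smul_mem_smul_set hy))
          simp [hx, hy, this]
        · simp [hy, h0]
      · simp [hx, h1'])
  simpa only [lintegral_indicator_one hA, lintegral_indicator_one hB, lintegral_indicator_one hS]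
    using this

theorem Real.volume_real_image_add_left (c : ℝ) (S : Set ℝ) :
    volume.real ((fun t => c + t) '' S) = volume.real S := by
  rw [measureReal_def, Set.image_add_left, measure_preimage_add, measureReal_def]

theorem measureReal_le_card_mul {d : ℝ} (hd : 0 < d) {A : Set ℝ} (hA : A ⊆ Set.Icc 0 d) {p : ℕ}
    [NeZero p] {s : Finset (ZMod p)}
    (hs : ∀ a ∈ A, ((⌊a * p / d⌋₊ : ℕ) : ZMod p) ∈ s) :
    volume.real A ≤ s.card * (d / p) := by
  have hp : (0 : ℝ) < p := by exact_mod_cast NeZero.pos p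
  have hsub : A ⊆ {d} ∪ ⋃ c ∈ s, Set.Ico (c.val * (d / p)) ((c.val + 1) * (d / p)) := by
    intro a ha
    rcases (hA ha).2.eq_or_lt with h | h
    · left; exact h
    right
    have h0 : 0 ≤ a * p / d := by have := (hA ha).1; positivity
    have hlt : ⌊a * p / d⌋₊ < p := by
      rw [Nat.floor_lt h0, div_lt_iff₀ hd]; nlinarith
    simp only [Set.mem_iUnion]
    refine ⟨_, hs a ha, ?_⟩
    rw [ZMod.val_natCast, Nat.mod_eq_of_lt hlt]
    have h1 := Nat.floor_le h0
    have h2 := Nat.lt_floor_add_one (a * p / d)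
    have e : a = (a * p / d) * (d / p) := by field_simp
    constructor
    · conv_rhs => rw [e]
      gcongr
    · conv_lhs => rw [e]
      gcongr
  have hfin : volume (⋃ c ∈ s, Set.Ico (c.val * (d / p)) ((c.val + 1) * (d / p))) ≠ ⊤ := by
    refine ((measure_biUnion_finset_le _ _).trans_lt ?_).ne
    exact ENNReal.sum_lt_top.2 fun c _ => by simp
  calc volume.real A ≤ volume.real ({d} ∪ ⋃ c ∈ s, Set.Ico (c.val * (d / p)) ((c.val + 1) * (d / p))) :=
        measureReal_mono hsub (measure_union_ne_top (by simp) hfin)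
    _ ≤ volume.real {d} + volume.real (⋃ c ∈ s, Set.Ico (c.val * (d / p)) ((c.val + 1) * (d / p))) :=
        measureReal_union_le _ _
    _ ≤ 0 + ∑ c ∈ s, volume.real (Set.Ico (c.val * (d / p)) ((c.val + 1) * (d / p))) := by
        exact add_le_add (by simp [measureReal_def]) (measureReal_biUnion_finset_le _ _)
    _ = s.card * (d / p) := by
        have : ∀ c ∈ s, volume.real (Set.Ico (c.val * (d / p)) ((c.val + 1) * (d / p))) = d / p := by
          intro c _
          rw [Real.volume_real_Ico_of_le (by gcongr; linarith)]
          ring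
        rw [Finset.sum_congr rfl this]; simp

theorem card_mul_le_measureReal {d : ℝ} (hd : 0 < d) {A : Set ℝ} (hA : A ⊆ Set.Icc 0 d) {p : ℕ}
    [NeZero p] {s : Finset (ZMod p)}
    (hs : ∀ c ∈ s, Set.Ico (c.val * (d / p)) ((c.val + 1) * (d / p)) ⊆ A) :
    s.card * (d / p) ≤ volume.real A := by
  have hp : (0 : ℝ) < p := by exact_mod_cast NeZero.pos p
  have hdisj : Set.PairwiseDisjoint (s : Set (ZMod p))
      (fun c => Set.Ico ((c.val : ℝ) * (d / p)) ((c.val + 1) * (d / p))) := by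
    intro c _ c' _ hcc
    refine Set.disjoint_left.2 fun x hx hx' => hcc (ZMod.val_injective p ?_)
    have hdp : 0 < d / p := by positivity
    have h1 := lt_of_mul_lt_mul_right (hx.1.trans_lt hx'.2) hdp.le
    have h2 := lt_of_mul_lt_mul_right (hx'.1.trans_lt hx.2) hdp.le
    norm_cast at h1 h2
    omega
  have : ∀ c ∈ s, volume.real (Set.Ico (c.val * (d / p)) ((c.val + 1) * (d / p))) = d / p := by
    intro c _
    rw [Real.volume_real_Ico_of_le (by gcongr; linarith)]
    ring
  calc (s.card : ℝ) * (d / p)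
      = ∑ c ∈ s, volume.real (Set.Ico (c.val * (d / p)) ((c.val + 1) * (d / p))) := by
        rw [Finset.sum_congr rfl this]; simp
    _ = volume.real (⋃ c ∈ s, Set.Ico (c.val * (d / p)) ((c.val + 1) * (d / p))) := by
        rw [measureReal_biUnion_finset hdisj (fun _ _ => measurableSet_Ico)
            (fun _ _ => by rw [Real.volume_Ico]; exact ENNReal.ofReal_ne_top)]
    _ ≤ volume.real A := measureReal_mono (Set.iUnion₂_subset hs)
        ((measure_mono hA).trans_lt (by simp)).ne

/-- A quantitative form of Raikov's inequality on the circle of length `d`. -/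
theorem min_le_volume_of_add_mod_subset {d : ℝ} (hd : 0 < d) {A B C : Set ℝ}
    (hA : A ⊆ Set.Icc 0 d) (hB : B ⊆ Set.Icc 0 d) (hAn : A.Nonempty) (hBn : B.Nonempty)
    (hC : IsClosed C) (h : ∀ a ∈ A, ∀ b ∈ B, ∀ q : ℕ, q ≤ 2 → a + b - q * d ∈ C) :
    min d (volume.real A + volume.real B) ≤ volume.real (C ∩ Set.Icc 0 d) := by
  classical
  have step : ∀ ε > 0, min d (volume.real A + volume.real B) - ε ≤
      volume.real (Metric.cthickening ε C ∩ Set.Icc 0 d) := by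
    intro ε hε
    obtain ⟨N, hN⟩ := exists_nat_gt (2 * d / ε)
    obtain ⟨p, hNp, hp⟩ := Nat.exists_infinite_primes N
    have := Fact.mk hp
    have hp0 : (0 : ℝ) < p := by exact_mod_cast hp.pos
    have hdp : 2 * (d / p) ≤ ε := by
      have : (N : ℝ) ≤ p := by exact_mod_cast hNp
      rw [div_lt_iff₀ hε] at hN
      rw [← mul_div_assoc, div_le_iff₀ hp0]
      nlinarith
    set s : Finset (ZMod p) := Finset.univ.filter fun c => ∃ a ∈ A, ((⌊a * p / d⌋₊ : ℕ) : ZMod p) = c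
      with hs
    set t : Finset (ZMod p) := Finset.univ.filter fun c => ∃ a ∈ B, ((⌊a * p / d⌋₊ : ℕ) : ZMod p) = c
      with ht
    have h1 : volume.real A ≤ s.card * (d / p) := measureReal_le_card_mul hd hA (by
      intro a ha; simp only [hs, Finset.mem_filter]; exact ⟨Finset.mem_univ _, a, ha, rfl⟩)
    have h2 : volume.real B ≤ t.card * (d / p) := measureReal_le_card_mul hd hB (by
      intro a ha; simp only [ht, Finset.mem_filter]; exact ⟨Finset.mem_univ _, a, ha, rfl⟩)
    have h3 : (s + t).card * (d / p) ≤ volume.real (Metric.cthickening ε C ∩ Set.Icc 0 d) := by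
      refine card_mul_le_measureReal hd Set.inter_subset_right fun c hc x hx => ?_
      obtain ⟨c1, hc1, c2, hc2, rfl⟩ := Finset.mem_add.1 hc
      simp only [hs, ht, Finset.mem_filter, Finset.mem_univ, true_and] at hc1 hc2
      obtain ⟨a, ha, rfl⟩ := hc1
      obtain ⟨b, hb, rfl⟩ := hc2
      have hval := (hx.1)
      have hval2 := (hx.2)
      rw [← Nat.cast_add, ZMod.val_natCast] at hval hval2
      set fa := ⌊a * p / d⌋₊ with hfa
      set fb := ⌊b * p / d⌋₊ with hfb
      have ea : a = (a * p / d) * (d / p) := by field_simp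
      have eb : b = (b * p / d) * (d / p) := by field_simp
      have a0 : 0 ≤ a * p / d := by have := (hA ha).1; positivity
      have b0 : 0 ≤ b * p / d := by have := (hB hb).1; positivity
      have la := Nat.floor_le a0
      have lb := Nat.floor_le b0
      have ua := Nat.lt_floor_add_one (a * p / d)
      have ub := Nat.lt_floor_add_one (b * p / d)
      rw [← hfa] at la ua
      rw [← hfb] at lb ub
      have fap : fa ≤ p := by
        have : a * p / d ≤ p := by rw [div_le_iff₀ hd]; nlinarith [(hA ha).2]
        exact_mod_cast la.trans this
      have fbp : fb ≤ p := by
        have : b * p / d ≤ p := by rw [div_le_iff₀ hd]; nlinarith [(hB hb).2]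
        exact_mod_cast lb.trans this
      have hq := Nat.div_add_mod (fa + fb) p
      set q := (fa + fb) / p
      set r := (fa + fb) % p with hr
      have hr' : r < p := Nat.mod_lt _ hp.pos
      have hq2 : q ≤ 2 := by
        have : p * q ≤ p * 2 := by omega
        exact Nat.le_of_mul_le_mul_left this hp.pos
      have hqr : (p : ℝ) * q + r = fa + fb := by exact_mod_cast hq
      have hrp : (r : ℝ) + 1 ≤ p := by exact_mod_cast hr'
      have hdp0 : 0 < d / p := by positivity
      have epd : p * (d / p) = d := by field_simp
      refine ⟨?_, ?_, ?_⟩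
      · refine Metric.mem_cthickening_of_dist_le x (a + b - q * d) ε C (h a ha b hb q hq2) ?_
        rw [Real.dist_eq, abs_le]
        have e1 : (r : ℝ) * (d / p) = (fa + fb) * (d / p) - q * d := by
          rw [← hqr, ← epd]; ring_nf; field_simp; ring
        have la' : fa * (d / p) ≤ a := by
          conv_rhs => rw [ea]
          gcongr
        have lb' : fb * (d / p) ≤ b := by
          conv_rhs => rw [eb]
          gcongr
        have ua' : a ≤ (fa + 1) * (d / p) := by
          conv_lhs => rw [ea]
          gcongr
        have ub' : b ≤ (fb + 1) * (d / p) := by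
          conv_lhs => rw [eb]
          gcongr
        constructor <;> nlinarith
      · exact le_trans (by positivity) hval
      · refine hval2.le.trans ?_
        conv_rhs => rw [← epd]
        gcongr
    have sn : s.Nonempty := by
      obtain ⟨a, ha⟩ := hAn
      exact ⟨_, by simp only [hs, Finset.mem_filter]; exact ⟨Finset.mem_univ _, a, ha, rfl⟩⟩
    have tn : t.Nonempty := by
      obtain ⟨a, ha⟩ := hBn
      exact ⟨_, by simp only [ht, Finset.mem_filter]; exact ⟨Finset.mem_univ _, a, ha, rfl⟩⟩
    have cd := ZMod.cauchy_davenport hp sn tn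
    refine le_trans ?_ h3
    have hdp0 : 0 < d / p := by positivity
    have epd : p * (d / p) = d := by field_simp
    rcases min_le_iff.1 cd with h4 | h4
    · have : (p : ℝ) ≤ (s + t).card := by exact_mod_cast h4
      have := min_le_left d (volume.real A + volume.real B)
      nlinarith
    · have h5 : s.card + t.card ≤ (s + t).card + 1 := by omega
      have : (s.card + t.card : ℝ) ≤ (s + t).card + 1 := by exact_mod_cast h5
      have := min_le_right d (volume.real A + volume.real B)
      nlinarith
  have lim : Filter.Tendsto (fun ε => volume.real (Metric.cthickening ε C ∩ Set.Icc 0 d))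
      (nhdsWithin 0 (Set.Ioi 0)) (nhds (volume.real (C ∩ Set.Icc 0 d))) := by
    have := tendsto_measure_cthickening_of_isClosed (μ := volume.restrict (Set.Icc 0 d)) (s := C)
      ⟨1, one_pos, by simpa using (measure_mono (Set.subset_univ _)).trans_lt (measure_lt_top (volume.restrict (Set.Icc 0 d)) Set.univ) |>.ne⟩ hC
    have h2 : ∀ ε, volume.restrict (Set.Icc 0 d) (Metric.cthickening ε C) =
        volume (Metric.cthickening ε C ∩ Set.Icc 0 d) := fun ε =>
      Measure.restrict_apply Metric.isClosed_cthickening.measurableSet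
    rw [Measure.restrict_apply hC.measurableSet] at this
    simp_rw [h2] at this
    exact ((ENNReal.tendsto_toReal (((measure_mono Set.inter_subset_right).trans_lt
      (by simp : volume (Set.Icc 0 d) < ⊤)).ne)).comp this).mono_left nhdsWithin_le_nhds
  have lim2 : Filter.Tendsto (fun ε => min d (volume.real A + volume.real B) - ε)
      (nhdsWithin 0 (Set.Ioi 0)) (nhds (min d (volume.real A + volume.real B) - 0)) :=
    (tendsto_const_nhds.sub Filter.tendsto_id).mono_left nhdsWithin_le_nhds
  rw [sub_zero] at lim2
  refine le_of_tendsto_of_tendsto lim2 lim ?_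
  filter_upwards [self_mem_nhdsWithin] with ε hε using step ε hε

/-- Sumset bound for compact subsets of an interval, one of which contains both endpoints. -/
theorem min_le_volume_add_of_endpoints {d : ℝ} (hd : 0 < d) {A B : Set ℝ}
    (hA : A ⊆ Set.Icc 0 d) (hB : B ⊆ Set.Icc 0 d) (hAc : IsCompact A) (hBc : IsCompact B)
    (h0 : 0 ∈ A) (h1 : d ∈ A) (hBn : B.Nonempty) :
    min (d + volume.real B) (volume.real A + 2 * volume.real B) ≤ volume.real (A + B) := by
  set C := A + B with hC
  have hCc : IsCompact C := hAc.add hBc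
  have hCsub : C ⊆ Set.Icc 0 (2 * d) := by
    rintro _ ⟨a, ha, b, hb, rfl⟩
    have := hA ha
    have := hB hb
    simp only [Set.mem_Icc] at *
    constructor <;> linarith
  set C0 := C ∩ Set.Icc 0 d
  set C1 := ((fun t => -d + t) '' C) ∩ Set.Icc 0 d with hC1
  have hC0c : IsCompact C0 := hCc.inter_right isClosed_Icc
  have hC1c : IsCompact C1 := (hCc.image (by fun_prop)).inter_right isClosed_Icc
  have hP : min d (volume.real A + volume.real B) ≤ volume.real (C0 ∪ C1) := by
    set C2 := C ∪ ((fun t => -d + t) '' C) ∪ ((fun t => -(2 * d) + t) '' C) with hC2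
    have hcl : IsClosed C2 := ((hCc.union (hCc.image (by fun_prop))).union
      (hCc.image (by fun_prop))).isClosed
    refine (min_le_volume_of_add_mod_subset hd hA hB ⟨0, h0⟩ hBn hcl ?_).trans ?_
    · intro a ha b hb q hq
      have hab : a + b ∈ C := Set.add_mem_add ha hb
      interval_cases q
      · left; left; simpa using hab
      · left; right; exact ⟨_, hab, by push_cast; ring⟩
      · right; exact ⟨_, hab, by push_cast; ring⟩
    · have : C2 ∩ Set.Icc 0 d ⊆ {0} ∪ (C0 ∪ C1) := by
        rintro x ⟨(hx | hx) | ⟨y, hy, rfl⟩, hx2⟩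
        · exact Or.inr (Or.inl ⟨hx, hx2⟩)
        · exact Or.inr (Or.inr ⟨hx, hx2⟩)
        · left
          have := (hCsub hy).2
          have := hx2.1
          simp only [Set.mem_singleton_iff] at *
          linarith
      calc volume.real (C2 ∩ Set.Icc 0 d) ≤ volume.real ({0} ∪ (C0 ∪ C1)) :=
            measureReal_mono this (measure_union_ne_top (by simp)
              (hC0c.union hC1c).measure_lt_top.ne)
        _ ≤ volume.real {(0:ℝ)} + volume.real (C0 ∪ C1) := measureReal_union_le _ _
        _ = volume.real (C0 ∪ C1) := by simp [measureReal_def]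
  have hB' : B ⊆ C0 ∩ C1 := by
    intro b hb
    refine ⟨⟨⟨0, h0, b, hb, by simp⟩, hB hb⟩, ⟨d + b, ⟨d, h1, b, hb, rfl⟩, by simp⟩, hB hb⟩
  have hBm : volume.real B ≤ volume.real (C0 ∩ C1) :=
    measureReal_mono hB' (hC0c.inter hC1c).measure_lt_top.ne
  have hsum : volume.real (C0 ∪ C1) + volume.real (C0 ∩ C1) =
      volume.real C0 + volume.real C1 :=
    measureReal_union_add_inter hC1c.measurableSet hC0c.measure_lt_top.ne hC1c.measure_lt_top.ne
  have hC1' : volume.real C1 = volume.real (C ∩ Set.Icc d (2 * d)) := by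
    rw [← Real.volume_real_image_add_left (-d) (C ∩ Set.Icc d (2 * d)), hC1,
      Set.image_inter (add_right_injective _), Set.image_const_add_Icc]
    congr 3 <;> ring
  have hC3 : volume.real (C ∩ Set.Icc d (2 * d)) ≤ volume.real (C \ Set.Icc 0 d) := by
    have : C ∩ Set.Icc d (2 * d) ⊆ {d} ∪ (C \ Set.Icc 0 d) := by
      rintro x ⟨hx, hx2⟩
      rcases hx2.1.eq_or_lt with h | h
      · left; exact h.symm
      · right; exact ⟨hx, fun h' => h.not_ge h'.2⟩
    have hfin : volume (C \ Set.Icc 0 d) ≠ ⊤ :=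
      ((measure_mono Set.sdiff_subset).trans_lt hCc.measure_lt_top).ne
    calc _ ≤ volume.real ({d} ∪ (C \ Set.Icc 0 d)) :=
          measureReal_mono this (measure_union_ne_top (by simp) hfin)
      _ ≤ volume.real {d} + volume.real (C \ Set.Icc 0 d) := measureReal_union_le _ _
      _ = _ := by simp [measureReal_def]
  have hsplit : volume.real C0 + volume.real (C \ Set.Icc 0 d) = volume.real C :=
    measureReal_inter_add_sdiff measurableSet_Icc hCc.measure_lt_top.ne
  rcases min_le_iff.1 hP with h | h
  · exact (min_le_left _ _).trans (by linarith)
  · exact (min_le_right _ _).trans (by linarith)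

/-- Translation-invariant form of `min_le_volume_add_of_endpoints`. -/
theorem min_le_volume_add {a₀ a₁ b₀ b₁ : ℝ} {A B : Set ℝ} (hAc : IsCompact A) (hBc : IsCompact B)
    (hA : A ⊆ Set.Icc a₀ a₁) (h0 : a₀ ∈ A) (h1 : a₁ ∈ A) (hB : B ⊆ Set.Icc b₀ b₁)
    (hBn : B.Nonempty) (hlen : b₁ - b₀ ≤ a₁ - a₀) :
    min (a₁ - a₀ + volume.real B) (volume.real A + 2 * volume.real B) ≤ volume.real (A + B) := by
  rcases (sub_nonneg.2 (hA h0).2).eq_or_lt with hd | hd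
  · have : volume.real B = 0 := by
      have h2 : volume.real B ≤ volume.real (Set.Icc b₀ b₁) := measureReal_mono hB (by simp)
      rw [Real.volume_real_Icc, max_eq_right (by linarith)] at h2
      exact le_antisymm h2 measureReal_nonneg
    rw [this, ← hd]
    refine (min_le_left _ _).trans ?_
    simp [measureReal_nonneg]
  have key := min_le_volume_add_of_endpoints hd (A := (fun t => -a₀ + t) '' A)
    (B := (fun t => -b₀ + t) '' B) ?_ ?_ (hAc.image (by fun_prop)) (hBc.image (by fun_prop))
    ⟨a₀, h0, by ring⟩ ⟨a₁, h1, by ring⟩ (hBn.image _)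
  · have : (fun t => -a₀ + t) '' A + (fun t => -b₀ + t) '' B =
        (fun t => (-a₀ - b₀) + t) '' (A + B) := by
      ext x
      simp only [Set.mem_add, Set.mem_image, exists_exists_and_eq_and]
      constructor
      · rintro ⟨a, ha, b, hb, rfl⟩
        exact ⟨a + b, ⟨a, ha, b, hb, rfl⟩, by ring⟩
      · rintro ⟨_, ⟨a, ha, b, hb, rfl⟩, rfl⟩
        exact ⟨a, ha, b, hb, by ring⟩
    rw [this] at key
    simpa only [Real.volume_real_image_add_left] using key
  · rintro _ ⟨a, ha, rfl⟩
    have := hA ha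
    simp only [Set.mem_Icc] at *
    constructor <;> linarith
  · rintro _ ⟨a, ha, rfl⟩
    have := hB ha
    simp only [Set.mem_Icc] at *
    constructor <;> linarith

theorem add_volume_real_le_of_isCompact {K L : Set ℝ} (hK : IsCompact K) (hL : IsCompact L)
    (hKn : K.Nonempty) (hLn : L.Nonempty) :
    volume.real K + volume.real L ≤ volume.real (K + L) := by
  have := add_volume_le_of_isCompact hK hL hKn hLn subset_rfl
  rw [measureReal_def, measureReal_def, measureReal_def,
    ← ENNReal.toReal_add hK.measure_lt_top.ne hL.measure_lt_top.ne]
  exact ENNReal.toReal_mono (hK.add hL).measure_lt_top.ne this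

theorem exists_volume_inter_Iic_eq {X : Set ℝ} (hX : IsCompact X) {g : ℝ} (hg0 : 0 ≤ g)
    (hg : g ≤ volume.real X) : ∃ t, volume.real (X ∩ Set.Iic t) = g := by
  have hXf : volume X ≠ ⊤ := hX.measure_lt_top.ne
  have hle : ∀ s t, volume.real (X ∩ Set.Iic t) ≤ volume.real (X ∩ Set.Iic s) + |t - s| := by
    intro s t
    have hsub : X ∩ Set.Iic t ⊆ (X ∩ Set.Iic s) ∪ Set.Ioc s t := by
      rintro x ⟨hx, hxt⟩
      rcases le_or_gt x s with h | h
      · exact Or.inl ⟨hx, h⟩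
      · exact Or.inr ⟨h, hxt⟩
    calc _ ≤ volume.real ((X ∩ Set.Iic s) ∪ Set.Ioc s t) :=
          measureReal_mono hsub (measure_union_ne_top
            (measure_ne_top_of_subset Set.inter_subset_left hXf) (by simp))
      _ ≤ volume.real (X ∩ Set.Iic s) + volume.real (Set.Ioc s t) := measureReal_union_le _ _
      _ ≤ _ := by
        rw [Real.volume_real_Ioc]
        gcongr
        exact max_le (le_abs_self _) (abs_nonneg _)
  have hcont : Continuous fun t => volume.real (X ∩ Set.Iic t) := by
    refine (LipschitzWith.of_dist_le_mul (K := 1) fun s t => ?_).continuous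
    rw [Real.dist_eq, Real.dist_eq, NNReal.coe_one, one_mul, abs_le]
    have h1 := hle s t
    have h2 := hle t s
    rw [abs_sub_comm] at h1
    constructor <;> linarith
  rcases X.eq_empty_or_nonempty with rfl | hne
  · exact ⟨0, by simp at hg ⊢; linarith⟩
  obtain ⟨a, ha, hal⟩ := hX.exists_isLeast hne
  obtain ⟨b, hb, hbl⟩ := hX.exists_isGreatest hne
  have h1 : volume.real (X ∩ Set.Iic (a - 1)) = 0 := by
    have : X ∩ Set.Iic (a - 1) = ∅ := by
      ext x
      simp only [Set.mem_inter_iff, Set.mem_Iic, Set.mem_empty_iff_false, iff_false, not_and,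
        not_le]
      intro hx
      linarith [hal hx]
    simp [this]
  have h2 : volume.real (X ∩ Set.Iic b) = volume.real X := by
    have : X ∩ Set.Iic b = X := Set.inter_eq_left.2 fun x hx => hbl hx
    rw [this]
  have := intermediate_value_Icc (a := a - 1) (b := b) (by linarith [hal hb]) hcont.continuousOn
  rw [h1, h2] at this
  obtain ⟨t, -, ht⟩ := this ⟨hg0, hg⟩
  exact ⟨t, ht⟩

theorem exists_volume_inter_Ici_eq {X : Set ℝ} (hX : IsCompact X) {g : ℝ} (hg0 : 0 ≤ g)
    (hg : g ≤ volume.real X) : ∃ t, volume.real (X ∩ Set.Ici t) = g := by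
  have hXf : volume X ≠ ⊤ := hX.measure_lt_top.ne
  obtain ⟨t, ht⟩ := exists_volume_inter_Iic_eq hX (g := volume.real X - g) (by linarith)
    (by linarith)
  refine ⟨t, ?_⟩
  have h1 := measureReal_inter_add_sdiff (μ := volume) (s := X) (t := Set.Iic t)
    measurableSet_Iic hXf
  have h2 : volume.real (X ∩ Set.Ici t) = volume.real (X \ Set.Iic t) := by
    rw [Set.sdiff_eq, Set.compl_Iic]
    exact measureReal_congr ((ae_eq_refl X).inter Ioi_ae_eq_Ici).symm
  linarith

/-- Points of `A` which together with their translate by `v` witness a failure of convexity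
of `A` at the point of parameter `s` in between. -/
def chordDefect {E : Type*} [AddCommGroup E] [Module ℝ E] (A : Set E) (v : E) (s : ℝ) : Set E :=
  {x | x ∈ A ∧ x + v ∈ A ∧ x + s • v ∉ A}

theorem volume_real_preimage_add_right (c : ℝ) (S : Set ℝ) :
    volume.real ((fun t => t + c) ⁻¹' S) = volume.real S := by
  rw [measureReal_def, measure_preimage_add_right, measureReal_def]

theorem three_mul_lt_volume_chordDefect_false {X Y : Set ℝ} (hX : IsCompact X) (hY : IsCompact Y)
    {a₀ a₁ b₀ b₁ : ℝ} (hX0 : IsLeast X a₀) (hX1 : IsGreatest X a₁) (hY0 : IsLeast Y b₀)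
    (hY1 : IsGreatest Y b₁) (hlen : a₁ - a₀ ≤ b₁ - b₀) {v s g : ℝ} (hs0 : 0 ≤ s) (hs1 : s ≤ 1)
    (hg0 : 0 ≤ g) (hgX : 3 * g < volume.real (chordDefect X v s))
    (hgdiam : b₁ - b₀ ≤ volume.real Y + g)
    (hXY : volume.real (X + Y) = volume.real X + volume.real Y + g) : False := by
  have hXf : volume X ≠ ⊤ := hX.measure_lt_top.ne
  have hYf : volume Y ≠ ⊤ := hY.measure_lt_top.ne
  set N := chordDefect X v s with hN
  have hNX : N ⊆ X := fun x hx => hx.1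
  have hNXm : volume.real N ≤ volume.real X := measureReal_mono hNX hXf
  obtain ⟨g', hgg', hg'⟩ : ∃ g', g < g' ∧ 3 * g' < volume.real N :=
    ⟨(g + volume.real N / 3) / 2, by linarith, by linarith⟩
  obtain ⟨x₁, hx₁⟩ := exists_volume_inter_Iic_eq hX (g := g') (by linarith) (by linarith)
  obtain ⟨x₂, hx₂⟩ := exists_volume_inter_Ici_eq hX (g := g') (by linarith) (by linarith)
  have fI : ∀ s : Set ℝ, volume (X ∩ s) ≠ ⊤ := fun s =>
    measure_ne_top_of_subset Set.inter_subset_left hXf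
  have hlt : x₁ < x₂ := by
    by_contra hcon
    push Not at hcon
    have : X ⊆ (X ∩ Set.Iic x₁) ∪ (X ∩ Set.Ici x₂) := by
      intro x hx
      rcases le_or_gt x x₁ with h | h
      · exact Or.inl ⟨hx, h⟩
      · exact Or.inr ⟨hx, (hcon.trans h.le)⟩
    have := (measureReal_mono this (measure_union_ne_top (fI _) (fI _))).trans
      (measureReal_union_le _ _)
    linarith
  have hmid : ∀ w, x₁ + b₀ < w → w < x₂ + b₁ → w ∈ X + Y := by
    intro w hw1 hw2
    by_contra hcon
    set I := Set.Icc (w - b₁) (w - b₀) with hI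
    have hXI : g' ≤ volume.real (X ∩ I) := by
      rcases le_or_gt (w - b₁) a₀ with h | h
      · rw [← hx₁]
        refine measureReal_mono (fun x hx => ⟨hx.1, ?_, ?_⟩) (fI _)
        · exact h.trans (hX0.2 hx.1)
        · have := hx.2
          simp only [Set.mem_Iic] at this
          linarith
      · rw [← hx₂]
        refine measureReal_mono (fun x hx => ⟨hx.1, ?_, ?_⟩) (fI _)
        · have := hx.2
          simp only [Set.mem_Ici] at this
          linarith
        · linarith [hX1.2 hx.1]
    set Z := (fun y => w - y) '' Y with hZ
    have hZc : IsCompact Z := hY.image (by fun_prop)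
    have hZm : volume.real Z = volume.real Y := by
      have : Z = (fun y => w + y) '' ((fun y => -y) '' Y) := by
        rw [Set.image_image]; simp only [hZ, sub_eq_add_neg]
      rw [this, Real.volume_real_image_add_left, Set.image_neg_eq_neg, measureReal_def,
        Measure.measure_neg, measureReal_def]
    have hdisj : Disjoint (X ∩ I) Z := by
      rw [Set.disjoint_left]
      rintro x ⟨hx, -⟩ ⟨y, hy, rfl⟩
      exact hcon ⟨_, hx, y, hy, by simp⟩
    have hsub : (X ∩ I) ∪ Z ⊆ I := by
      refine Set.union_subset Set.inter_subset_right ?_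
      rintro _ ⟨y, hy, rfl⟩
      have h1 := hY0.2 hy
      have h2 := hY1.2 hy
      constructor <;> simp only <;> linarith
    have h1 := measureReal_mono (μ := volume) hsub (by simp [hI])
    rw [measureReal_union hdisj hZc.measurableSet (fI _) hZc.measure_lt_top.ne, hZm, hI,
      Real.volume_real_Icc_of_le (by linarith [hY0.2 hY1.1])] at h1
    linarith
  have hsumset : g' + (x₂ + b₁ - (x₁ + b₀)) + g' ≤ volume.real (X + Y) := by
    set P₁ := (fun t => b₀ + t) '' (X ∩ Set.Iic x₁) with hP₁
    set P₃ := (fun t => b₁ + t) '' (X ∩ Set.Ici x₂) with hP₃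
    have c1 : IsCompact P₁ := (hX.inter_right isClosed_Iic).image (by fun_prop)
    have c3 : IsCompact P₃ := (hX.inter_right isClosed_Ici).image (by fun_prop)
    have hb := hY0.2 hY1.1
    have hsub : (P₁ ∪ Set.Ioo (x₁ + b₀) (x₂ + b₁)) ∪ P₃ ⊆ X + Y := by
      refine Set.union_subset (Set.union_subset ?_ fun w hw => hmid w hw.1 hw.2) ?_
      · rintro _ ⟨x, hx, rfl⟩
        exact ⟨x, hx.1, b₀, hY0.1, by simp only; ring⟩
      · rintro _ ⟨x, hx, rfl⟩
        exact ⟨x, hx.1, b₁, hY1.1, by simp only; ring⟩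
    have d1 : Disjoint P₁ (Set.Ioo (x₁ + b₀) (x₂ + b₁)) := by
      rw [Set.disjoint_left]
      rintro _ ⟨x, hx, rfl⟩ hx'
      have h1 := hx.2
      have h2 := hx'.1
      simp only [Set.mem_Iic] at h1
      linarith
    have d2 : Disjoint (P₁ ∪ Set.Ioo (x₁ + b₀) (x₂ + b₁)) P₃ := by
      rw [Set.disjoint_left]
      rintro z hz ⟨x, hx, rfl⟩
      have h1 := hx.2
      simp only [Set.mem_Ici] at h1
      rcases hz with ⟨y, hy, hxy⟩ | hz
      · have h2 := hy.2
        simp only [Set.mem_Iic] at h2 hxy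
        linarith
      · linarith [hz.2]
    have h1 := measureReal_mono (μ := volume) hsub (hX.add hY).measure_lt_top.ne
    rwa [measureReal_union d2 c3.measurableSet (measure_union_ne_top c1.measure_lt_top.ne (by simp))
      c3.measure_lt_top.ne, measureReal_union d1 measurableSet_Ioo c1.measure_lt_top.ne (by simp),
      hP₁, hP₃, Real.volume_real_image_add_left, Real.volume_real_image_add_left, hx₁, hx₂,
      Real.volume_real_Ioo_of_le (by linarith)] at h1
  set J := Set.Ioo x₁ x₂ with hJ
  have hJX : volume.real (J \ X) ≤ g' := by
    have hsub : X ⊆ (X ∩ Set.Iic x₁) ∪ (X ∩ Set.Ici x₂) ∪ (J ∩ X) := by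
      intro x hx
      rcases le_or_gt x x₁ with h | h
      · exact Or.inl (Or.inl ⟨hx, h⟩)
      rcases le_or_gt x₂ x with h' | h'
      · exact Or.inl (Or.inr ⟨hx, h'⟩)
      · exact Or.inr ⟨⟨h, h'⟩, hx⟩
    have hJf : volume J ≠ ⊤ := by simp [hJ]
    have h1 := (measureReal_mono (μ := volume) hsub
        (measure_union_ne_top (measure_union_ne_top (fI _) (fI _))
      (measure_ne_top_of_subset Set.inter_subset_left hJf))).trans (measureReal_union_le _ _)
    have h2 := measureReal_union_le (μ := volume) (X ∩ Set.Iic x₁) (X ∩ Set.Ici x₂)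
    have h3 := measureReal_inter_add_sdiff (μ := volume) (s := J) (t := X) hX.measurableSet hJf
    rw [hJ, Real.volume_real_Ioo_of_le hlt.le] at h3
    rw [← hJ] at h3
    have hYI : Y ⊆ Set.Icc b₀ b₁ := fun y hy => ⟨hY0.2 hy, hY1.2 hy⟩
    have h4 := measureReal_mono (μ := volume) hYI (by simp)
    rw [Real.volume_real_Icc_of_le (hY0.2 hY1.1)] at h4
    linarith
  have hNle : volume.real N ≤ g' + g' + g' := by
    have hJXf : volume (J \ X) ≠ ⊤ := measure_ne_top_of_subset Set.sdiff_subset (by simp [hJ])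
    have fin : ∀ c (S : Set ℝ), volume S ≠ ⊤ → volume ((fun t => t + c) ⁻¹' S) ≠ ⊤ := by
      intro c S hS
      rwa [measure_preimage_add_right]
    have bound : ∀ S₁ S₂ S₃ : Set ℝ, volume S₁ ≠ ⊤ → volume S₂ ≠ ⊤ → volume S₃ ≠ ⊤ →
        N ⊆ S₁ ∪ S₂ ∪ S₃ → volume.real N ≤ volume.real S₁ + volume.real S₂ + volume.real S₃ := by
      intro S₁ S₂ S₃ h1 h2 h3 h
      have h4 := (measureReal_mono (μ := volume) h
          (measure_union_ne_top (measure_union_ne_top h1 h2)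
        h3)).trans (measureReal_union_le _ _)
      have h5 := measureReal_union_le (μ := volume) S₁ S₂
      linarith
    rcases le_or_gt 0 v with hv | hv
    · refine (bound (X ∩ Set.Iic x₁) ((fun t => t + v) ⁻¹' (X ∩ Set.Ici x₂))
        ((fun t => t + s • v) ⁻¹' (J \ X)) (fI _) (fin _ _ (fI _)) (fin _ _ hJXf) ?_).trans ?_
      · rintro x ⟨h1, h2, h3⟩
        rcases le_or_gt x x₁ with h | h
        · exact Or.inl (Or.inl ⟨h1, h⟩)
        rcases le_or_gt x₂ (x + v) with h' | h'
        · exact Or.inl (Or.inr ⟨h2, h'⟩)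
        · refine Or.inr ⟨⟨?_, ?_⟩, h3⟩ <;> simp only [smul_eq_mul] <;> nlinarith
      · simp only [volume_real_preimage_add_right]
        linarith
    · refine (bound (X ∩ Set.Ici x₂) ((fun t => t + v) ⁻¹' (X ∩ Set.Iic x₁))
        ((fun t => t + s • v) ⁻¹' (J \ X)) (fI _) (fin _ _ (fI _)) (fin _ _ hJXf) ?_).trans ?_
      · rintro x ⟨h1, h2, h3⟩
        rcases le_or_gt x₂ x with h | h
        · exact Or.inl (Or.inl ⟨h1, h⟩)
        rcases le_or_gt (x + v) x₁ with h' | h'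
        · exact Or.inl (Or.inr ⟨h2, h'⟩)
        · refine Or.inr ⟨⟨?_, ?_⟩, h3⟩ <;> simp only [smul_eq_mul] <;> nlinarith
      · simp only [volume_real_preimage_add_right]
        linarith
  linarith

/-- One-dimensional sumset inequality with a gain coming from a failure of convexity. -/
theorem volume_add_chordDefect_le {X Y : Set ℝ} (hX : IsCompact X) (hY : IsCompact Y)
    (hXn : X.Nonempty) (hYn : Y.Nonempty) {v s : ℝ} (hs0 : 0 ≤ s) (hs1 : s ≤ 1) :
    volume.real X + volume.real Y + min (volume.real (chordDefect X v s) / 3) (volume.real Y) ≤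
      volume.real (X + Y) := by
  by_contra hcon
  push Not at hcon
  set N := chordDefect X v s with hN
  have hXf : volume X ≠ ⊤ := hX.measure_lt_top.ne
  have hNX : volume.real N ≤ volume.real X := measureReal_mono (fun x hx => hx.1) hXf
  obtain ⟨g, hg⟩ : ∃ g, volume.real (X + Y) = volume.real X + volume.real Y + g :=
    ⟨_, (add_sub_cancel _ _).symm⟩
  have hg0 : 0 ≤ g := by linarith [add_volume_real_le_of_isCompact hX hY hXn hYn]
  rw [hg] at hcon
  have hg1 : 3 * g < volume.real N := by
    linarith [min_le_left (volume.real N / 3) (volume.real Y)]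
  have hg2 : g < volume.real Y := by
    linarith [min_le_right (volume.real N / 3) (volume.real Y)]
  obtain ⟨a₀, ha₀⟩ := hX.exists_isLeast hXn
  obtain ⟨a₁, ha₁⟩ := hX.exists_isGreatest hXn
  obtain ⟨b₀, hb₀⟩ := hY.exists_isLeast hYn
  obtain ⟨b₁, hb₁⟩ := hY.exists_isGreatest hYn
  have hXI : X ⊆ Set.Icc a₀ a₁ := fun x hx => ⟨ha₀.2 hx, ha₁.2 hx⟩
  have hYI : Y ⊆ Set.Icc b₀ b₁ := fun x hx => ⟨hb₀.2 hx, hb₁.2 hx⟩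
  rcases le_or_gt (b₁ - b₀) (a₁ - a₀) with hlen | hlen
  · have h1 := min_le_volume_add hX hY hXI ha₀.1 ha₁.1 hYI hYn hlen
    have h2 : a₁ - a₀ ≤ volume.real X + g := by
      rcases min_le_iff.1 h1 with h | h <;> linarith
    have h3 : N ⊆ (fun t => t + s • v) ⁻¹' (Set.Icc a₀ a₁ \ X) := by
      rintro x ⟨hx, hxv, hxs⟩
      refine ⟨?_, hxs⟩
      have := (convex_Icc a₀ a₁) (hXI hx) (hXI hxv) (sub_nonneg.2 hs1) hs0 (by ring)
      convert this using 1
      simp only [smul_eq_mul]; ring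
    have hf : volume (Set.Icc a₀ a₁ \ X) ≠ ⊤ :=
      measure_ne_top_of_subset Set.sdiff_subset (by simp)
    have h4 := measureReal_mono (μ := volume) h3 (by rwa [measure_preimage_add_right])
    rw [volume_real_preimage_add_right] at h4
    have h5 := measureReal_sdiff_add_inter (μ := volume) (s := Set.Icc a₀ a₁) (t := X)
      hX.measurableSet
      (by simp)
    rw [Set.inter_eq_right.2 hXI, Real.volume_real_Icc_of_le (ha₀.2 ha₁.1)] at h5
    linarith
  · have h1 := min_le_volume_add hY hX hYI hb₀.1 hb₁.1 hXI hXn hlen.le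
    rw [add_comm Y X] at h1
    have h2 : b₁ - b₀ ≤ volume.real Y + g := by
      rcases min_le_iff.1 h1 with h | h <;> linarith
    exact three_mul_lt_volume_chordDefect_false hX hY ha₀ ha₁ hb₀ hb₁ hlen.le hs0 hs1 hg0 hg1 h2 hg

theorem rpow_mul_rpow_le_of_gain {lam a b n : ℝ} (h0 : 0 < lam) (h1 : lam < 1) (hb : 0 ≤ b)
    (hn : 0 ≤ n) (hna : n ≤ a) :
    (a + lam / 3 * n) ^ (1 - lam) * b ^ lam ≤
      (1 - lam) * a + lam * b + min ((1 - lam) * n / 3) (lam * b) := by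
  have ha : 0 ≤ a := hn.trans hna
  have h1' : 0 < 1 - lam := by linarith
  rcases le_total ((1 - lam) * n / 3) (lam * b) with h | h
  · rw [min_eq_left h]
    refine (Real.geom_mean_le_arith_mean2_weighted h1'.le h0.le (by positivity) hb (by ring)).trans ?_
    nlinarith [mul_nonneg h1'.le hn]
  · rw [min_eq_right h]
    have e1 := Real.geom_mean_le_arith_mean2_weighted h1'.le h0.le ha (by positivity : 0 ≤ 2 * b)
      (by ring)
    rw [Real.mul_rpow (by norm_num) hb] at e1
    have e2 : 1 + lam / 3 ≤ (2 : ℝ) ^ lam := by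
      rw [Real.rpow_def_of_pos (by norm_num)]
      have := Real.log_two_gt_d9
      refine le_trans ?_ (Real.add_one_le_exp _)
      nlinarith
    have e3 : (a + lam / 3 * n) ^ (1 - lam) ≤ (1 + lam / 3) * a ^ (1 - lam) := by
      calc (a + lam / 3 * n) ^ (1 - lam) ≤ ((1 + lam / 3) * a) ^ (1 - lam) := by
            refine Real.rpow_le_rpow (by positivity) ?_ h1'.le
            nlinarith
        _ = (1 + lam / 3) ^ (1 - lam) * a ^ (1 - lam) := Real.mul_rpow (by positivity) ha
        _ ≤ (1 + lam / 3) ^ (1 : ℝ) * a ^ (1 - lam) := by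
            gcongr
            · linarith
            · linarith
        _ = _ := by rw [Real.rpow_one]
    calc _ ≤ ((1 + lam / 3) * a ^ (1 - lam)) * b ^ lam := by gcongr
      _ ≤ ((2 : ℝ) ^ lam * a ^ (1 - lam)) * b ^ lam := by gcongr
      _ ≤ _ := by linarith

theorem chordDefect_smul {E : Type*} [AddCommGroup E] [Module ℝ E] {c : ℝ} (hc : c ≠ 0) (A : Set E)
    (v : E) (s : ℝ) : chordDefect (c • A) (c • v) s = c • chordDefect A v s := by
  ext x
  simp only [chordDefect, Set.mem_smul_set_iff_inv_smul_mem₀ hc, Set.mem_ofPred_eq, smul_add,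
    smul_smul, inv_mul_cancel₀ hc, one_smul]
  have : c⁻¹ * (s * c) = s := by field_simp
  rw [this]

theorem volume_smul_real {c : ℝ} (hc : 0 ≤ c) (s : Set ℝ) :
    volume.real (c • s) = c * volume.real s := by
  rw [measureReal_def, Measure.addHaar_smul, ENNReal.toReal_mul]
  simp [abs_of_nonneg hc, measureReal_def, ENNReal.toReal_ofReal hc]

/-- The section of a subset of `ℝ^(k+1)` above `y : ℝ^k`. -/
def firstSection {k : ℕ} (A : Set (Fin (k + 1) → ℝ)) (y : Fin k → ℝ) : Set ℝ :=
  {x | (Fin.cons x y : Fin (k + 1) → ℝ) ∈ A}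

theorem isCompact_firstSection {k : ℕ} {A : Set (Fin (k + 1) → ℝ)} (hA : IsCompact A)
    (y : Fin k → ℝ) : IsCompact (firstSection A y) := by
  refine (hA.image (continuous_apply 0)).of_isClosed_subset
    (hA.isClosed.preimage (by fun_prop)) fun x hx => ⟨_, hx, by simp⟩

theorem measurableSet_firstSection {k : ℕ} {A : Set (Fin (k + 1) → ℝ)} (hA : MeasurableSet A)
    (y : Fin k → ℝ) : MeasurableSet (firstSection A y) :=
  (measurable_finCons.comp (by fun_prop : Measurable fun x : ℝ => (x, y))) hA

theorem lintegral_volume_firstSection {k : ℕ} {A : Set (Fin (k + 1) → ℝ)} (hA : MeasurableSet A) :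
    ∫⁻ y, volume (firstSection A y) = volume A := by
  rw [← lintegral_indicator_one hA, lintegral_fin_succ (measurable_one.indicator hA)]
  refine lintegral_congr fun y => ?_
  rw [← lintegral_indicator_one (measurableSet_firstSection hA y)]
  rfl

theorem measurable_volume_firstSection {k : ℕ} {A : Set (Fin (k + 1) → ℝ)} (hA : MeasurableSet A) :
    Measurable fun y => volume (firstSection A y) := by
  exact measurable_measure_prodMk_right (μ := (volume : Measure ℝ)) (measurable_finCons hA)

theorem cons_combination {k : ℕ} (a b x x' : ℝ) (y y' : Fin k → ℝ) :
    a • (Fin.cons x y : Fin (k + 1) → ℝ) + b • (Fin.cons x' y' : Fin (k + 1) → ℝ) =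
      Fin.cons (a * x + b * x') (a • y + b • y') := by
  ext i
  refine Fin.cases ?_ (fun i => ?_) i <;> simp

theorem measurableSet_chordDefect {k : ℕ} {X : Set (Fin k → ℝ)} (hX : MeasurableSet X)
    (v : Fin k → ℝ) (s : ℝ) : MeasurableSet (chordDefect X v s) :=
  hX.inter ((measurableSet_preimage (measurable_id.add_const v) hX).inter
    (measurableSet_preimage (measurable_id.add_const (s • v)) hX).compl)

theorem brunn_minkowski_chordDefect_single {lam : ℝ} (h0 : 0 < lam) (h1 : lam < 1) {k : ℕ}
    {A B S : Set (Fin (k + 1) → ℝ)} (hA : IsCompact A) (hB : IsCompact B) (hS : MeasurableSet S)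
    (H : (1 - lam) • A + lam • B ⊆ S) {s : ℝ} (hs0 : 0 ≤ s) (hs1 : s ≤ 1) :
    (volume A + ENNReal.ofReal (lam / 3) * volume (chordDefect A (Pi.single 0 1) s)) ^ (1 - lam) *
      volume B ^ lam ≤ volume S := by
  have h1' : 0 < 1 - lam := by linarith
  set N := chordDefect A (Pi.single 0 1) s with hN
  have hNm : MeasurableSet N := measurableSet_chordDefect hA.measurableSet _ _
  have key := prekopa_leindler h0 h1
    (f := fun y => volume (firstSection A y) + ENNReal.ofReal (lam / 3) * volume (firstSection N y))
    (g := fun y => volume (firstSection B y)) (h := fun y => volume (firstSection S y))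
    ((measurable_volume_firstSection hA.measurableSet).add
      ((measurable_volume_firstSection hNm).const_mul _))
    (measurable_volume_firstSection hB.measurableSet) (measurable_volume_firstSection hS) ?_
  · rwa [lintegral_add_left (measurable_volume_firstSection hA.measurableSet),
      lintegral_const_mul _ (measurable_volume_firstSection hNm),
      lintegral_volume_firstSection hA.measurableSet,
      lintegral_volume_firstSection hB.measurableSet,
      lintegral_volume_firstSection hS, lintegral_volume_firstSection hNm] at key
  intro y y'
  have hNy : firstSection N y = chordDefect (firstSection A y) 1 s := by
    ext x
    have e : ∀ t : ℝ, (Fin.cons x y : Fin (k + 1) → ℝ) + t • Pi.single 0 1 = Fin.cons (x + t) y := by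
      intro t
      ext i
      refine Fin.cases ?_ (fun i => ?_) i <;> simp
    have e1 := e 1
    rw [one_smul] at e1
    simp only [firstSection, hN, chordDefect, Set.mem_ofPred_eq, e, e1, smul_eq_mul, mul_one]
  have hcA := isCompact_firstSection hA y
  have hcB := isCompact_firstSection hB y'
  have hsub : firstSection N y ⊆ firstSection A y := by
    rw [hNy]; exact fun x hx => hx.1
  rcases (firstSection A y).eq_empty_or_nonempty with he | hne
  · rw [he, Set.subset_empty_iff] at hsub
    simp [he, hsub, h1']
  rcases (firstSection B y').eq_empty_or_nonempty with he | hne'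
  · simp [he, h0]
  have l1 := volume_add_chordDefect_le (X := (1 - lam) • firstSection A y)
    (Y := lam • firstSection B y') (v := (1 - lam) • (1 : ℝ)) (hcA.smul _) (hcB.smul _)
    hne.smul_set hne'.smul_set hs0 hs1
  rw [chordDefect_smul h1'.ne', ← hNy, volume_smul_real h1'.le, volume_smul_real h1'.le,
    volume_smul_real h0.le] at l1
  have l2 : volume.real (firstSection N y) ≤ volume.real (firstSection A y) :=
    measureReal_mono hsub hcA.measure_lt_top.ne
  have l3 := (rpow_mul_rpow_le_of_gain h0 h1 measureReal_nonneg measureReal_nonneg l2).trans l1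
  have hNf : volume (firstSection N y) ≠ ⊤ := measure_ne_top_of_subset hsub hcA.measure_lt_top.ne
  have fA : volume (firstSection A y) = ENNReal.ofReal (volume.real (firstSection A y)) :=
    (ofReal_measureReal hcA.measure_lt_top.ne).symm
  have fB : volume (firstSection B y') = ENNReal.ofReal (volume.real (firstSection B y')) :=
    (ofReal_measureReal hcB.measure_lt_top.ne).symm
  have fN : volume (firstSection N y) = ENNReal.ofReal (volume.real (firstSection N y)) :=
    (ofReal_measureReal hNf).symm
  rw [fA, fB, fN, ← ENNReal.ofReal_mul (by positivity), ← ENNReal.ofReal_add (by positivity)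
    (by positivity), ENNReal.ofReal_rpow_of_nonneg (by positivity) h1'.le,
    ENNReal.ofReal_rpow_of_nonneg (by positivity) h0.le, ← ENNReal.ofReal_mul (by positivity)]
  refine (ENNReal.ofReal_le_ofReal l3).trans ?_
  rw [ofReal_measureReal ((hcA.smul _).add (hcB.smul _)).measure_lt_top.ne]
  refine measure_mono ?_
  rintro _ ⟨_, ⟨x, hx, rfl⟩, _, ⟨x', hx', rfl⟩, rfl⟩
  have := H (Set.add_mem_add (Set.smul_mem_smul_set hx) (Set.smul_mem_smul_set hx'))
  rwa [cons_combination] at this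

/-- The Brunn–Minkowski inequality with a gain from the failure of convexity of `A` along chords
with a given direction. -/
theorem brunn_minkowski_chordDefect {lam : ℝ} (h0 : 0 < lam) (h1 : lam < 1) {k : ℕ}
    {A B S : Set (Fin (k + 1) → ℝ)} (hA : IsCompact A) (hB : IsCompact B) (hS : MeasurableSet S)
    (H : (1 - lam) • A + lam • B ⊆ S) (v : Fin (k + 1) → ℝ) {s : ℝ} (hs0 : 0 ≤ s) (hs1 : s ≤ 1) :
    (volume A + ENNReal.ofReal (lam / 3) * volume (chordDefect A v s)) ^ (1 - lam) *
      volume B ^ lam ≤ volume S := by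
  have h1' : 0 < 1 - lam := by linarith
  rcases eq_or_ne v 0 with rfl | hv
  · have : chordDefect A 0 s = ∅ := by
      ext x; simp +contextual [chordDefect]
    rw [this]
    simpa using brunn_minkowski h0 h1 hA.measurableSet hB.measurableSet hS H
  obtain ⟨T, hT⟩ := SeparatingDual.exists_continuousLinearEquiv_apply_eq (R := ℝ)
    (x := (Pi.single 0 1 : Fin (k + 1) → ℝ)) (y := v) (by simp) hv
  have hcomp : ∀ {A : Set (Fin (k + 1) → ℝ)}, IsCompact A → IsCompact (T ⁻¹' A) := fun {A} hA => by
    rw [← T.image_symm_eq_preimage]; exact hA.image T.symm.continuous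
  have key := brunn_minkowski_chordDefect_single h0 h1 (hcomp hA) (hcomp hB)
    (S := T ⁻¹' S) (T.continuous.measurable hS) ?_ hs0 hs1
  · have hN : chordDefect (T ⁻¹' A) (Pi.single 0 1) s = T ⁻¹' chordDefect A v s := by
      ext x; simp only [chordDefect, Set.mem_preimage, Set.mem_ofPred_eq, map_add, map_smul, hT]
    rw [hN] at key
    simp only [Measure.addHaar_preimage_continuousLinearEquiv] at key
    set c := ENNReal.ofReal |LinearMap.det (T.symm : (Fin (k + 1) → ℝ) →ₗ[ℝ] (Fin (k + 1) → ℝ))| with hc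
    have hc0 : c ≠ 0 := by
      simpa [hc] using T.symm.toLinearEquiv.isUnit_det'.ne_zero
    have hct : c ≠ ⊤ := ENNReal.ofReal_ne_top
    rw [mul_left_comm, ← mul_add, ENNReal.mul_rpow_of_nonneg _ _ h1'.le,
      ENNReal.mul_rpow_of_nonneg _ _ h0.le, mul_mul_mul_comm, ← ENNReal.rpow_add _ _ hc0 hct,
      sub_add_cancel, ENNReal.rpow_one] at key
    exact (ENNReal.mul_le_mul_iff_right hc0 hct).1 key
  · rintro _ ⟨_, ⟨x, hx, rfl⟩, _, ⟨x', hx', rfl⟩, rfl⟩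
    have := H (Set.add_mem_add (Set.smul_mem_smul_set hx) (Set.smul_mem_smul_set hx'))
    simpa using this

theorem lintegral_volume_section_swap {m n : ℕ} {M : Set ((Fin m → ℝ) × (Fin n → ℝ))}
    (hM : MeasurableSet M) :
    ∫⁻ x, volume {y | (x, y) ∈ M} = ∫⁻ y, volume {x | (x, y) ∈ M} := by
  have h1 := Measure.prod_apply (μ := (volume : Measure (Fin m → ℝ)))
    (ν := (volume : Measure (Fin n → ℝ))) hM
  have h2 := Measure.prod_apply_symm (μ := (volume : Measure (Fin m → ℝ)))
    (ν := (volume : Measure (Fin n → ℝ))) hM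
  exact h1.symm.trans h2

theorem volume_affine_preimage {n : ℕ} {c : ℝ} (hc : c ≠ 0) (a : Fin n → ℝ) (S : Set (Fin n → ℝ)) :
    volume {v | a + c • v ∈ S} = ENNReal.ofReal |(c ^ n)⁻¹| * volume S := by
  have h1 : {v | a + c • v ∈ S} = (fun v => c • v) ⁻¹' ((fun v => a + v) ⁻¹' S) := rfl
  rw [h1, Measure.addHaar_preimage_smul _ hc, measure_preimage_add, Module.finrank_fin_fun]

theorem volume_affine_image {n : ℕ} (c : ℝ) (a : Fin n → ℝ) (S : Set (Fin n → ℝ)) :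
    volume ((fun v => a + c • v) '' S) = ENNReal.ofReal |c ^ n| * volume S := by
  have h1 : (fun v => a + c • v) '' S = (fun v => a + v) '' (c • S) := by
    rw [← Set.image_smul, Set.image_image]
  rw [h1, Set.image_add_left, measure_preimage_add, Measure.addHaar_smul, Module.finrank_fin_fun]

/-- The difference set of a set having a small sumset is not too large. -/
theorem volume_sub_self_le {lam : ℝ} (h0 : 0 < lam) (h1 : lam < 1) {n : ℕ}
    {A B S : Set (Fin n → ℝ)} (hA : IsCompact A) (hS : MeasurableSet S)
    (H : (1 - lam) • A + lam • B ⊆ S) :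
    ENNReal.ofReal (lam ^ n) * volume B * volume (A - A) ≤
      ENNReal.ofReal (((1 - lam) ^ n)⁻¹) * volume S * volume S := by
  have h1' : 0 < 1 - lam := by linarith
  set M : Set ((Fin n → ℝ) × (Fin n → ℝ)) := {p | p.1 ∈ S ∧ p.1 + (-(1 - lam)) • p.2 ∈ S} with hM
  have hMm : MeasurableSet M := by
    refine (measurableSet_preimage measurable_fst hS).inter
      (measurableSet_preimage (f := fun p : (Fin n → ℝ) × (Fin n → ℝ) => p.1 + (-(1 - lam)) • p.2)
        (by fun_prop) hS)
  have hsw := lintegral_volume_section_swap hMm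
  have hAA : MeasurableSet (A - A) := by
    rw [sub_eq_add_neg]; exact (hA.add hA.neg).measurableSet
  have e1 : ∫⁻ x, volume {v | (x, v) ∈ M} ≤ ENNReal.ofReal (((1 - lam) ^ n)⁻¹) * volume S * volume S := by
    have : ∀ x, volume {v | (x, v) ∈ M} ≤
        S.indicator (fun _ => ENNReal.ofReal (((1 - lam) ^ n)⁻¹) * volume S) x := by
      intro x
      by_cases hx : x ∈ S
      · rw [Set.indicator_of_mem hx]
        have hsub : {v | (x, v) ∈ M} ⊆ {v | x + (-(1 - lam)) • v ∈ S} := fun v hv => hv.2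
        refine (measure_mono hsub).trans (le_of_eq ?_)
        rw [volume_affine_preimage (by linarith)]
        congr 2
        rw [abs_inv, abs_pow, abs_neg, abs_of_pos h1']
      · rw [Set.indicator_of_notMem hx]
        have : {v | (x, v) ∈ M} = ∅ := by
          ext v; simp [hM, hx]
        simp [this]
    refine (lintegral_mono this).trans ?_
    rw [lintegral_indicator_const hS]
  refine le_trans ?_ (hsw ▸ e1)
  rw [← lintegral_indicator_const hAA]
  refine lintegral_mono fun v => ?_
  by_cases hv : v ∈ A - A
  · rw [Set.indicator_of_mem hv]
    obtain ⟨a, ha, a', ha', rfl⟩ := hv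
    have h2 := volume_affine_image lam ((1 - lam) • a) B
    rw [abs_of_pos (by positivity)] at h2
    rw [← h2]
    refine measure_mono ?_
    rintro _ ⟨b, hb, rfl⟩
    refine ⟨H (Set.add_mem_add (Set.smul_mem_smul_set ha) (Set.smul_mem_smul_set hb)), ?_⟩
    have := H (Set.add_mem_add (Set.smul_mem_smul_set ha') (Set.smul_mem_smul_set hb))
    convert this using 1
    module
  · rw [Set.indicator_of_notMem hv]; exact zero_le

/-- Measure of the pairs of points of `A` with a given convex combination outside of `A`. -/
noncomputable def pairDefect {n : ℕ} (A : Set (Fin n → ℝ)) (s : ℝ) : ℝ≥0∞ :=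
  ∫⁻ x in A, volume {x' | x' ∈ A ∧ (1 - s) • x + s • x' ∉ A}

theorem measurableSet_pairs {n : ℕ} {A B Z : Set (Fin n → ℝ)} (hA : MeasurableSet A)
    (hB : MeasurableSet B) (hZ : MeasurableSet Z) (s t : ℝ) :
    MeasurableSet {p : (Fin n → ℝ) × (Fin n → ℝ) | p.1 ∈ A ∧ p.2 ∈ B ∧ s • p.1 + t • p.2 ∈ Z} :=
  (measurableSet_preimage measurable_fst hA).inter
    ((measurableSet_preimage measurable_snd hB).inter
      (measurableSet_preimage (f := fun p : (Fin n → ℝ) × (Fin n → ℝ) => s • p.1 + t • p.2)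
        (by fun_prop) hZ))

theorem measurable_volume_pairs {n : ℕ} {B Z : Set (Fin n → ℝ)}
    (hB : MeasurableSet B) (hZ : MeasurableSet Z) (s t : ℝ) :
    Measurable fun x => volume {x' | x' ∈ B ∧ s • x + t • x' ∈ Z} := by
  have := measurable_measure_prodMk_left (ν := (volume : Measure (Fin n → ℝ)))
    (measurableSet_pairs MeasurableSet.univ hB hZ s t)
  simpa using this

theorem setLIntegral_volume_pairs {n : ℕ} {A B Z : Set (Fin n → ℝ)} (hA : MeasurableSet A)
    (s t : ℝ) :
    ∫⁻ x in A, volume {x' | x' ∈ B ∧ s • x + t • x' ∈ Z} =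
      ∫⁻ x, volume {x' | (x, x') ∈
        {p : (Fin n → ℝ) × (Fin n → ℝ) | p.1 ∈ A ∧ p.2 ∈ B ∧ s • p.1 + t • p.2 ∈ Z}} := by
  rw [← lintegral_indicator hA]
  refine lintegral_congr fun x => ?_
  by_cases hx : x ∈ A <;> simp [hx]

theorem pairDefect_le {n : ℕ} {A : Set (Fin n → ℝ)} (hA : IsCompact A) {s : ℝ} {ε : ℝ≥0∞}
    (h : ∀ v, volume (chordDefect A v s) ≤ ε) : pairDefect A s ≤ ε * volume (A - A) := by
  set M : Set ((Fin n → ℝ) × (Fin n → ℝ)) := {p | p.1 ∈ A ∧ p.1 + p.2 ∈ A ∧ p.1 + s • p.2 ∈ Aᶜ} with hM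
  have hMm : MeasurableSet M :=
    (measurableSet_preimage measurable_fst hA.measurableSet).inter
    ((measurableSet_preimage (measurable_fst.add measurable_snd) hA.measurableSet).inter
      (measurableSet_preimage (f := fun p : (Fin n → ℝ) × (Fin n → ℝ) => p.1 + s • p.2)
        (by fun_prop) hA.measurableSet.compl))
  have hAA : MeasurableSet (A - A) := by
    rw [sub_eq_add_neg]; exact (hA.add hA.neg).measurableSet
  calc pairDefect A s = ∫⁻ x, volume {v | (x, v) ∈ M} := by
        rw [pairDefect, ← lintegral_indicator hA.measurableSet]
        refine lintegral_congr fun x => ?_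
        by_cases hx : x ∈ A
        · rw [Set.indicator_of_mem hx, ← measure_preimage_add volume x]
          congr 1
          ext v
          have : (1 - s) • x + s • (x + v) = x + s • v := by module
          simp only [hM, Set.mem_preimage, Set.mem_ofPred_eq, hx, true_and, this, Set.mem_compl_iff]
        · simp [hM, hx]
    _ = ∫⁻ v, volume {x | (x, v) ∈ M} := lintegral_volume_section_swap hMm
    _ ≤ ∫⁻ v, (A - A).indicator (fun _ => ε) v := by
        refine lintegral_mono fun v => ?_
        by_cases hv : v ∈ A - A
        · rw [Set.indicator_of_mem hv]
          exact h v
        · rw [Set.indicator_of_notMem hv]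
          refine le_of_eq (measure_mono_null (t := ∅) (fun x hx => hv ?_) measure_empty)
          exact ⟨x + v, hx.2.1, x, hx.1, by simp⟩
    _ = ε * volume (A - A) := lintegral_indicator_const hAA _

/-- The measure of the set of representations of `2 z` as a sum of two elements of `A`. -/
noncomputable def midMult {n : ℕ} (A : Set (Fin n → ℝ)) (z : Fin n → ℝ) : ℝ≥0∞ :=
  volume {x | x ∈ A ∧ (2 : ℝ) • z - x ∈ A}

/-- Popular midpoints of `A`. -/
def popMid {n : ℕ} (A : Set (Fin n → ℝ)) (η : ℝ) : Set (Fin n → ℝ) :=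
  {z | ENNReal.ofReal η < midMult A z}

theorem measurable_midMult {n : ℕ} {A : Set (Fin n → ℝ)} (hA : MeasurableSet A) :
    Measurable (midMult A) := by
  have e : midMult A = fun z => volume {x | x ∈ A ∧ (2 : ℝ) • z + (-1 : ℝ) • x ∈ A} := by
    funext z; simp only [midMult, neg_one_smul, sub_eq_add_neg]
  rw [e]
  exact measurable_volume_pairs hA hA 2 (-1)

theorem setLIntegral_midMult {n : ℕ} {A Z : Set (Fin n → ℝ)} (hA : MeasurableSet A)
    (hZ : MeasurableSet Z) :
    ∫⁻ z in Z, midMult A z = ENNReal.ofReal ((1 / 2) ^ n) *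
      ∫⁻ x in A, volume {x' | x' ∈ A ∧ (1 / 2 : ℝ) • x + (1 / 2 : ℝ) • x' ∈ Z} := by
  have e1 : ∫⁻ z in Z, midMult A z =
      ∫⁻ z in Z, volume {x' | x' ∈ A ∧ (2 : ℝ) • z + (-1 : ℝ) • x' ∈ A} := by
    simp only [midMult, neg_one_smul, sub_eq_add_neg]
  rw [e1, setLIntegral_volume_pairs hZ, lintegral_volume_section_swap
    (measurableSet_pairs hZ hA hA 2 (-1)), ← lintegral_const_mul _
    (measurable_volume_pairs hA hZ _ _), ← lintegral_indicator hA]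
  refine lintegral_congr fun x => ?_
  by_cases hx : x ∈ A
  · rw [Set.indicator_of_mem hx]
    have := volume_affine_preimage (c := 2) (by norm_num) (-x)
      {x' | x' ∈ A ∧ (1 / 2 : ℝ) • x + (1 / 2 : ℝ) • x' ∈ Z}
    rw [abs_of_pos (by positivity), ← inv_pow, ← one_div] at this
    rw [← this]
    congr 1
    ext z
    have e2 : (1 / 2 : ℝ) • x + (1 / 2 : ℝ) • (-x + (2 : ℝ) • z) = z := by module
    simp only [Set.mem_ofPred_eq, e2, hx, true_and]
    rw [and_comm, neg_one_smul, add_comm]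
  · simp [hx]

theorem volume_reflect_preimage {n : ℕ} (a : Fin n → ℝ) (S : Set (Fin n → ℝ)) :
    volume {v | a - v ∈ S} = volume S := by
  have := volume_affine_preimage (c := -1) (by norm_num) a S
  simpa [sub_eq_add_neg] using this

theorem popMid_combination_aux {n : ℕ} {A : Set (Fin n → ℝ)} (hA : IsCompact A) {ε η : ℝ}
    (hη : 0 < η) (hε : 4 * ε ≤ η ^ 2) {s : ℝ} (hs : 1 / 2 ≤ s)
    (h : pairDefect A s ≤ ENNReal.ofReal ε) {z z' : Fin n → ℝ} (hz : z ∈ popMid A η)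
    (hz' : z' ∈ popMid A η) : (1 - s) • z + s • z' ∈ popMid A (η / 2 ^ (n + 1)) := by
  have hAm := hA.measurableSet
  set G : (Fin n → ℝ) → Set (Fin n → ℝ) := fun x => {x' | x' ∈ A ∧ (1 - s) • x + s • x' ∈ Aᶜ} with hG
  have hGm : Measurable fun x => volume (G x) := measurable_volume_pairs hAm hAm.compl _ _
  have hpd : ∫⁻ x in A, volume (G x) ≤ ENNReal.ofReal ε := h
  set P : Set (Fin n → ℝ) := {x | x ∈ A ∧ (2 : ℝ) • z - x ∈ A} with hP
  have hPm : MeasurableSet P := hAm.inter (measurableSet_preimage (by fun_prop) hAm)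
  obtain ⟨x, hx, hxG⟩ : ∃ x ∈ P, volume (G x) + volume (G ((2 : ℝ) • z - x)) <
      ENNReal.ofReal (η / 2) := by
    by_contra! hcon
    have i1 : ∫⁻ x in P, volume (G x) ≤ ENNReal.ofReal ε :=
      (lintegral_mono_set fun x hx => hx.1).trans hpd
    have i2 : ∫⁻ x in P, volume (G ((2 : ℝ) • z - x)) ≤ ENNReal.ofReal ε := by
      refine le_trans ?_ hpd
      rw [← lintegral_indicator hPm, ← lintegral_indicator hAm,
        ← lintegral_sub_left_eq_self _ ((2 : ℝ) • z)]
      refine lintegral_mono fun x => ?_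
      by_cases hx : (2 : ℝ) • z - x ∈ P
      · have hx2 := hx.2
        rw [sub_sub_cancel] at hx2
        rw [Set.indicator_of_mem hx, Set.indicator_of_mem hx2, sub_sub_cancel]
      · rw [Set.indicator_of_notMem hx]; exact zero_le
    have i3 : ENNReal.ofReal (η / 2) * volume P ≤ ENNReal.ofReal ε + ENNReal.ofReal ε := by
      rw [← setLIntegral_const]
      refine le_trans (setLIntegral_mono ?_ hcon) ?_
      · exact hGm.add (hGm.comp (by fun_prop))
      · rw [lintegral_add_left hGm]
        exact add_le_add i1 i2
    have i4 : ENNReal.ofReal (η / 2 * η) < ENNReal.ofReal (η / 2) * volume P := by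
      rw [ENNReal.ofReal_mul (by positivity)]
      exact ENNReal.mul_lt_mul_right (by simpa using hη) ENNReal.ofReal_ne_top hz
    have i5 : ENNReal.ofReal ε + ENNReal.ofReal ε ≤ ENNReal.ofReal (η / 2 * η) := by
      rcases le_total 0 ε with h0 | h0
      · rw [← ENNReal.ofReal_add h0 h0]
        exact ENNReal.ofReal_le_ofReal (by nlinarith)
      · simp [ENNReal.ofReal_of_nonpos h0]
    exact absurd (i4.trans_le (i3.trans i5)) (lt_irrefl _)
  set P' : Set (Fin n → ℝ) := {x | x ∈ A ∧ (2 : ℝ) • z' - x ∈ A} with hP'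
  set G2 : Set (Fin n → ℝ) := {x' | (2 : ℝ) • z' - x' ∈ G ((2 : ℝ) • z - x)} with hG2
  have v2 : volume G2 = volume (G ((2 : ℝ) • z - x)) := volume_reflect_preimage _ _
  have v1 : ENNReal.ofReal (η / 2) < volume (P' \ (G x ∪ G2)) := by
    by_contra! hcon
    have : volume P' ≤ ENNReal.ofReal η := by
      calc volume P' ≤ volume ((P' \ (G x ∪ G2)) ∪ (G x ∪ G2)) := measure_mono (by simp)
        _ ≤ volume (P' \ (G x ∪ G2)) + (volume (G x) + volume G2) :=
            (measure_union_le _ _).trans (by gcongr; exact measure_union_le _ _)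
        _ ≤ ENNReal.ofReal (η / 2) + ENNReal.ofReal (η / 2) := by
            rw [v2]; exact add_le_add hcon hxG.le
        _ = ENNReal.ofReal η := by
            rw [← ENNReal.ofReal_add (by positivity) (by positivity)]; congr 1; ring
    exact absurd (lt_of_lt_of_le hz' this) (lt_irrefl _)
  have v3 := volume_affine_image s ((1 - s) • x) (P' \ (G x ∪ G2))
  have v4 : (fun v => (1 - s) • x + s • v) '' (P' \ (G x ∪ G2)) ⊆
      {m | m ∈ A ∧ (2 : ℝ) • ((1 - s) • z + s • z') - m ∈ A} := by
    rintro _ ⟨x', ⟨hx', hn⟩, rfl⟩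
    simp only [Set.mem_union, not_or] at hn
    refine ⟨?_, ?_⟩
    · by_contra hc
      exact hn.1 ⟨hx'.1, hc⟩
    · by_contra hc
      refine hn.2 ⟨hx'.2, ?_⟩
      convert hc using 2
      module
  refine lt_of_lt_of_le ?_ (measure_mono v4)
  rw [v3]
  have h2 : ENNReal.ofReal (η / 2 ^ (n + 1)) ≤ ENNReal.ofReal |s ^ n| * ENNReal.ofReal (η / 2) := by
    rw [← ENNReal.ofReal_mul (by positivity)]
    refine ENNReal.ofReal_le_ofReal ?_
    rw [abs_of_nonneg (by positivity)]
    have : (1 / 2 : ℝ) ^ n ≤ s ^ n := by gcongr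
    calc η / 2 ^ (n + 1) = (1 / 2 : ℝ) ^ n * (η / 2) := by
          rw [one_div, inv_pow]; field_simp; ring
      _ ≤ _ := by gcongr
  refine lt_of_le_of_lt h2 (ENNReal.mul_lt_mul_right ?_ ENNReal.ofReal_ne_top v1)
  have : 0 < |s ^ n| := by positivity
  exact (ENNReal.ofReal_pos.2 this).ne'

theorem popMid_combination {n : ℕ} {A : Set (Fin n → ℝ)} (hA : IsCompact A) {ε η : ℝ}
    (hη : 0 < η) (hε : 4 * ε ≤ η ^ 2)
    (h : ∀ s : ℝ, 0 ≤ s → s ≤ 1 → pairDefect A s ≤ ENNReal.ofReal ε) {z z' : Fin n → ℝ}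
    (hz : z ∈ popMid A η) (hz' : z' ∈ popMid A η) {s : ℝ} (hs0 : 0 ≤ s) (hs1 : s ≤ 1) :
    (1 - s) • z + s • z' ∈ popMid A (η / 2 ^ (n + 1)) := by
  rcases le_total (1 / 2) s with hs | hs
  · exact popMid_combination_aux hA hη hε hs (h s hs0 hs1) hz hz'
  · have := popMid_combination_aux hA hη hε (s := 1 - s) (by linarith)
      (h (1 - s) (by linarith) (by linarith)) hz' hz
    rw [sub_sub_cancel, add_comm (s • z')] at this
    exact this

theorem popMid_anti {n : ℕ} (A : Set (Fin n → ℝ)) {η η' : ℝ} (h : η' ≤ η) :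
    popMid A η ⊆ popMid A η' :=
  fun _ hz => lt_of_le_of_lt (ENNReal.ofReal_le_ofReal h) hz

theorem convexHull_finset_popMid {n : ℕ} {A : Set (Fin n → ℝ)} (hA : IsCompact A) {ε η : ℝ}
    (hη : 0 < η) (m : ℕ) (hε : 4 * ε ≤ (η / (2 ^ (n + 1)) ^ m) ^ 2)
    (h : ∀ s : ℝ, 0 ≤ s → s ≤ 1 → pairDefect A s ≤ ENNReal.ofReal ε)
    (t : Finset (Fin n → ℝ)) (ht : (t : Set (Fin n → ℝ)) ⊆ popMid A η) (hc : t.card ≤ m + 1) :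
    convexHull ℝ (t : Set (Fin n → ℝ)) ⊆ popMid A (η / (2 ^ (n + 1)) ^ m) := by
  have hbase : ∀ m : ℕ, η / (2 ^ (n + 1)) ^ m ≤ η := fun m =>
    div_le_self hη.le (one_le_pow₀ (one_le_pow₀ (by norm_num)))
  induction m generalizing t with
  | zero =>
    rcases Finset.card_le_one_iff_subset_singleton.1 (by simpa using hc) with ⟨x, hx⟩
    have : convexHull ℝ (t : Set (Fin n → ℝ)) = t := by
      rw [(Set.Subsingleton.convex (𝕜 := ℝ) ?_).convexHull_eq]
      exact Set.Subsingleton.anti (t := {x}) Set.subsingleton_singleton (by exact_mod_cast hx)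
    rw [this]
    simpa using ht
  | succ m ih =>
    have hstep : η / (2 ^ (n + 1)) ^ (m + 1) = (η / (2 ^ (n + 1)) ^ m) / 2 ^ (n + 1) := by
      rw [pow_succ, div_div]
    have hp : 0 < η / (2 ^ (n + 1)) ^ m := by positivity
    have hε' : 4 * ε ≤ (η / (2 ^ (n + 1)) ^ m) ^ 2 := by
      refine hε.trans ?_
      rw [hstep]
      have : (η / (2 ^ (n + 1)) ^ m) / 2 ^ (n + 1) ≤ η / (2 ^ (n + 1)) ^ m :=
        div_le_self hp.le (one_le_pow₀ (by norm_num))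
      gcongr
    rcases t.eq_empty_or_nonempty with rfl | ⟨x, hx⟩
    · simp
    obtain ⟨u, hxu, rfl⟩ : ∃ u : Finset (Fin n → ℝ), x ∉ u ∧ insert x u = t :=
      ⟨t.erase x, by simp, Finset.insert_erase hx⟩
    rw [Finset.card_insert_of_notMem hxu] at hc
    rcases u.eq_empty_or_nonempty with rfl | hu
    · intro y hy
      have : y = x := by simpa using hy
      rw [this]
      exact popMid_anti A (hbase _) (ht (by simp))
    rw [Finset.coe_insert, convexHull_insert (by exact_mod_cast hu)]
    intro y hy
    rw [mem_convexJoin] at hy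
    obtain ⟨x', hx', w, hw, hy⟩ := hy
    rw [Set.mem_singleton_iff.1 hx', segment_eq_image] at hy
    obtain ⟨s, ⟨hs0, hs1⟩, rfl⟩ := hy
    rw [hstep]
    refine popMid_combination hA hp hε' h ?_ ?_ hs0 hs1
    · exact popMid_anti A (hbase m) (ht (by simp))
    · exact ih hε' u (fun y hy => ht (by simp [Finset.mem_coe.1 hy])) (by omega) hw

theorem convexHull_popMid {n : ℕ} {A : Set (Fin n → ℝ)} (hA : IsCompact A) {ε η : ℝ}
    (hη : 0 < η) (hε : 4 * ε ≤ (η / (2 ^ (n + 1)) ^ n) ^ 2)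
    (h : ∀ s : ℝ, 0 ≤ s → s ≤ 1 → pairDefect A s ≤ ENNReal.ofReal ε) :
    convexHull ℝ (popMid A η) ⊆ popMid A (η / (2 ^ (n + 1)) ^ n) := by
  intro y hy
  rw [convexHull_eq_union] at hy
  simp only [Set.mem_iUnion] at hy
  obtain ⟨t, ht, hai, hy⟩ := hy
  refine convexHull_finset_popMid hA hη n hε h t ht ?_ hy
  have := hai.card_le_finrank_succ
  simp only [Fintype.card_coe] at this
  refine this.trans ?_
  have h2 := Submodule.finrank_le (vectorSpan ℝ (Set.range ((↑) : t → Fin n → ℝ)))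
  simpa using h2

theorem isBounded_popMid {n : ℕ} {A : Set (Fin n → ℝ)} (hA : IsCompact A) (η : ℝ) :
    Bornology.IsBounded (popMid A η) := by
  have hc : IsCompact ((fun p : (Fin n → ℝ) × (Fin n → ℝ) => (1 / 2 : ℝ) • (p.1 + p.2)) '' (A ×ˢ A)) :=
    (hA.prod hA).image (by fun_prop)
  refine hc.isBounded.subset fun z hz => ?_
  have hz' : 0 < midMult A z := lt_of_le_of_lt zero_le hz
  obtain ⟨x, hx⟩ := nonempty_of_measure_ne_zero hz'.ne'
  refine ⟨(x, (2 : ℝ) • z - x), ⟨hx.1, hx.2⟩, ?_⟩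
  simp only
  module

theorem measurableSet_popMid {n : ℕ} {A : Set (Fin n → ℝ)} (hA : MeasurableSet A) (η : ℝ) :
    MeasurableSet (popMid A η) :=
  measurableSet_lt measurable_const (measurable_midMult hA)

theorem setLIntegral_midMult_compl_le {n : ℕ} {A : Set (Fin n → ℝ)} (hA : MeasurableSet A) {ε : ℝ}
    (h : pairDefect A (1 / 2) ≤ ENNReal.ofReal ε) :
    ∫⁻ z in Aᶜ, midMult A z ≤ ENNReal.ofReal ((1 / 2) ^ n) * ENNReal.ofReal ε := by
  rw [setLIntegral_midMult hA hA.compl]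
  gcongr
  refine le_trans (le_of_eq ?_) h
  rw [pairDefect]
  norm_num

theorem volume_popMid_sdiff_le {n : ℕ} {A : Set (Fin n → ℝ)} (hA : MeasurableSet A) {ε η : ℝ}
    (hη : 0 < η) (h : pairDefect A (1 / 2) ≤ ENNReal.ofReal ε) :
    volume (popMid A η \ A) ≤ ENNReal.ofReal (ε / η) := by
  have h1 := mul_meas_ge_le_lintegral (μ := volume.restrict Aᶜ) (measurable_midMult hA)
    (ENNReal.ofReal η)
  have h2 : volume (popMid A η \ A) ≤
      (volume.restrict Aᶜ) {x | ENNReal.ofReal η ≤ midMult A x} := by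
    rw [Set.sdiff_eq, ← Measure.restrict_apply (measurableSet_popMid hA η)]
    refine measure_mono fun x hx => ?_
    exact le_of_lt (show ENNReal.ofReal η < midMult A x from hx)
  have h3 : ENNReal.ofReal η * volume (popMid A η \ A) ≤ ENNReal.ofReal ε := by
    calc _ ≤ _ := by gcongr
      _ ≤ _ := h1
      _ ≤ _ := setLIntegral_midMult_compl_le hA h
      _ ≤ 1 * ENNReal.ofReal ε := by
          gcongr
          rw [ENNReal.ofReal_le_one]
          exact pow_le_one₀ (by norm_num) (by norm_num)
      _ = _ := one_mul _
  rw [ENNReal.ofReal_div_of_pos hη, ENNReal.le_div_iff_mul_le (by simp [hη]) (by simp), mul_comm]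
  exact h3

theorem setLIntegral_pairs_notMem_popMid_le {n : ℕ} {A : Set (Fin n → ℝ)} (hA : MeasurableSet A)
    {ε η : ℝ} (h : pairDefect A (1 / 2) ≤ ENNReal.ofReal ε) :
    ∫⁻ x in A, volume {x' | x' ∈ A ∧ (1 / 2 : ℝ) • x + (1 / 2 : ℝ) • x' ∈ (popMid A η)ᶜ} ≤
      ENNReal.ofReal ε + ENNReal.ofReal (2 ^ n) * (ENNReal.ofReal η * volume A) := by
  have e := setLIntegral_midMult hA (measurableSet_popMid hA η).compl
  have h1 : ∫⁻ z in (popMid A η)ᶜ, midMult A z ≤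
      ENNReal.ofReal ((1 / 2) ^ n) * ENNReal.ofReal ε + ENNReal.ofReal η * volume A := by
    calc _ ≤ ∫⁻ z in Aᶜ ∪ (A \ popMid A η), midMult A z := lintegral_mono_set (by
          intro x hx
          by_cases hxA : x ∈ A
          · exact Or.inr ⟨hxA, hx⟩
          · exact Or.inl hxA)
      _ ≤ (∫⁻ z in Aᶜ, midMult A z) + ∫⁻ z in A \ popMid A η, midMult A z :=
          lintegral_union_le _ _ _
      _ ≤ _ := by
        refine add_le_add (setLIntegral_midMult_compl_le hA h) ?_
        calc _ ≤ ∫⁻ z in A \ popMid A η, ENNReal.ofReal η :=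
              setLIntegral_mono measurable_const fun x hx => not_lt.1 hx.2
          _ = ENNReal.ofReal η * volume (A \ popMid A η) := setLIntegral_const _ _
          _ ≤ _ := by gcongr; exact Set.sdiff_subset
  rw [e] at h1
  have h2 : ENNReal.ofReal (2 ^ n) * ENNReal.ofReal ((1 / 2) ^ n) = 1 := by
    rw [← ENNReal.ofReal_mul (by positivity), ← mul_pow]; norm_num
  calc _ = ENNReal.ofReal (2 ^ n) * (ENNReal.ofReal ((1 / 2) ^ n) * _) := by
        rw [← mul_assoc, h2, one_mul]
    _ ≤ ENNReal.ofReal (2 ^ n) * (ENNReal.ofReal ((1 / 2) ^ n) * ENNReal.ofReal ε +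
          ENNReal.ofReal η * volume A) := by gcongr
    _ = _ := by rw [mul_add, ← mul_assoc, h2, one_mul]

/-- A compact set most of whose chords are almost contained in it contains almost all of a compact
convex set which in turn contains most of the midpoints of the set. -/
theorem exists_convex_core {n : ℕ} {A : Set (Fin n → ℝ)} (hA : IsCompact A) {ε η : ℝ}
    (hη : 0 < η) (hε0 : 0 ≤ ε) (hε : 4 * ε ≤ (η / (2 ^ (n + 1)) ^ n) ^ 2)
    (h : ∀ s : ℝ, 0 ≤ s → s ≤ 1 → pairDefect A s ≤ ENNReal.ofReal ε) :
    ∃ C : Set (Fin n → ℝ), IsCompact C ∧ Convex ℝ C ∧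
      volume.real (C \ A) ≤ ε / (η / (2 ^ (n + 1)) ^ n) ∧
      ∫⁻ x in A, volume {x' | x' ∈ A ∧ (1 / 2 : ℝ) • x + (1 / 2 : ℝ) • x' ∈ Cᶜ} ≤
        ENNReal.ofReal (ε + 2 ^ n * (η * volume.real A)) := by
  have hm := h (1 / 2) (by norm_num) (by norm_num)
  have hη' : 0 < η / (2 ^ (n + 1)) ^ n := by positivity
  have hconv : Convex ℝ (convexHull ℝ (popMid A η)) := convex_convexHull ℝ _
  refine ⟨closure (convexHull ℝ (popMid A η)), ?_, hconv.closure, ?_, ?_⟩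
  · exact Metric.isCompact_of_isClosed_isBounded isClosed_closure
      (isBounded_convexHull.2 (isBounded_popMid hA η)).closure
  · refine ENNReal.toReal_le_of_le_ofReal (by positivity) ?_
    refine le_trans ?_ (volume_popMid_sdiff_le hA.measurableSet hη' hm)
    refine measure_mono_ae ?_
    have hf := hconv.addHaar_frontier volume
    filter_upwards [measure_eq_zero_iff_ae_notMem.1 hf] with x hx hxC
    refine ⟨convexHull_popMid hA hη hε h ?_, hxC.2⟩
    by_contra hc
    exact hx ⟨hxC.1, fun hi => hc (interior_subset hi)⟩
  · rw [ENNReal.ofReal_add hε0 (by positivity), ENNReal.ofReal_mul (by positivity),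
      ENNReal.ofReal_mul hη.le, ofReal_measureReal hA.measure_lt_top.ne]
    refine le_trans (lintegral_mono fun x => measure_mono ?_)
      (setLIntegral_pairs_notMem_popMid_le (η := η) hA.measurableSet hm)
    exact fun x' hx' => ⟨hx'.1, fun hc => hx'.2 (subset_closure (subset_convexHull ℝ _ hc))⟩

theorem sq_volume_le_of_midpoints {n : ℕ} {A C : Set (Fin n → ℝ)} (hA : IsCompact A)
    (hC : IsCompact C) {β : ℝ} (hβ : 0 ≤ β)
    (h : ∫⁻ x in A, volume {x' | x' ∈ A ∧ (1 / 2 : ℝ) • x + (1 / 2 : ℝ) • x' ∈ Cᶜ} ≤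
      ENNReal.ofReal β) :
    volume.real A ^ 2 ≤ 2 ^ n * volume.real C * volume.real A + β := by
  have h1 : ∀ x, volume A ≤ ENNReal.ofReal (2 ^ n) * volume C +
      volume {x' | x' ∈ A ∧ (1 / 2 : ℝ) • x + (1 / 2 : ℝ) • x' ∈ Cᶜ} := by
    intro x
    have := volume_affine_preimage (c := 1 / 2) (by norm_num) ((1 / 2 : ℝ) • x) C
    rw [abs_of_pos (by positivity), ← inv_pow, one_div, inv_inv] at this
    rw [← this]
    refine le_trans (measure_mono ?_) (measure_union_le _ _)
    intro x' hx'
    by_cases hc : (2⁻¹ : ℝ) • x + (2⁻¹ : ℝ) • x' ∈ C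
    · exact Or.inl hc
    · exact Or.inr ⟨hx', by rwa [one_div]⟩
  have h2 : volume A * volume A ≤ ENNReal.ofReal (2 ^ n) * volume C * volume A +
      ENNReal.ofReal β := by
    calc volume A * volume A = ∫⁻ x in A, volume A := (setLIntegral_const _ _).symm
      _ ≤ _ := lintegral_mono fun x => h1 x
      _ ≤ _ := by
        rw [lintegral_add_left measurable_const, setLIntegral_const]
        gcongr
  have fA := (hA.measure_lt_top (μ := volume)).ne
  have fC := (hC.measure_lt_top (μ := volume)).ne
  rw [← ofReal_measureReal fA, ← ofReal_measureReal fC, ← ENNReal.ofReal_mul (by positivity),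
    ← ENNReal.ofReal_mul (by positivity), ← ENNReal.ofReal_mul (by positivity),
    ← ENNReal.ofReal_add (by positivity) (by positivity)] at h2
  rw [sq]
  exact (ENNReal.ofReal_le_ofReal_iff (by positivity)).1 h2

/-- The support function of a set. -/
noncomputable def suppFn {E : Type*} [AddCommGroup E] [TopologicalSpace E] [Module ℝ E]
    (C : Set E) (u : E →L[ℝ] ℝ) : ℝ := sSup (u '' C)

/-- The width of a set in the direction of a linear form. -/
noncomputable def wid {E : Type*} [AddCommGroup E] [TopologicalSpace E] [Module ℝ E]
    [IsTopologicalAddGroup E] (C : Set E) (u : E →L[ℝ] ℝ) : ℝ := suppFn C u + suppFn C (-u)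

section Support

variable {E : Type*} [AddCommGroup E] [TopologicalSpace E] [Module ℝ E] {C : Set E}

theorem le_suppFn (hC : IsCompact C) (u : E →L[ℝ] ℝ) {x : E} (hx : x ∈ C) : u x ≤ suppFn C u :=
  le_csSup (hC.image u.continuous).bddAbove (Set.mem_image_of_mem u hx)

theorem suppFn_le (hne : C.Nonempty) (u : E →L[ℝ] ℝ) {a : ℝ} (h : ∀ x ∈ C, u x ≤ a) :
    suppFn C u ≤ a :=
  csSup_le (hne.image u) (by rintro _ ⟨x, hx, rfl⟩; exact h x hx)

theorem exists_eq_suppFn (hC : IsCompact C) (hne : C.Nonempty) (u : E →L[ℝ] ℝ) :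
    ∃ x ∈ C, u x = suppFn C u :=
  (hC.image u.continuous).sSup_mem (hne.image u)

theorem neg_suppFn_neg_le (hC : IsCompact C) (u : E →L[ℝ] ℝ) {x : E} (hx : x ∈ C) :
    -suppFn C (-u) ≤ u x := by
  have := le_suppFn hC (-u) hx
  rw [neg_apply] at this
  linarith

variable [IsTopologicalAddGroup E]

theorem sub_le_wid (hC : IsCompact C) (u : E →L[ℝ] ℝ) {x y : E} (hx : x ∈ C) (hy : y ∈ C) :
    u x - u y ≤ wid C u := by
  have h1 := le_suppFn hC u hx
  have h2 := neg_suppFn_neg_le hC u hy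
  rw [wid]; linarith

theorem exists_eq_wid (hC : IsCompact C) (hne : C.Nonempty) (u : E →L[ℝ] ℝ) :
    ∃ x ∈ C, ∃ y ∈ C, u x = suppFn C u ∧ u y = -suppFn C (-u) ∧ u x - u y = wid C u := by
  obtain ⟨x, hx, h1⟩ := exists_eq_suppFn hC hne u
  obtain ⟨y, hy, h2⟩ := exists_eq_suppFn hC hne (-u)
  rw [neg_apply] at h2
  exact ⟨x, hx, y, hy, h1, by linarith, by rw [wid]; linarith⟩

theorem wid_nonneg (hC : IsCompact C) (hne : C.Nonempty) (u : E →L[ℝ] ℝ) : 0 ≤ wid C u := by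
  obtain ⟨x, hx⟩ := hne
  simpa using sub_le_wid hC u hx hx

end Support

theorem volume_cap_ge {n : ℕ} {C : Set (Fin n → ℝ)} (hC : IsCompact C) (hconv : Convex ℝ C)
    (hne : C.Nonempty) (u : (Fin n → ℝ) →L[ℝ] ℝ) {t D : ℝ} (h0 : 0 ≤ t) (h1 : t ≤ 1)
    (hD : t * wid C u ≤ D) :
    t ^ n * volume.real C ≤ volume.real (C ∩ {x | suppFn C u - D ≤ u x}) := by
  obtain ⟨p, hp, hpu⟩ := exists_eq_suppFn hC hne u
  have h2 := volume_affine_image t ((1 - t) • p) C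
  have h3 : volume.real ((fun v => (1 - t) • p + t • v) '' C) = t ^ n * volume.real C := by
    rw [measureReal_def, h2, ENNReal.toReal_mul, ENNReal.toReal_ofReal (by positivity),
      abs_of_nonneg (by positivity), measureReal_def]
  rw [← h3]
  refine measureReal_mono ?_ (measure_ne_top_of_subset Set.inter_subset_left hC.measure_lt_top.ne)
  rintro _ ⟨x, hx, rfl⟩
  refine ⟨hconv hp hx (by linarith) h0 (by ring), ?_⟩
  have h4 := sub_le_wid hC u hp hx
  simp only [Set.mem_ofPred_eq, map_add, map_smul, smul_eq_mul]
  rw [hpu] at h4 ⊢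
  nlinarith

theorem lt_of_volume_cap_lt {n : ℕ} {C : Set (Fin n → ℝ)} (hC : IsCompact C) (hconv : Convex ℝ C)
    (hne : C.Nonempty) (u : (Fin n → ℝ) →L[ℝ] ℝ) {t D : ℝ} (h0 : 0 ≤ t) (h1 : t ≤ 1)
    (h : volume.real (C ∩ {x | suppFn C u - D ≤ u x}) < t ^ n * volume.real C) :
    D < t * wid C u := by
  by_contra! hcon
  exact absurd h (not_lt.2 (volume_cap_ge hC hconv hne u h0 h1 hcon))

/-- A compact convex set has a point about which it is not too asymmetric. -/
theorem exists_center {n : ℕ} {C : Set (Fin n → ℝ)} (hC : IsCompact C) (hconv : Convex ℝ C)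
    (hne : C.Nonempty) :
    ∃ z ∈ C, ∀ u : (Fin n → ℝ) →L[ℝ] ℝ, wid C u ≤ (n + 1) * (suppFn C u - u z) := by
  have hn : (0 : ℝ) < n + 1 := by positivity
  set F : C → Set (Fin n → ℝ) := fun x =>
    (fun y => (1 / (n + 1) : ℝ) • (x : Fin n → ℝ) + (n / (n + 1) : ℝ) • y) '' C with hF
  have hsum : (1 / (n + 1) : ℝ) + (n / (n + 1) : ℝ) = 1 := by field_simp; ring
  have hFc : ∀ x, IsCompact (F x) := fun x => hC.image (by fun_prop)
  have hFconv : ∀ x, Convex ℝ (F x) := fun x => by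
    have e : F x = (fun z => (1 / (n + 1) : ℝ) • (x : Fin n → ℝ) + z) '' ((n / (n + 1) : ℝ) • C) := by
      rw [← Set.image_smul, Set.image_image]
    rw [e]
    exact (hconv.smul _).translate _
  have key : (⋂ x, F x).Nonempty := by
    refine Convex.helly_theorem_compact' (𝕜 := ℝ) hFconv hFc ?_
    intro I hI
    rw [Module.finrank_fin_fun] at hI
    rcases I.eq_empty_or_nonempty with rfl | ⟨x0, hx0⟩
    · simp
    obtain ⟨c, hc⟩ := hne
    set m := n + 1 - I.card with hm
    have hm' : (I.card : ℝ) + m = n + 1 := by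
      rw [hm, Nat.cast_sub hI]; push_cast; ring
    set z : Fin n → ℝ := (1 / (n + 1) : ℝ) • (∑ x ∈ I, (x : Fin n → ℝ) + (m : ℝ) • c) with hz
    refine ⟨z, ?_⟩
    simp only [Set.mem_iInter]
    intro x hx
    rcases Nat.eq_zero_or_pos n with h0 | h0
    · subst h0
      exact ⟨c, hc, Subsingleton.elim _ _⟩
    have hnp : (0 : ℝ) < n := by exact_mod_cast h0
    have hz2 : z = (1 / (n + 1) : ℝ) • (x : Fin n → ℝ) +
        (n / (n + 1) : ℝ) • ((1 / n : ℝ) • (∑ y ∈ I.erase x, (y : Fin n → ℝ) + (m : ℝ) • c)) := by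
      rw [smul_smul, hz, ← Finset.add_sum_erase I _ hx, add_assoc, smul_add]
      congr 2
      field_simp
    refine ⟨(1 / n : ℝ) • (∑ y ∈ I.erase x, (y : Fin n → ℝ) + (m : ℝ) • c), ?_, hz2.symm⟩
    have hcard : ((I.erase x).card : ℝ) + m = n := by
      have := Finset.card_erase_add_one hx
      have h3 : ((I.erase x).card : ℝ) + 1 = I.card := by exact_mod_cast this
      linarith
    have e := hconv.sum_mem (t := insert none ((I.erase x).map Function.Embedding.some))
      (w := fun o => o.elim (m / n : ℝ) fun _ => 1 / n) (z := fun o => o.elim c fun y => (y : Fin n → ℝ))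
      ?_ ?_ ?_
    · rw [Finset.sum_insert (by simp), Finset.sum_map] at e
      simp only [Option.elim_none, Function.Embedding.some_apply, Option.elim_some] at e
      convert e using 1
      rw [smul_add, smul_smul, add_comm, Finset.smul_sum]
      congr 2
      ring
    · rintro (_ | y) _
      · simp only [Option.elim_none]; positivity
      · simp only [Option.elim_some]; positivity
    · rw [Finset.sum_insert (by simp), Finset.sum_map]
      simp only [Option.elim_none, Function.Embedding.some_apply, Option.elim_some,
        Finset.sum_const, nsmul_eq_mul]
      rw [← mul_one_div (m : ℝ), ← add_mul, add_comm, hcard]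
      field_simp
    · rintro (_ | y) _
      · exact hc
      · exact y.2
  obtain ⟨z, hz⟩ := key
  simp only [Set.mem_iInter] at hz
  have hzC : z ∈ C := by
    obtain ⟨c, hc⟩ := hne
    obtain ⟨y, hy, rfl⟩ := hz ⟨c, hc⟩
    exact hconv hc hy (by positivity) (by positivity) hsum
  refine ⟨z, hzC, fun u => ?_⟩
  obtain ⟨-, -, y, hy, -, h1, -⟩ := exists_eq_wid hC hne u
  obtain ⟨y', hy', h2⟩ := hz ⟨y, hy⟩
  have h3 : u z = 1 / (n + 1) * u y + n / (n + 1) * u y' := by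
    rw [← h2]; simp
  have h4 := le_suppFn hC u hy'
  rw [h3, wid]
  have h5 : ((n : ℝ) + 1) * (suppFn C u - (1 / (n + 1) * u y + n / (n + 1) * u y')) =
      (n + 1) * suppFn C u - u y - n * u y' := by
    field_simp; ring
  rw [h5, h1]
  nlinarith [(Nat.cast_nonneg n : (0 : ℝ) ≤ n)]

theorem mem_dilation_of_le {n : ℕ} {C : Set (Fin n → ℝ)} (hC : IsCompact C) (hconv : Convex ℝ C)
    (hne : C.Nonempty) {z x : Fin n → ℝ} {T : ℝ} (hT : 0 ≤ T)
    (hz : ∀ u : (Fin n → ℝ) →L[ℝ] ℝ, wid C u ≤ (n + 1) * (suppFn C u - u z))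
    (h : ∀ u : (Fin n → ℝ) →L[ℝ] ℝ, u x ≤ suppFn C u + T * wid C u) :
    x ∈ (fun y => (-((n + 1) * T)) • z + (1 + (n + 1) * T) • y) '' C := by
  by_contra hx
  have hcl : IsCompact ((fun y => (-((n + 1) * T)) • z + (1 + (n + 1) * T) • y) '' C) :=
    hC.image (by fun_prop)
  have hcv : Convex ℝ ((fun y => (-((n + 1) * T)) • z + (1 + (n + 1) * T) • y) '' C) := by
    have e : (fun y => (-((n + 1) * T)) • z + (1 + (n + 1) * T) • y) '' C =
        (fun y => (-((n + 1) * T)) • z + y) '' ((1 + (n + 1) * T) • C) := by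
      rw [← Set.image_smul, Set.image_image]
    rw [e]
    exact (hconv.smul _).translate _
  obtain ⟨u, a, h1, h2⟩ := geometric_hahn_banach_closed_point hcv hcl.isClosed hx
  obtain ⟨p, hp, hpu⟩ := exists_eq_suppFn hC hne u
  have h3 := h1 _ ⟨p, hp, rfl⟩
  simp only [map_add, map_smul, smul_eq_mul, hpu] at h3
  nlinarith [h u, mul_le_mul_of_nonneg_left (hz u) hT]

theorem volume_real_affine_image {n : ℕ} {c : ℝ} (hc : 0 ≤ c) (a : Fin n → ℝ)
    (S : Set (Fin n → ℝ)) :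
    volume.real ((fun v => a + c • v) '' S) = c ^ n * volume.real S := by
  rw [measureReal_def, volume_affine_image, ENNReal.toReal_mul, ENNReal.toReal_ofReal (by positivity),
    abs_of_nonneg (by positivity), measureReal_def]

theorem volume_le_of_midpoints {n : ℕ} {A C : Set (Fin n → ℝ)} (hA : IsCompact A)
    (hC : IsCompact C) (hconv : Convex ℝ C) (hne : C.Nonempty) {β γ q t : ℝ} (hq : 0 < q)
    (hβ : β ≤ q ^ 2) (hCA : volume.real (C \ A) ≤ γ)
    (h : ∫⁻ x in A, volume {x' | x' ∈ A ∧ (1 / 2 : ℝ) • x + (1 / 2 : ℝ) • x' ∈ Cᶜ} ≤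
      ENNReal.ofReal β) (ht0 : 0 ≤ t) (ht1 : t ≤ 1) (hcap : q + γ < t ^ n * volume.real C) :
    volume.real A ≤ q + (1 + (n + 1) * t) ^ n * volume.real C := by
  set G : (Fin n → ℝ) → Set (Fin n → ℝ) :=
    fun x => {x' | x' ∈ A ∧ (1 / 2 : ℝ) • x + (1 / 2 : ℝ) • x' ∈ Cᶜ} with hG
  have hGm : Measurable fun x => volume (G x) :=
    measurable_volume_pairs hA.measurableSet hC.measurableSet.compl _ _
  set Bd : Set (Fin n → ℝ) := {x | x ∈ A ∧ ENNReal.ofReal q ≤ volume (G x)} with hBd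
  have hBdm : volume Bd ≤ ENNReal.ofReal q := by
    have h1 := mul_meas_ge_le_lintegral (μ := volume.restrict A) hGm (ENNReal.ofReal q)
    have h2 : (volume.restrict A) {x | ENNReal.ofReal q ≤ volume (G x)} = volume Bd := by
      rw [Measure.restrict_apply (measurableSet_le measurable_const hGm), Set.inter_comm]
      rfl
    rw [h2] at h1
    have h3 : ENNReal.ofReal q * volume Bd ≤ ENNReal.ofReal q * ENNReal.ofReal q := by
      refine (h1.trans h).trans ?_
      rw [← ENNReal.ofReal_mul hq.le, ← sq]
      exact ENNReal.ofReal_le_ofReal hβ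
    exact (ENNReal.mul_le_mul_iff_right (by simpa using hq) ENNReal.ofReal_ne_top).1 h3
  obtain ⟨z, hzC, hz⟩ := exists_center hC hconv hne
  set L := (fun y => (-((n + 1) * t)) • z + (1 + (n + 1) * t) • y) '' C with hL
  have hLc : IsCompact L := hC.image (by fun_prop)
  have hsub : A ⊆ Bd ∪ L := by
    intro x hx
    by_cases hxB : ENNReal.ofReal q ≤ volume (G x)
    · exact Or.inl ⟨hx, hxB⟩
    right
    rw [not_le] at hxB
    refine mem_dilation_of_le hC hconv hne ht0 hz fun u => ?_
    by_contra! hcon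
    have h1 := volume_cap_ge hC hconv hne u ht0 ht1 le_rfl
    have h2 : C ∩ {x' | suppFn C u - t * wid C u ≤ u x'} ⊆ G x ∪ C \ A := by
      rintro x' ⟨hx'C, hx'u⟩
      by_cases hx'A : x' ∈ A
      · refine Or.inl ⟨hx'A, fun hmid => ?_⟩
        have := le_suppFn hC u hmid
        simp only [Set.mem_ofPred_eq, map_add, map_smul, smul_eq_mul] at hx'u this
        linarith
      · exact Or.inr ⟨hx'C, hx'A⟩
    have h3 : volume.real (G x) < q := by
      rw [measureReal_def]
      exact (ENNReal.lt_ofReal_iff_toReal_lt hxB.ne_top).1 hxB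
    have h4 : volume.real (C ∩ {x' | suppFn C u - t * wid C u ≤ u x'}) ≤ volume.real (G x) +
        volume.real (C \ A) :=
      (measureReal_mono h2 (measure_union_ne_top hxB.ne_top
        (measure_ne_top_of_subset Set.sdiff_subset hC.measure_lt_top.ne))).trans
        (measureReal_union_le _ _)
    linarith
  have hfin : volume Bd ≠ ⊤ := (hBdm.trans_lt ENNReal.ofReal_lt_top).ne
  calc volume.real A ≤ volume.real (Bd ∪ L) :=
        measureReal_mono hsub (measure_union_ne_top hfin hLc.measure_lt_top.ne)
    _ ≤ volume.real Bd + volume.real L := measureReal_union_le _ _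
    _ ≤ _ := by
      rw [hL, volume_real_affine_image (by positivity)]
      gcongr
      exact ENNReal.toReal_le_of_le_ofReal hq.le hBdm

theorem one_add_mul_half_le_rpow {p x : ℝ} (hp : 0 ≤ p) (h0 : 0 ≤ x) (h1 : x ≤ 1) :
    1 + p * x / 2 ≤ (1 + x) ^ p := by
  rw [Real.rpow_def_of_pos (by linarith)]
  refine le_trans ?_ (Real.add_one_le_exp _)
  have h2 := Real.one_sub_inv_le_log_of_pos (by linarith : 0 < 1 + x)
  have h3 : x / 2 ≤ 1 - (1 + x)⁻¹ := by
    have : 1 - (1 + x)⁻¹ = x / (1 + x) := by field_simp; ring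
    rw [this]
    gcongr
    linarith
  nlinarith [mul_le_mul_of_nonneg_left (h3.trans h2) hp]

theorem volume_chordDefect_le {lam τ δ : ℝ} (hτ : 0 < τ) (h0 : τ ≤ lam) (h1 : τ ≤ 1 - lam) {k : ℕ}
    {A B S : Set (Fin (k + 1) → ℝ)} (hA : IsCompact A) (hB : IsCompact B) (hS : MeasurableSet S)
    (H : (1 - lam) • A + lam • B ⊆ S) (hδ0 : 0 ≤ δ) (hδ1 : δ ≤ 1 / 2)
    (hA0 : 1 - δ ≤ volume.real A) (hA1 : volume.real A ≤ 1) (hB0 : 1 - δ ≤ volume.real B)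
    (hSv : volume S ≤ ENNReal.ofReal (1 + δ)) (v : Fin (k + 1) → ℝ) {s : ℝ} (hs0 : 0 ≤ s)
    (hs1 : s ≤ 1) : volume (chordDefect A v s) ≤ ENNReal.ofReal (27 * δ / τ ^ 2) := by
  have hl0 : 0 < lam := by linarith
  have hl1 : 0 < 1 - lam := by linarith
  have key := (brunn_minkowski_chordDefect hl0 (by linarith) hA hB hS H v hs0 hs1).trans hSv
  have hsub : chordDefect A v s ⊆ A := fun x hx => hx.1
  have fA := (hA.measure_lt_top (μ := volume)).ne
  have fB := (hB.measure_lt_top (μ := volume)).ne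
  have fN : volume (chordDefect A v s) ≠ ⊤ := measure_ne_top_of_subset hsub fA
  have hNA : volume.real (chordDefect A v s) ≤ volume.real A := measureReal_mono hsub fA
  rw [← ofReal_measureReal fN]
  rw [← ofReal_measureReal fN, ← ofReal_measureReal fA, ← ofReal_measureReal fB,
    ← ENNReal.ofReal_mul (by positivity), ← ENNReal.ofReal_add (by positivity)
    (by positivity), ENNReal.ofReal_rpow_of_nonneg (by positivity) hl1.le,
    ENNReal.ofReal_rpow_of_nonneg (by positivity) hl0.le, ← ENNReal.ofReal_mul (by positivity),
    ENNReal.ofReal_le_ofReal_iff (by positivity)] at key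
  set N := volume.real (chordDefect A v s) with hN
  have hN0 : 0 ≤ N := measureReal_nonneg
  refine ENNReal.ofReal_le_ofReal ?_
  set X := volume.real A + lam / 3 * N with hX
  have e1 : 1 - δ ≤ volume.real B ^ lam := by
    calc 1 - δ = (1 - δ) ^ (1 : ℝ) := (Real.rpow_one _).symm
      _ ≤ (1 - δ) ^ lam :=
          Real.rpow_le_rpow_of_exponent_ge (by linarith) (by linarith) (by linarith)
      _ ≤ _ := Real.rpow_le_rpow (by linarith) hB0 hl0.le
  have hX0 : 0 ≤ X := by positivity
  have e2 : X ^ (1 - lam) ≤ 1 + 4 * δ := by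
    have : X ^ (1 - lam) * (1 - δ) ≤ 1 + δ :=
      (mul_le_mul_of_nonneg_left e1 (by positivity)).trans key
    by_contra! hc
    nlinarith
  rw [le_div_iff₀ (by positivity)]
  have hll : τ ^ 2 ≤ lam * (1 - lam) := by nlinarith
  have hτ1 : τ ≤ 1 := by linarith
  rcases le_total X 1 with hX1 | hX1
  · have : lam / 3 * N ≤ δ := by linarith
    nlinarith [mul_le_mul_of_nonneg_right h0 (mul_nonneg hN0 hτ.le), mul_nonneg hτ.le hN0]
  · have e3 := one_add_mul_half_le_rpow (p := 1 - lam) (x := X - 1) hl1.le (by linarith)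
      (by nlinarith)
    rw [add_sub_cancel] at e3
    have e4 : (1 - lam) * (X - 1) ≤ 8 * δ := by linarith
    have e5 : (1 - lam) * (lam / 3 * N) ≤ 9 * δ := by
      have : lam / 3 * N ≤ (X - 1) + δ := by linarith
      nlinarith
    nlinarith [mul_le_mul_of_nonneg_left hll hN0]

theorem pairDefect_le_of_sumset {lam τ δ : ℝ} (hτ : 0 < τ) (h0 : τ ≤ lam) (h1 : τ ≤ 1 - lam) {k : ℕ}
    {A B S : Set (Fin (k + 1) → ℝ)} (hA : IsCompact A) (hB : IsCompact B) (hS : MeasurableSet S)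
    (H : (1 - lam) • A + lam • B ⊆ S) (hδ0 : 0 ≤ δ) (hδ1 : δ ≤ 1 / 2)
    (hA0 : 1 - δ ≤ volume.real A) (hA1 : volume.real A ≤ 1) (hB0 : 1 - δ ≤ volume.real B)
    (hSv : volume S ≤ ENNReal.ofReal (1 + δ)) {s : ℝ} (hs0 : 0 ≤ s)
    (hs1 : s ≤ 1) : pairDefect A s ≤ ENNReal.ofReal (135 * δ / τ ^ (2 * (k + 1) + 2)) := by
  have e1 := pairDefect_le hA (s := s) fun v =>
    volume_chordDefect_le hτ h0 h1 hA hB hS H hδ0 hδ1 hA0 hA1 hB0 hSv v hs0 hs1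
  have e2 := volume_sub_self_le (by linarith : 0 < lam) (by linarith) hA hS H (B := B)
  have hAA : IsCompact (A - A) := by
    rw [sub_eq_add_neg]; exact hA.add hA.neg
  have fAA := (hAA.measure_lt_top (μ := volume)).ne
  have fB := (hB.measure_lt_top (μ := volume)).ne
  have hl0 : 0 < lam := by linarith
  have hl1 : 0 < 1 - lam := by linarith
  have e3 : volume (A - A) ≤ ENNReal.ofReal (5 / τ ^ (2 * (k + 1))) := by
    have e4 : ENNReal.ofReal (lam ^ (k + 1)) * volume B * volume (A - A) ≤
        ENNReal.ofReal (((1 - lam) ^ (k + 1))⁻¹) * ENNReal.ofReal (1 + δ) * ENNReal.ofReal (1 + δ) :=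
      e2.trans (by gcongr)
    rw [← ofReal_measureReal fAA]
    rw [← ofReal_measureReal fAA, ← ofReal_measureReal fB, ← ENNReal.ofReal_mul (by positivity),
      ← ENNReal.ofReal_mul (by positivity), ← ENNReal.ofReal_mul (by positivity),
      ← ENNReal.ofReal_mul (by positivity), ENNReal.ofReal_le_ofReal_iff (by positivity)] at e4
    refine ENNReal.ofReal_le_ofReal ?_
    set D := volume.real (A - A)
    have hD : 0 ≤ D := measureReal_nonneg
    rw [le_div_iff₀ (by positivity), pow_mul', sq]
    have p1 : τ ^ (k + 1) ≤ lam ^ (k + 1) := by gcongr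
    have p2 : τ ^ (k + 1) ≤ (1 - lam) ^ (k + 1) := by gcongr
    set T := τ ^ (k + 1)
    have hT : 0 < T := by positivity
    have p3 : ((1 - lam) ^ (k + 1))⁻¹ * T ≤ 1 := by
      rw [inv_mul_le_iff₀ (by positivity)]; linarith
    have p4 : T * (1 / 2) * D ≤ ((1 - lam) ^ (k + 1))⁻¹ * (1 + δ) * (1 + δ) := by
      refine le_trans ?_ e4
      gcongr
      linarith
    calc D * (T * T) = 2 * ((T * (1 / 2) * D) * T) := by ring
      _ ≤ 2 * ((((1 - lam) ^ (k + 1))⁻¹ * (1 + δ) * (1 + δ)) * T) := by gcongr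
      _ = 2 * (((1 - lam) ^ (k + 1))⁻¹ * T) * ((1 + δ) * (1 + δ)) := by ring
      _ ≤ 2 * 1 * ((1 + 1 / 2) * (1 + 1 / 2)) := by gcongr
      _ ≤ 5 := by norm_num
  refine e1.trans ((mul_le_mul_right e3 _).trans (le_of_eq ?_))
  rw [← ENNReal.ofReal_mul (by positivity), pow_add]
  congr 1
  field_simp
  ring

theorem rpow_mul_rpow_le_of_ratio {lam κ f g : ℝ} (h0 : 0 < lam) (h1 : lam < 1) (hκ0 : 0 < κ)
    (hκ1 : κ < 1) (hf : 0 ≤ f) (hfg : f ≤ (1 - κ) ^ 2 * g) :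
    f ^ (1 - lam) * ((1 + (1 - lam) * κ ^ 2) * g) ^ lam ≤ (1 - lam) * f + lam * g := by
  have h1' : 0 < 1 - lam := by linarith
  have hk : 0 < (1 - κ) ^ 2 := by have : 0 < 1 - κ := by linarith
                                  positivity
  have hg : 0 ≤ g := by
    by_contra! hc
    nlinarith
  have hfg' : f ≤ g := by
    refine hfg.trans (mul_le_of_le_one_left hg ?_)
    nlinarith
  set a := Real.sqrt f with ha
  set b := Real.sqrt g with hb
  have ea : a ^ 2 = f := Real.sq_sqrt hf
  have eb : b ^ 2 = g := Real.sq_sqrt hg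
  have ha0 : 0 ≤ a := Real.sqrt_nonneg _
  have hb0 : 0 ≤ b := Real.sqrt_nonneg _
  have hab : a ≤ (1 - κ) * b := by
    have hkb : 0 ≤ (1 - κ) * b := mul_nonneg (by linarith) hb0
    refine (pow_le_pow_iff_left₀ ha0 hkb two_ne_zero).1 ?_
    rw [mul_pow, ea, eb]; exact hfg
  have e1 := Real.geom_mean_le_arith_mean2_weighted h1'.le h0.le ha0 hb0 (by ring)
  have e2 : f ^ (1 - lam) * g ^ lam ≤ ((1 - lam) * a + lam * b) ^ 2 := by
    have : f ^ (1 - lam) * g ^ lam = (a ^ (1 - lam) * b ^ lam) ^ 2 := by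
      rw [mul_pow, ← Real.rpow_natCast, ← Real.rpow_natCast, ← Real.rpow_mul ha0,
        ← Real.rpow_mul hb0, mul_comm (1 - lam), mul_comm lam, Real.rpow_mul ha0, Real.rpow_mul hb0,
        Real.rpow_natCast, Real.rpow_natCast, ea, eb]
    rw [this]
    gcongr
  set e := lam * (1 - lam) * κ ^ 2 with he
  have he0 : 0 ≤ e := by positivity
  set M := (1 - lam) * f + lam * g with hM
  have e3 : f ^ (1 - lam) * g ^ lam ≤ M - e * g := by
    have : κ ^ 2 * g ≤ (b - a) ^ 2 := by
      rw [← eb, ← mul_pow]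
      gcongr
      linarith
    have h3 : ((1 - lam) * a + lam * b) ^ 2 = M - lam * (1 - lam) * (b - a) ^ 2 := by
      rw [hM, ← ea, ← eb]; ring
    rw [h3] at e2
    have := mul_le_mul_of_nonneg_left this (mul_nonneg h0.le h1'.le)
    rw [he]; linarith
  have e4 : (1 + (1 - lam) * κ ^ 2) ^ lam ≤ 1 + e := by
    have := rpow_one_add_le_one_add_mul_self (s := (1 - lam) * κ ^ 2) (p := lam)
      (by have : 0 ≤ (1 - lam) * κ ^ 2 := by positivity
          linarith) h0.le h1.le
    rw [he]; linarith
  have hMg : M ≤ g := by rw [hM]; nlinarith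
  rw [Real.mul_rpow (by positivity) hg]
  calc f ^ (1 - lam) * ((1 + (1 - lam) * κ ^ 2) ^ lam * g ^ lam) =
        (1 + (1 - lam) * κ ^ 2) ^ lam * (f ^ (1 - lam) * g ^ lam) := by ring
    _ ≤ (1 + e) * (f ^ (1 - lam) * g ^ lam) := by gcongr
    _ ≤ (1 + e) * (M - e * g) := by gcongr
    _ ≤ M := by nlinarith [mul_nonneg he0 (sub_nonneg.2 hMg), mul_nonneg (mul_nonneg he0 he0) hg]

theorem brunn_minkowski_width_single {lam κ : ℝ} (h0 : 0 < lam) (h1 : lam < 1) (hκ0 : 0 < κ)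
    (hκ1 : κ < 1) {k : ℕ} {X Y S : Set (Fin (k + 1) → ℝ)} (hX : IsCompact X) (hY : IsCompact Y)
    (hYc : Convex ℝ Y) (hS : MeasurableSet S) (H : (1 - lam) • X + lam • Y ⊆ S)
    {p : Fin (k + 1) → ℝ} (hp : p ∈ Y) (hp1 : p + Pi.single 0 1 ∈ Y)
    (hXs : ∀ x ∈ X, ∀ s : ℝ, x + s • Pi.single 0 1 ∈ X → s ≤ (1 - κ) ^ 4) :
    volume X ^ (1 - lam) * (ENNReal.ofReal (1 + (1 - lam) * κ ^ 2 * κ ^ (k + 1)) * volume Y) ^ lam ≤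
      volume S := by
  have h1' : 0 < 1 - lam := by linarith
  have hk : 0 < 1 - κ := by linarith
  have hline : ∀ (x : ℝ) (y : Fin k → ℝ) (t : ℝ), (Fin.cons x y : Fin (k + 1) → ℝ) +
      t • Pi.single 0 1 = Fin.cons (x + t) y := by
    intro x y t
    ext i
    refine Fin.cases ?_ (fun i => ?_) i <;> simp
  set g : (Fin k → ℝ) → ℝ≥0∞ := fun y => volume (firstSection Y y) with hg
  have hgm : Measurable g := measurable_volume_firstSection hY.measurableSet
  set G : Set (Fin k → ℝ) := {y | ENNReal.ofReal (1 - κ) ≤ g y} with hG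
  have hGm : MeasurableSet G := measurableSet_le measurable_const hgm
  set c := (1 - lam) * κ ^ 2 with hc
  have hc0 : 0 < c := by positivity
  have key := prekopa_leindler h0 h1
    (f := fun y => volume (firstSection X y))
    (g := fun y => g y + ENNReal.ofReal c * G.indicator g y)
    (h := fun y => volume (firstSection S y))
    (measurable_volume_firstSection hX.measurableSet)
    (hgm.add ((hgm.indicator hGm).const_mul _)) (measurable_volume_firstSection hS) ?_
  · rw [lintegral_volume_firstSection hX.measurableSet, lintegral_volume_firstSection hS,
      lintegral_add_left hgm, lintegral_const_mul _ (hgm.indicator hGm), hg,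
      lintegral_volume_firstSection hY.measurableSet, ← hg] at key
    refine le_trans ?_ key
    gcongr
    rw [ENNReal.ofReal_add zero_le_one (by positivity), ENNReal.ofReal_one, add_mul, one_mul,
      ENNReal.ofReal_mul hc0.le, mul_assoc]
    gcongr
    set Y1 := (fun q => (1 - κ) • p + κ • q) '' Y with hY1
    have hY1m : MeasurableSet Y1 := (hY.image (by fun_prop)).measurableSet
    have e1 := volume_affine_image κ ((1 - κ) • p) Y
    rw [abs_of_pos (by positivity)] at e1
    rw [← e1, ← hY1, ← lintegral_volume_firstSection hY1m]
    refine lintegral_mono fun y => ?_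
    rcases (firstSection Y1 y).eq_empty_or_nonempty with he | ⟨x, q, hq, hqx⟩
    · rw [he, measure_empty]; exact zero_le
    · have hyG : y ∈ G := by
        have i1 : (Fin.cons x y : Fin (k + 1) → ℝ) ∈ Y := by
          rw [← hqx]; exact hYc hp hq hk.le hκ0.le (by ring)
        have i2 : (Fin.cons (x + (1 - κ)) y : Fin (k + 1) → ℝ) ∈ Y := by
          rw [← hline, ← hqx]
          have := hYc hp1 hq hk.le hκ0.le (by ring)
          convert this using 1
          rw [smul_add, add_right_comm]
        have i3 : Set.Icc x (x + (1 - κ)) ⊆ firstSection Y y := by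
          intro r hr
          obtain ⟨a, b, ha, hb, hab, rfl⟩ := (Convex.mem_Icc (by linarith)).1 hr
          have := hYc i1 i2 ha hb hab
          rw [cons_combination] at this
          have e : a • y + b • y = y := by rw [← add_smul, hab, one_smul]
          rwa [e] at this
        have := measure_mono (μ := volume) i3
        rw [Real.volume_Icc, add_sub_cancel_left] at this
        exact this
      rw [Set.indicator_of_mem hyG]
      refine measure_mono fun r hr => ?_
      obtain ⟨q, hq, hqr⟩ := hr
      change (Fin.cons r y : Fin (k + 1) → ℝ) ∈ Y
      rw [← hqr]
      exact hYc hp hq hk.le hκ0.le (by ring)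
  intro y y'
  have hcX := isCompact_firstSection hX y
  have hcY := isCompact_firstSection hY y'
  rcases (firstSection X y).eq_empty_or_nonempty with he | hne
  · simp [he, h1']
  rcases (firstSection Y y').eq_empty_or_nonempty with he | hne'
  · have : G.indicator g y' = 0 := by
      by_cases hy : y' ∈ G
      · rw [Set.indicator_of_mem hy, hg]; simp [he]
      · rw [Set.indicator_of_notMem hy]
    have hg0 : g y' = 0 := by simp [hg, he]
    simp only [this, hg0]
    simp [h0]
  have l0 := add_volume_le_of_isCompact (hcX.smul (1 - lam)) (hcY.smul lam) hne.smul_set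
    hne'.smul_set
    subset_rfl
  have fX : volume (firstSection X y) = ENNReal.ofReal (volume.real (firstSection X y)) :=
    (ofReal_measureReal hcX.measure_lt_top.ne).symm
  have fY : g y' = ENNReal.ofReal (volume.real (firstSection Y y')) :=
    (ofReal_measureReal hcY.measure_lt_top.ne).symm
  have l1 : (1 - lam) * volume.real (firstSection X y) + lam * volume.real (firstSection Y y') ≤
      volume.real ((1 - lam) • firstSection X y + lam • firstSection Y y') := by
    rw [← volume_smul_real h1'.le, ← volume_smul_real h0.le]
    rw [measureReal_def, measureReal_def, measureReal_def, ← ENNReal.toReal_add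
      (hcX.smul _).measure_lt_top.ne (hcY.smul _).measure_lt_top.ne]
    exact ENNReal.toReal_mono ((hcX.smul _).add (hcY.smul _)).measure_lt_top.ne l0
  have l3 : volume ((1 - lam) • firstSection X y + lam • firstSection Y y') ≤
      volume (firstSection S ((1 - lam) • y + lam • y')) := by
    refine measure_mono ?_
    rintro _ ⟨_, ⟨x, hx, rfl⟩, _, ⟨x', hx', rfl⟩, rfl⟩
    have := H (Set.add_mem_add (Set.smul_mem_smul_set hx) (Set.smul_mem_smul_set hx'))
    rwa [cons_combination] at this
  refine le_trans ?_ l3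
  rw [← ofReal_measureReal ((hcX.smul _).add (hcY.smul _)).measure_lt_top.ne]
  refine le_trans ?_ (ENNReal.ofReal_le_ofReal l1)
  set F := volume.real (firstSection X y)
  set g' := volume.real (firstSection Y y')
  have hF0 : 0 ≤ F := measureReal_nonneg
  have hg0 : 0 ≤ g' := measureReal_nonneg
  by_cases hy : y' ∈ G
  · have hF : F ≤ (1 - κ) ^ 4 := by
      refine ENNReal.toReal_le_of_le_ofReal (by positivity) ?_
      refine (Real.volume_le_diam _).trans (Metric.ediam_le fun x hx x' hx' => ?_)
      rw [edist_dist, Real.dist_eq]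
      refine ENNReal.ofReal_le_ofReal (abs_le.2 ⟨?_, ?_⟩)
      · have := hXs _ hx (x' - x) (by
          rw [hline, add_sub_cancel]; exact hx')
        linarith
      · have := hXs _ hx' (x - x') (by
          rw [hline, add_sub_cancel]; exact hx)
        linarith
    have hgk : 1 - κ ≤ g' := by
      have : ENNReal.ofReal (1 - κ) ≤ ENNReal.ofReal g' := by rw [← fY]; exact hy
      exact (ENNReal.ofReal_le_ofReal_iff hg0).1 this
    have hFg : F ≤ (1 - κ) ^ 2 * g' := by
      have a1 : (1 - κ) ^ 4 ≤ (1 - κ) ^ 3 := pow_le_pow_of_le_one hk.le (by linarith) (by norm_num)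
      have a2 : (1 - κ) ^ 2 * (1 - κ) ≤ (1 - κ) ^ 2 * g' := by gcongr
      nlinarith
    have := rpow_mul_rpow_le_of_ratio h0 h1 hκ0 hκ1 hF0 hFg
    rw [Set.indicator_of_mem hy, fX, fY, ← ENNReal.ofReal_mul hc0.le,
      ← ENNReal.ofReal_add hg0 (by positivity), ENNReal.ofReal_rpow_of_nonneg hF0 h1'.le,
      ENNReal.ofReal_rpow_of_nonneg (by positivity) h0.le, ← ENNReal.ofReal_mul (by positivity)]
    refine ENNReal.ofReal_le_ofReal ?_
    convert this using 3
    ring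
  · rw [Set.indicator_of_notMem hy, mul_zero, add_zero, fX, fY,
      ENNReal.ofReal_rpow_of_nonneg hF0 h1'.le,
      ENNReal.ofReal_rpow_of_nonneg hg0 h0.le, ← ENNReal.ofReal_mul (by positivity)]
    exact ENNReal.ofReal_le_ofReal
      (Real.geom_mean_le_arith_mean2_weighted h1'.le h0.le hF0 hg0 (by ring))

theorem brunn_minkowski_width {lam κ : ℝ} (h0 : 0 < lam) (h1 : lam < 1) (hκ0 : 0 < κ)
    (hκ1 : κ < 1) {k : ℕ} {X Y S : Set (Fin (k + 1) → ℝ)} (hX : IsCompact X) (hY : IsCompact Y)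
    (hYc : Convex ℝ Y) (hS : MeasurableSet S) (H : (1 - lam) • X + lam • Y ⊆ S)
    {p v : Fin (k + 1) → ℝ} (hv : v ≠ 0) (hp : p ∈ Y) (hp1 : p + v ∈ Y)
    (hXs : ∀ x ∈ X, ∀ s : ℝ, x + s • v ∈ X → s ≤ (1 - κ) ^ 4) :
    volume X ^ (1 - lam) * (ENNReal.ofReal (1 + (1 - lam) * κ ^ 2 * κ ^ (k + 1)) * volume Y) ^ lam ≤
      volume S := by
  have h1' : 0 < 1 - lam := by linarith
  obtain ⟨T, hT⟩ := SeparatingDual.exists_continuousLinearEquiv_apply_eq (R := ℝ)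
    (x := (Pi.single 0 1 : Fin (k + 1) → ℝ)) (y := v) (by simp) hv
  have hcomp : ∀ {A : Set (Fin (k + 1) → ℝ)}, IsCompact A → IsCompact (T ⁻¹' A) := fun {A} hA => by
    rw [← T.image_symm_eq_preimage]; exact hA.image T.symm.continuous
  have key := brunn_minkowski_width_single h0 h1 hκ0 hκ1 (hcomp hX) (hcomp hY)
    (hYc.is_linear_preimage (f := T) ⟨map_add T, map_smul T⟩)
    (S := T ⁻¹' S) (T.continuous.measurable hS) ?_ (p := T.symm p) (by simpa using hp)
    (by simpa [hT] using hp1) ?_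
  · simp only [Measure.addHaar_preimage_continuousLinearEquiv] at key
    set c := ENNReal.ofReal |LinearMap.det (T.symm : (Fin (k + 1) → ℝ) →ₗ[ℝ] (Fin (k + 1) → ℝ))| with hc
    have hc0 : c ≠ 0 := by
      simpa [hc] using T.symm.toLinearEquiv.isUnit_det'.ne_zero
    have hct : c ≠ ⊤ := ENNReal.ofReal_ne_top
    rw [mul_left_comm, ENNReal.mul_rpow_of_nonneg _ _ h1'.le,
      ENNReal.mul_rpow_of_nonneg c _ h0.le, mul_mul_mul_comm, ← ENNReal.rpow_add _ _ hc0 hct,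
      sub_add_cancel, ENNReal.rpow_one] at key
    exact (ENNReal.mul_le_mul_iff_right hc0 hct).1 key
  · rintro _ ⟨_, ⟨x, hx, rfl⟩, _, ⟨x', hx', rfl⟩, rfl⟩
    have := H (Set.add_mem_add (Set.smul_mem_smul_set hx) (Set.smul_mem_smul_set hx'))
    simpa using this
  · intro x hx s hs
    refine hXs (T x) hx s ?_
    simpa [hT] using hs

/-- If the sumset of two convex sets is not much larger than the two sets, then their widths are
comparable. -/
theorem width_le_of_sumset {lam κ d m ω : ℝ} (h0 : 0 < lam) (h1 : lam < 1) (hκ0 : 0 < κ)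
    (hκ1 : κ < 1) {k : ℕ} {X Y S : Set (Fin (k + 1) → ℝ)} (hX : IsCompact X) (hY : IsCompact Y)
    (hYc : Convex ℝ Y) (hS : MeasurableSet S) (H : (1 - lam) • X + lam • Y ⊆ S) (hm : 0 < m)
    (hXm : m ≤ volume.real X) (hYm : m ≤ volume.real Y)
    (hSm : volume S ≤ ENNReal.ofReal (m * (1 + d))) (hd : d < lam * (1 - lam) * κ ^ (k + 3) / 2)
    (u : (Fin (k + 1) → ℝ) →L[ℝ] ℝ) (hω : ∀ x ∈ X, ∀ x' ∈ X, u x - u x' ≤ ω)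
    {y y' : Fin (k + 1) → ℝ} (hy : y ∈ Y) (hy' : y' ∈ Y) : (1 - κ) ^ 4 * (u y - u y') ≤ ω := by
  have h1' : 0 < 1 - lam := by linarith
  have hk : 0 < 1 - κ := by linarith
  by_contra! hcon
  have hXne : X.Nonempty := by
    rw [Set.nonempty_iff_ne_empty]
    rintro rfl
    simp at hXm
    linarith
  have hω0 : 0 ≤ ω := by
    obtain ⟨x, hx⟩ := hXne
    simpa using hω x hx x hx
  have huv : 0 < u (y - y') := by
    rw [map_sub]
    by_contra! hc
    have : (1 - κ) ^ 4 * (u y - u y') ≤ 0 := mul_nonpos_of_nonneg_of_nonpos (by positivity) hc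
    linarith
  have hv : y - y' ≠ 0 := by
    intro h; rw [h, map_zero] at huv; exact lt_irrefl _ huv
  have key := brunn_minkowski_width h0 h1 hκ0 hκ1 hX hY hYc hS H hv hy' (by simpa using hy) ?_
  · set c := (1 - lam) * κ ^ 2 * κ ^ (k + 1) with hc
    have hc0 : 0 < c := by positivity
    have hc1 : c ≤ 1 := by
      have a1 : κ ^ 2 ≤ 1 := pow_le_one₀ hκ0.le hκ1.le
      have a2 : κ ^ (k + 1) ≤ 1 := pow_le_one₀ hκ0.le hκ1.le
      rw [hc]
      exact mul_le_one₀ (mul_le_one₀ (by linarith) (by positivity) a1) (by positivity) a2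
    have fX : ENNReal.ofReal m ≤ volume X := ENNReal.ofReal_le_of_le_toReal hXm
    have fY : ENNReal.ofReal m ≤ volume Y := ENNReal.ofReal_le_of_le_toReal hYm
    have i1 : ENNReal.ofReal m ^ (1 - lam) * (ENNReal.ofReal (1 + c) * ENNReal.ofReal m) ^ lam ≤
        ENNReal.ofReal (m * (1 + d)) := by
      refine le_trans ?_ (key.trans hSm)
      gcongr
    rw [ENNReal.mul_rpow_of_nonneg _ _ h0.le, mul_left_comm, ← ENNReal.rpow_add _ _
      (by simpa using hm) ENNReal.ofReal_ne_top, sub_add_cancel, ENNReal.rpow_one,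
      ENNReal.ofReal_rpow_of_nonneg (by positivity) h0.le,
      ← ENNReal.ofReal_mul (by positivity)] at i1
    have e1 := one_add_mul_half_le_rpow h0.le hc0.le hc1
    have hcd : d < lam * c / 2 := by
      refine hd.trans_le (le_of_eq ?_)
      rw [hc]; ring
    have i2 : m * (1 + d) < (1 + c) ^ lam * m := by nlinarith
    exact absurd i1 (not_le.2 ((ENNReal.ofReal_lt_ofReal_iff (by positivity)).2 i2))
  · intro x hx s hs
    have := hω _ hs x hx
    rw [map_add, add_sub_cancel_left, map_smul, smul_eq_mul] at this
    rw [← map_sub] at hcon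
    by_contra! hc
    nlinarith

theorem exists_quantile {ν : Measure ℝ} [IsFiniteMeasure ν] {m : ℝ≥0∞} {b0 b1 : ℝ}
    (h0 : m ≤ ν (Set.Ici b0)) (h1 : ν (Set.Ici b1) < m) :
    ∃ b, m ≤ ν (Set.Ici b) ∧ ν (Set.Ioi b) ≤ m := by
  set T : Set ℝ := {b | m ≤ ν (Set.Ici b)} with hT
  have hbd : ∀ b ∈ T, b ≤ b1 := by
    intro b hb
    by_contra! hc
    exact absurd (lt_of_le_of_lt (le_trans hb (measure_mono (Set.Ici_subset_Ici.2 hc.le))) h1)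
      (lt_irrefl _)
  have hba : BddAbove T := ⟨b1, hbd⟩
  have hdown : ∀ b b', b' ∈ T → b ≤ b' → b ∈ T := fun b b' hb' h =>
    le_trans hb' (measure_mono (Set.Ici_subset_Ici.2 h))
  have hlt : ∀ b, b < sSup T → b ∈ T := by
    intro b hb
    obtain ⟨b', hb', h⟩ := exists_lt_of_lt_csSup ⟨b0, h0⟩ hb
    exact hdown b b' hb' h.le
  refine ⟨sSup T, ?_, ?_⟩
  · have e : Set.Ici (sSup T) = ⋂ j : ℕ, Set.Ici (sSup T - 1 / (j + 1)) := by
      ext x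
      simp only [Set.mem_Ici, Set.mem_iInter]
      constructor
      · intro h j
        have : (0 : ℝ) < 1 / (j + 1) := by positivity
        linarith
      · intro h
        by_contra! hc
        obtain ⟨j, hj⟩ := exists_nat_one_div_lt (sub_pos.2 hc)
        linarith [h j]
    rw [e]
    refine ge_of_tendsto (tendsto_measure_iInter_atTop (fun j => measurableSet_Ici.nullMeasurableSet)
      ?_ ⟨0, measure_ne_top _ _⟩) (Filter.Eventually.of_forall fun j => ?_)
    · intro i j hij
      refine Set.Ici_subset_Ici.2 ?_
      have : (1 : ℝ) / (j + 1) ≤ 1 / (i + 1) := by gcongr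
      linarith
    · have : (0 : ℝ) < 1 / (j + 1) := by positivity
      exact hlt _ (by linarith)
  · have e : Set.Ioi (sSup T) = ⋃ j : ℕ, Set.Ici (sSup T + 1 / (j + 1)) := by
      ext x
      simp only [Set.mem_Ioi, Set.mem_iUnion, Set.mem_Ici]
      constructor
      · intro h
        obtain ⟨j, hj⟩ := exists_nat_one_div_lt (sub_pos.2 h)
        exact ⟨j, by linarith⟩
      · rintro ⟨j, hj⟩
        have : (0 : ℝ) < 1 / (j + 1) := by positivity
        linarith
    rw [e]
    refine le_of_tendsto (tendsto_measure_iUnion_atTop ?_) (Filter.Eventually.of_forall fun j => ?_)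
    · intro i j hij
      refine Set.Ici_subset_Ici.2 ?_
      have : (1 : ℝ) / (j + 1) ≤ 1 / (i + 1) := by gcongr
      linarith
    · by_contra! hc
      have : (0 : ℝ) < 1 / (j + 1) := by positivity
      have := le_csSup hba hc.le
      linarith

theorem exists_level {n : ℕ} {L : Set (Fin n → ℝ)} (hL : IsCompact L)
    (u : (Fin n → ℝ) →L[ℝ] ℝ) {m b1 : ℝ} (hm0 : 0 < m) (hm : m ≤ volume.real L)
    (h1 : volume.real (L ∩ {x | b1 ≤ u x}) < m) :
    ∃ b, m ≤ volume.real (L ∩ {x | b ≤ u x}) ∧ volume.real (L ∩ {x | b < u x}) ≤ m := by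
  have hum : Measurable u := u.continuous.measurable
  set ν : Measure ℝ := (volume.restrict L).map u with hν
  have fL : volume L < ⊤ := hL.measure_lt_top
  have : IsFiniteMeasure (volume.restrict L) := ⟨by simpa using fL⟩
  have hν1 : ∀ s : Set ℝ, MeasurableSet s → ν s = volume (L ∩ u ⁻¹' s) := fun s hs => by
    rw [hν, Measure.map_apply hum hs, Measure.restrict_apply (hum hs), Set.inter_comm]
  have fin : ∀ s, volume (L ∩ s) ≠ ⊤ := fun s =>
    measure_ne_top_of_subset Set.inter_subset_left fL.ne
  obtain ⟨b, hb, hb'⟩ := exists_quantile (ν := ν) (m := ENNReal.ofReal m)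
    (b0 := -suppFn L (-u)) (b1 := b1) (by
      have e : L ∩ u ⁻¹' Set.Ici (-suppFn L (-u)) = L :=
        Set.inter_eq_left.2 fun x hx => neg_suppFn_neg_le hL u hx
      rw [hν1 _ measurableSet_Ici, e]
      exact ENNReal.ofReal_le_of_le_toReal hm) (by
      rw [hν1 _ measurableSet_Ici]
      exact (ENNReal.lt_ofReal_iff_toReal_lt (fin _)).2 h1)
  rw [hν1 _ measurableSet_Ici] at hb
  rw [hν1 _ measurableSet_Ioi] at hb'
  exact ⟨b, (ENNReal.ofReal_le_iff_le_toReal (fin _)).1 hb,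
    ENNReal.toReal_le_of_le_ofReal hm0.le hb'⟩

section

variable {lam κ d V : ℝ} {k : ℕ} {K L : Set (Fin (k + 1) → ℝ)}

theorem half_le_one_sub_pow_four (hκ0 : 0 < κ) (hκ1 : κ ≤ 1 / 8) :
    1 - 4 * κ ≤ (1 - κ) ^ 4 := by
  have := one_add_mul_le_pow (by linarith : (-2 : ℝ) ≤ -κ) 4
  push_cast at this
  rw [← sub_eq_add_neg] at this
  linarith

theorem wid_le_two_mul (h0 : 0 < lam) (h1 : lam < 1) (hκ0 : 0 < κ) (hκ1 : κ ≤ 1 / 8)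
    (hK : IsCompact K) (hL : IsCompact L) (hLc : Convex ℝ L) (hV : 0 < V)
    (hKV : volume.real K = V) (hLV : volume.real L = V)
    (hS : volume.real ((1 - lam) • K + lam • L) ≤ V * (1 + d))
    (hd : d < lam * (1 - lam) * κ ^ (2 * k + 4) / 2) (u : (Fin (k + 1) → ℝ) →L[ℝ] ℝ) :
    wid L u ≤ 2 * wid K u := by
  have h1' : 0 < 1 - lam := by linarith
  have hLne : L.Nonempty := by
    rw [Set.nonempty_iff_ne_empty]; rintro rfl; simp at hLV; linarith
  have hk4 := half_le_one_sub_pow_four hκ0 hκ1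
  have hWc : IsCompact ((1 - lam) • K + lam • L) := (hK.smul _).add (hL.smul _)
  have fW := hWc.measure_lt_top (μ := volume) |>.ne
  obtain ⟨y, hy, y', hy', -, -, hw⟩ := exists_eq_wid hL hLne u
  have := width_le_of_sumset (κ := κ) (ω := wid K u) h0 h1 hκ0 (by linarith) hK hL hLc
    hWc.measurableSet subset_rfl hV hKV.ge hLV.ge (d := d)
    (by rw [← ofReal_measureReal fW]; exact ENNReal.ofReal_le_ofReal hS)
    (hd.trans_le (by
      have : κ ^ (2 * k + 4) ≤ κ ^ (k + 3) :=
        pow_le_pow_of_le_one hκ0.le (by linarith) (by omega)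
      gcongr)) u (fun x hx x' hx' => sub_le_wid hK u hx hx') hy hy'
  rw [hw] at this
  nlinarith [wid_nonneg hL hLne u]

theorem volume_superlevel_le (h0 : 0 < lam) (h1 : lam < 1) (hκ0 : 0 < κ) (hκ1 : κ ≤ 1 / 8)
    (hK : IsCompact K) (hL : IsCompact L) (hLc : Convex ℝ L) (hV : 0 < V)
    (hKV : volume.real K = V) (hLV : volume.real L = V)
    (hS : volume.real ((1 - lam) • K + lam • L) ≤ V * (1 + d))
    (hd : d < lam * (1 - lam) * κ ^ (2 * k + 4) / 2) (hd0 : 0 ≤ d)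
    (u : (Fin (k + 1) → ℝ) →L[ℝ] ℝ) (a : ℝ) :
    volume.real (K ∩ {x | a ≤ u x}) ≤
      volume.real (L ∩ {x | a + (suppFn L u - suppFn K u - 10 * κ * wid K u) ≤ u x}) := by
  have h1' : 0 < 1 - lam := by linarith
  have hum : Measurable u := u.continuous.measurable
  have hKne : K.Nonempty := by
    rw [Set.nonempty_iff_ne_empty]; rintro rfl; simp at hKV; linarith
  have hLne : L.Nonempty := by
    rw [Set.nonempty_iff_ne_empty]; rintro rfl; simp at hLV; linarith
  have hk4 := half_le_one_sub_pow_four hκ0 hκ1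
  set W := (1 - lam) • K + lam • L with hW
  have hWc : IsCompact W := (hK.smul _).add (hL.smul _)
  have fW : volume W ≠ ⊤ := hWc.measure_lt_top.ne
  have fK : volume K ≠ ⊤ := hK.measure_lt_top.ne
  have fL : volume L ≠ ⊤ := hL.measure_lt_top.ne
  have hwK := wid_nonneg hK hKne u
  have hκn : κ ^ (k + 1) ≤ 1 := pow_le_one₀ hκ0.le (by linarith)
  have hwL := wid_le_two_mul h0 h1 hκ0 hκ1 hK hL hLc hV hKV hLV hS hd u
  set ε := 10 * κ * wid K u with hε
  set b := a + (suppFn L u - suppFn K u - ε) with hb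
  set m := volume.real (K ∩ {x | a ≤ u x}) with hm
  by_contra! hcon
  have hm0 : 0 < m := lt_of_le_of_lt measureReal_nonneg hcon
  have hmV : m ≤ V := by rw [← hKV]; exact measureReal_mono Set.inter_subset_left fK
  have haK : a ≤ suppFn K u := by
    have : (K ∩ {x | a ≤ u x}).Nonempty := by
      rw [Set.nonempty_iff_ne_empty]; intro h; rw [hm, h] at hm0; simp at hm0
    obtain ⟨x, hx, hxa⟩ := this
    exact le_trans hxa (le_suppFn hK u hx)
  rcases lt_or_ge m (κ ^ (k + 1) * V) with hmk | hmk
  · have := lt_of_volume_cap_lt hL hLc hLne u hκ0.le (by linarith) (D := suppFn L u - b) (by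
      rw [sub_sub_cancel, hLV]; exact hcon.trans hmk)
    nlinarith
  obtain ⟨c, hc1, hc2⟩ := exists_level hL u hm0 (hmV.trans hLV.ge) hcon
  obtain ⟨y', hy', hy'b⟩ : ∃ y' ∈ L ∩ {x | c ≤ u x}, u y' < b := by
    by_contra! h
    have : volume.real (L ∩ {x | c ≤ u x}) ≤ volume.real (L ∩ {x | b ≤ u x}) :=
      measureReal_mono (fun x hx => ⟨hx.1, h x hx⟩)
        (measure_ne_top_of_subset Set.inter_subset_left fL)
    linarith
  obtain ⟨y, hy, hyu⟩ := exists_eq_suppFn hL hLne u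
  have hyY : y ∈ L ∩ {x | c ≤ u x} :=
    ⟨hy, by rw [Set.mem_ofPred_eq, hyu]; exact hy'.2.trans (le_suppFn hL u hy'.1)⟩
  set e := (1 - lam) * a + lam * c with he
  have hKm := hK.measurableSet
  have hLm := hL.measurableSet
  have hSp : volume.real (W ∩ {x | e ≤ u x}) ≤ m + V * d := by
    have s1 : volume.real (K ∩ {x | u x < a}) = V - m := by
      have := measureReal_inter_add_sdiff (μ := volume) (s := K)
        (measurableSet_le measurable_const hum : MeasurableSet {x | a ≤ u x}) fK
      rw [hKV] at this
      have e1 : K \ {x | a ≤ u x} = K ∩ {x | u x < a} := by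
        ext x; simp
      rw [e1] at this
      linarith
    have s2 : V - m ≤ volume.real (L ∩ {x | u x ≤ c}) := by
      have := measureReal_inter_add_sdiff (μ := volume) (s := L)
        (measurableSet_lt measurable_const hum : MeasurableSet {x | c < u x}) fL
      rw [hLV] at this
      have e1 : L \ {x | c < u x} = L ∩ {x | u x ≤ c} := by
        ext x; simp
      rw [e1] at this
      linarith
    have s3 : V - m ≤ volume.real (W ∩ {x | u x < e}) := by
      have hbm := brunn_minkowski h0 h1 (A := K ∩ {x | u x < a}) (B := L ∩ {x | u x ≤ c})
        (S := W ∩ {x | u x < e}) (hKm.inter (measurableSet_lt hum measurable_const))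
        (hLm.inter (measurableSet_le hum measurable_const))
        (hWc.measurableSet.inter (measurableSet_lt hum measurable_const)) (by
          rintro _ ⟨_, ⟨x, hx, rfl⟩, _, ⟨x', hx', rfl⟩, rfl⟩
          refine ⟨Set.add_mem_add (Set.smul_mem_smul_set hx.1) (Set.smul_mem_smul_set hx'.1), ?_⟩
          have i1 : u x < a := hx.2
          have i2 : u x' ≤ c := hx'.2
          simp only [Set.mem_ofPred_eq, map_add, map_smul, smul_eq_mul]
          have := mul_lt_mul_of_pos_left i1 h1'
          have := mul_le_mul_of_nonneg_left i2 h0.le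
          linarith)
      refine (ENNReal.ofReal_le_iff_le_toReal
        (measure_ne_top_of_subset Set.inter_subset_left fW)).1 (le_trans ?_ hbm)
      have i1 : ENNReal.ofReal (V - m) ≤ volume (K ∩ {x | u x < a}) :=
        ENNReal.ofReal_le_of_le_toReal s1.ge
      have i2 : ENNReal.ofReal (V - m) ≤ volume (L ∩ {x | u x ≤ c}) :=
        ENNReal.ofReal_le_of_le_toReal s2
      calc ENNReal.ofReal (V - m) = ENNReal.ofReal (V - m) ^ (1 - lam) * ENNReal.ofReal (V - m) ^ lam := by
            rw [← ENNReal.rpow_add_of_nonneg _ _ h1'.le h0.le, sub_add_cancel, ENNReal.rpow_one]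
        _ ≤ _ := by gcongr
    have s4 := measureReal_inter_add_sdiff (μ := volume) (s := W)
        (measurableSet_le measurable_const hum : MeasurableSet {x | e ≤ u x}) fW
    have e1 : W \ {x | e ≤ u x} = W ∩ {x | u x < e} := by
      ext x; simp
    rw [e1] at s4
    linarith
  have fSp : volume (W ∩ {x | e ≤ u x}) ≠ ⊤ := measure_ne_top_of_subset Set.inter_subset_left fW
  have hfin := width_le_of_sumset (κ := κ) (ω := min (suppFn K u - a) (wid K u)) (m := m)
    (d := d / κ ^ (k + 1)) h0 h1 hκ0 (by linarith)
    (X := K ∩ {x | a ≤ u x}) (Y := L ∩ {x | c ≤ u x}) (S := W ∩ {x | e ≤ u x})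
    (hK.inter_right (isClosed_le continuous_const u.continuous))
    (hL.inter_right (isClosed_le continuous_const u.continuous))
    (hLc.inter (convex_halfSpace_ge u.isLinear c))
    (hWc.measurableSet.inter (measurableSet_le measurable_const hum)) (by
      rintro _ ⟨_, ⟨x, hx, rfl⟩, _, ⟨x', hx', rfl⟩, rfl⟩
      refine ⟨Set.add_mem_add (Set.smul_mem_smul_set hx.1) (Set.smul_mem_smul_set hx'.1), ?_⟩
      have i1 : a ≤ u x := hx.2
      have i2 : c ≤ u x' := hx'.2
      simp only [Set.mem_ofPred_eq, map_add, map_smul, smul_eq_mul]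
      have := mul_le_mul_of_nonneg_left i1 h1'.le
      have := mul_le_mul_of_nonneg_left i2 h0.le
      linarith) hm0 le_rfl hc1 (by
      rw [← ofReal_measureReal fSp]
      refine ENNReal.ofReal_le_ofReal (hSp.trans ?_)
      have : V * d ≤ m * (d / κ ^ (k + 1)) := by
        rw [← mul_div_assoc, le_div_iff₀ (by positivity)]
        calc V * d * κ ^ (k + 1) = κ ^ (k + 1) * V * d := by ring
          _ ≤ _ := by gcongr
      linarith) (by
      rw [div_lt_iff₀ (by positivity)]
      refine hd.trans_le (le_of_eq ?_)
      rw [show 2 * k + 4 = (k + 3) + (k + 1) by ring, pow_add]; ring)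
    u (fun x hx x' hx' => le_min (by
      have i1 : a ≤ u x' := hx'.2
      linarith [le_suppFn hK u hx.1]) (sub_le_wid hK u hx.1 hx'.1)) hyY hy'
  rw [hyu] at hfin
  have hk0 : 0 < (1 - κ) ^ 4 := by
    have : 0 < 1 - κ := by linarith
    positivity
  have i1 : (1 - κ) ^ 4 * (suppFn L u - b) < min (suppFn K u - a) (wid K u) :=
    lt_of_lt_of_le (mul_lt_mul_of_pos_left (by linarith) hk0) hfin
  set ω := min (suppFn K u - a) (wid K u)
  have i2 : ω ≤ suppFn K u - a := min_le_left _ _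
  have i3 : ω ≤ wid K u := min_le_right _ _
  have i4 : 0 ≤ ω := le_min (by linarith) hwK
  have i5 : ω + ε ≤ suppFn L u - b := by linarith
  have i6 : (1 - 4 * κ) * (ω + ε) < ω :=
    lt_of_le_of_lt ((mul_le_mul_of_nonneg_right hk4 (by positivity)).trans
      (mul_le_mul_of_nonneg_left i5 hk0.le)) i1
  nlinarith [mul_nonneg hκ0.le hwK]

end

theorem integral_le_of_superlevel {n : ℕ} {K L : Set (Fin n → ℝ)} (hK : IsCompact K)
    (hL : IsCompact L) (hV : volume.real K = volume.real L) (u : (Fin n → ℝ) →L[ℝ] ℝ) {c : ℝ}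
    (h : ∀ a, volume.real (K ∩ {x | a ≤ u x}) ≤ volume.real (L ∩ {x | a + c ≤ u x})) :
    (∫ x in K, u x) + c * volume.real K ≤ ∫ x in L, u x := by
  have hum : Measurable u := u.continuous.measurable
  have iK : IntegrableOn u K := u.continuous.continuousOn.integrableOn_compact hK
  have iL : IntegrableOn u L := u.continuous.continuousOn.integrableOn_compact hL
  have fK : volume K ≠ ⊤ := hK.measure_lt_top.ne
  have fL : volume L ≠ ⊤ := hL.measure_lt_top.ne
  set R := max (suppFn K (-u) - c) (suppFn L (-u)) with hR
  have pK : ∀ x ∈ K, 0 ≤ u x + (c + R) := fun x hx => by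
    have := neg_suppFn_neg_le hK u hx
    have := le_max_left (suppFn K (-u) - c) (suppFn L (-u))
    linarith
  have pL : ∀ x ∈ L, 0 ≤ u x + R := fun x hx => by
    have := neg_suppFn_neg_le hL u hx
    have := le_max_right (suppFn K (-u) - c) (suppFn L (-u))
    linarith
  have pK' : 0 ≤ᵐ[volume.restrict K] fun x => u x + (c + R) :=
    (ae_restrict_iff' hK.measurableSet).2 (Filter.Eventually.of_forall pK)
  have pL' : 0 ≤ᵐ[volume.restrict L] fun x => u x + R :=
    (ae_restrict_iff' hL.measurableSet).2 (Filter.Eventually.of_forall pL)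
  have e1 := lintegral_eq_lintegral_meas_le (volume.restrict K) pK' (by fun_prop)
  have e2 := lintegral_eq_lintegral_meas_le (volume.restrict L) pL' (by fun_prop)
  have e3 : ∫⁻ x in K, ENNReal.ofReal (u x + (c + R)) ≤ ∫⁻ x in L, ENNReal.ofReal (u x + R) := by
    rw [e1, e2]
    refine lintegral_mono fun t => ?_
    rw [Measure.restrict_apply (measurableSet_le measurable_const (by fun_prop)),
      Measure.restrict_apply (measurableSet_le measurable_const (by fun_prop))]
    have := h (t - (c + R))
    have s1 : {x | t ≤ u x + (c + R)} ∩ K = K ∩ {x | t - (c + R) ≤ u x} := by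
      ext x; simp only [Set.mem_inter_iff, Set.mem_ofPred_eq, sub_le_iff_le_add]; tauto
    have s2 : {x | t ≤ u x + R} ∩ L = L ∩ {x | t - (c + R) + c ≤ u x} := by
      ext x
      simp only [Set.mem_inter_iff, Set.mem_ofPred_eq]
      rw [show t - (c + R) + c = t - R by ring, sub_le_iff_le_add]; tauto
    rw [s1, s2]
    exact (ENNReal.toReal_le_toReal (measure_ne_top_of_subset Set.inter_subset_left fK)
      (measure_ne_top_of_subset Set.inter_subset_left fL)).1 this
  have cK : IntegrableOn (fun _ => c + R) K := integrableOn_const fK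
  have cL : IntegrableOn (fun _ => R) L := integrableOn_const fL
  have iK' : IntegrableOn (fun x => u x + (c + R)) K := iK.add cK
  have iL' : IntegrableOn (fun x => u x + R) L := iL.add cL
  rw [← ofReal_integral_eq_lintegral_ofReal iK' pK',
    ← ofReal_integral_eq_lintegral_ofReal iL' pL', ENNReal.ofReal_le_ofReal_iff
    (integral_nonneg_of_ae pL')] at e3
  have e4 : ∫ x in K, (u x + (c + R)) = (∫ x in K, u x) + volume.real K * (c + R) := by
    rw [integral_add iK cK, setIntegral_const, smul_eq_mul]
  have e5 : ∫ x in L, (u x + R) = (∫ x in L, u x) + volume.real L * R := by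
    rw [integral_add iL cL, setIntegral_const, smul_eq_mul]
  have e6 := e4 ▸ e5 ▸ e3
  rw [← hV] at e6
  linarith

/-- Two convex bodies of equal volume with a small sumset have, after a translation, close support
functions. -/
theorem suppFn_add_le {lam κ d V : ℝ} {k : ℕ} {K L : Set (Fin (k + 1) → ℝ)}
    (h0 : 0 < lam) (h1 : lam < 1) (hκ0 : 0 < κ) (hκ1 : κ ≤ 1 / 8)
    (hK : IsCompact K) (hL : IsCompact L) (hLc : Convex ℝ L) (hV : 0 < V)
    (hKV : volume.real K = V) (hLV : volume.real L = V)
    (hS : volume.real ((1 - lam) • K + lam • L) ≤ V * (1 + d))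
    (hd : d < lam * (1 - lam) * κ ^ (2 * k + 4) / 2) (hd0 : 0 ≤ d)
    (u : (Fin (k + 1) → ℝ) →L[ℝ] ℝ) :
    suppFn L u + u (V⁻¹ • ((∫ x in K, x) - ∫ x in L, x)) ≤ suppFn K u + 10 * κ * wid K u := by
  have key := integral_le_of_superlevel hK hL (hKV.trans hLV.symm) u
    (volume_superlevel_le h0 h1 hκ0 hκ1 hK hL hLc hV hKV hLV hS hd hd0 u)
  have iK : IntegrableOn (fun x : Fin (k + 1) → ℝ => x) K :=
    continuous_id.continuousOn.integrableOn_compact hK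
  have iL : IntegrableOn (fun x : Fin (k + 1) → ℝ => x) L :=
    continuous_id.continuousOn.integrableOn_compact hL
  rw [u.integral_comp_comm iK, u.integral_comp_comm iL, hKV] at key
  rw [map_smul, map_sub, smul_eq_mul]
  set I := u (∫ x in K, x)
  set J := u (∫ x in L, x)
  have e : V⁻¹ * (I - J) = (I - J) / V := by ring
  have : (I - J) / V ≤ -(suppFn L u - suppFn K u - 10 * κ * wid K u) := by
    rw [div_le_iff₀ hV]; linarith
  rw [e]; linarith

theorem exists_core {n : ℕ} {A : Set (Fin n → ℝ)} (hA : IsCompact A) {ε η q t γ : ℝ}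
    (hη : 0 < η) (hε0 : 0 ≤ ε) (hε : 4 * ε ≤ (η / (2 ^ (n + 1)) ^ n) ^ 2)
    (h : ∀ s : ℝ, 0 ≤ s → s ≤ 1 → pairDefect A s ≤ ENNReal.ofReal ε)
    (hγ : ε / (η / (2 ^ (n + 1)) ^ n) ≤ γ) (hβ : ε + 2 ^ n * η ≤ q ^ 2) (hq : 0 < q)
    (hq8 : q ≤ 1 / 4) (ht0 : 0 ≤ t) (ht1 : t ≤ 1) (hcap : (q + γ) * 2 ^ (n + 3) < t ^ n)
    (hA0 : 1 / 2 ≤ volume.real A) (hA1 : volume.real A ≤ 1) :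
    ∃ C : Set (Fin n → ℝ), IsCompact C ∧ Convex ℝ C ∧ volume.real (C \ A) ≤ γ ∧
      volume.real A ≤ q + (1 + (n + 1) * t) ^ n * volume.real C := by
  obtain ⟨C, hC, hconv, hCA, hmid⟩ := exists_convex_core hA hη hε0 hε h
  set β := ε + 2 ^ n * (η * volume.real A) with hβ'
  have hβq : β ≤ q ^ 2 := by
    refine le_trans ?_ hβ
    have : η * volume.real A ≤ η := mul_le_of_le_one_right hη.le hA1
    rw [hβ']; gcongr
  have hβ0 : 0 ≤ β := by positivity
  have hsq := sq_volume_le_of_midpoints hA hC hβ0 hmid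
  have hCpos : 1 ≤ volume.real C * 2 ^ (n + 3) := by
    have h2 : (0 : ℝ) < 2 ^ n := by positivity
    have hC0 : 0 ≤ volume.real C := measureReal_nonneg
    have i1 : q ^ 2 ≤ 1 / 16 := by nlinarith
    have i2 : (1 / 2) ^ 2 ≤ volume.real A ^ 2 := by gcongr
    have i3 : 2 ^ n * volume.real C * volume.real A ≤ 2 ^ n * volume.real C :=
      mul_le_of_le_one_right (by positivity) hA1
    rw [pow_add]; nlinarith
  have hne : C.Nonempty := by
    rw [Set.nonempty_iff_ne_empty]; rintro rfl; simp at hCpos; linarith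
  refine ⟨C, hC, hconv, hCA.trans hγ,
    volume_le_of_midpoints hA hC hconv hne hq hβq (hCA.trans hγ) hmid ht0 ht1 ?_⟩
  have h8 : (0 : ℝ) < 2 ^ (n + 3) := by positivity
  have i1 : t ^ n ≤ t ^ n * (volume.real C * 2 ^ (n + 3)) :=
    le_mul_of_one_le_right (by positivity) hCpos
  have i2 : (q + γ) * 2 ^ (n + 3) < t ^ n * volume.real C * 2 ^ (n + 3) := by
    rw [mul_assoc]; exact hcap.trans_le i1
  exact lt_of_mul_lt_mul_right i2 h8.le

theorem exists_subset_volume_eq {n : ℕ} (hn : n ≠ 0) {C : Set (Fin n → ℝ)} (hC : IsCompact C)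
    (hconv : Convex ℝ C) {V : ℝ} (hV0 : 0 < V) (hV : V ≤ volume.real C) :
    ∃ K ⊆ C, IsCompact K ∧ Convex ℝ K ∧ volume.real K = V := by
  have hC0 : 0 < volume.real C := hV0.trans_le hV
  obtain ⟨p, hp⟩ : C.Nonempty := by
    rw [Set.nonempty_iff_ne_empty]; rintro rfl; simp at hC0
  set t := (V / volume.real C) ^ (1 / (n : ℝ)) with ht
  have ht0 : 0 ≤ t := by positivity
  have ht1 : t ≤ 1 := Real.rpow_le_one (by positivity) ((div_le_one hC0).2 hV) (by positivity)
  have htn : t ^ n = V / volume.real C := by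
    rw [ht, one_div, Real.rpow_inv_natCast_pow (by positivity) hn]
  refine ⟨(fun v => (1 - t) • p + t • v) '' C, ?_, hC.image (by fun_prop), ?_, ?_⟩
  · rintro _ ⟨x, hx, rfl⟩
    exact hconv hp hx (by linarith) ht0 (by ring)
  · have : (fun v => (1 - t) • p + t • v) '' C = (fun v => (1 - t) • p + v) '' (t • C) := by
      rw [← Set.image_smul, Set.image_image]
    rw [this]
    simpa using (hconv.smul t).translate ((1 - t) • p)
  · rw [volume_real_affine_image ht0, htn]; field_simp

theorem exists_fiber {n : ℕ} {A B S : Set (Fin n → ℝ)} {lam : ℝ} (h0 : 0 < lam)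
    (hA : MeasurableSet A) (hB : MeasurableSet B) (hS : MeasurableSet S)
    (H : (1 - lam) • A + lam • B ⊆ S) {c : ℝ≥0∞}
    (hc : c * volume S < ENNReal.ofReal (lam ^ n) * volume B * volume A) :
    ∃ w, c < volume {x | x ∈ A ∧ lam⁻¹ • (w - (1 - lam) • x) ∈ B} := by
  set M : Set ((Fin n → ℝ) × (Fin n → ℝ)) :=
    {p | p.2 ∈ A ∧ lam⁻¹ • (p.1 - (1 - lam) • p.2) ∈ B} with hM
  have hMm : MeasurableSet M :=
    (measurable_snd hA).inter ((by fun_prop :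
      Measurable fun p : (Fin n → ℝ) × (Fin n → ℝ) => lam⁻¹ • (p.1 - (1 - lam) • p.2)) hB)
  have hsw := lintegral_volume_section_swap hMm
  have hr : ∫⁻ x, volume {w | (w, x) ∈ M} = ENNReal.ofReal (lam ^ n) * volume B * volume A := by
    have e : ∀ x, volume {w | (w, x) ∈ M} =
        A.indicator (fun _ => ENNReal.ofReal (lam ^ n) * volume B) x := by
      intro x
      by_cases hx : x ∈ A
      · rw [Set.indicator_of_mem hx]
        have := volume_affine_preimage (c := lam⁻¹) (inv_ne_zero h0.ne')
          (-(lam⁻¹ • (1 - lam) • x)) B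
        rw [inv_pow, inv_inv, abs_of_pos (by positivity)] at this
        rw [← this]
        congr 1
        ext w
        simp only [hM, Set.mem_ofPred_eq, hx, true_and]
        rw [smul_sub, neg_add_eq_sub]
      · rw [Set.indicator_of_notMem hx]
        simp [hM, hx]
    simp_rw [e]
    rw [lintegral_indicator hA, setLIntegral_const]
  by_contra! hcon
  have hl : ∫⁻ w, volume {x | (w, x) ∈ M} ≤ c * volume S := by
    calc ∫⁻ w, volume {x | (w, x) ∈ M} ≤ ∫⁻ w, S.indicator (fun _ => c) w := by
          refine lintegral_mono fun w => ?_
          by_cases hw : w ∈ S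
          · rw [Set.indicator_of_mem hw]; exact hcon w
          · rw [Set.indicator_of_notMem hw]
            refine le_of_eq ?_
            convert measure_empty (μ := (volume : Measure (Fin n → ℝ)))
            ext x
            simp only [hM, Set.mem_ofPred_eq, Set.mem_empty_iff_false, iff_false]
            rintro ⟨hx, hy⟩
            refine hw (H ⟨_, Set.smul_mem_smul_set hx, _, Set.smul_mem_smul_set hy, ?_⟩)
            dsimp only
            rw [smul_inv_smul₀ h0.ne']; abel
      _ = c * volume S := by rw [lintegral_indicator hS, setLIntegral_const]
  rw [hsw, hr] at hl
  exact absurd hc (not_lt.2 hl)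

/-- A homothetic copy of the sumset of the convex cores is covered by the sumset itself. -/
theorem exists_homothety_subset {n : ℕ} {A B S K L : Set (Fin n → ℝ)} {lam γ t : ℝ}
    (h0 : 0 < lam) (h1 : lam < 1)
    (hA : MeasurableSet A) (hB : MeasurableSet B) (hS : MeasurableSet S)
    (H : (1 - lam) • A + lam • B ⊆ S) (hSv : volume S ≤ ENNReal.ofReal (3 / 2))
    (hK : IsCompact K) (hL : IsCompact L) (hKc : Convex ℝ K) (hLc : Convex ℝ L)
    (hKA : volume.real (K \ A) ≤ γ) (hLB : volume.real (L \ B) ≤ γ)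
    (hKV : 3 / 4 + γ ≤ volume.real K) (hLV : 3 / 4 + γ ≤ volume.real L)
    (ht0 : 0 < t) (ht1 : t ≤ 1)
    (hcap : γ * (1 + (lam / (1 - lam)) ^ n) ≤ t ^ n * (lam ^ n / 4)) :
    ∃ w ∈ (1 - lam) • K + lam • L,
      (fun s => t • w + (1 - t) • s) '' ((1 - lam) • K + lam • L) ⊆ (1 - lam) • A + lam • B := by
  have h1' : 0 < 1 - lam := by linarith
  have fK := (hK.measure_lt_top (μ := volume)).ne
  have fL := (hL.measure_lt_top (μ := volume)).ne
  have vKA : 3 / 4 ≤ volume.real (K ∩ A) := by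
    have := measureReal_inter_add_sdiff (μ := volume) (s := K) hA fK
    linarith
  have vLB : 3 / 4 ≤ volume.real (L ∩ B) := by
    have := measureReal_inter_add_sdiff (μ := volume) (s := L) hB fL
    linarith
  obtain ⟨w, hw⟩ := exists_fiber (A := K ∩ A) (B := L ∩ B) (S := S)
    (c := ENNReal.ofReal (lam ^ n / 4)) h0
    (hK.measurableSet.inter hA) (hL.measurableSet.inter hB) hS
    ((Set.add_subset_add (Set.smul_set_mono Set.inter_subset_right)
      (Set.smul_set_mono Set.inter_subset_right)).trans H) (by
      have e1 : ENNReal.ofReal (3 / 4) ≤ volume (K ∩ A) := ENNReal.ofReal_le_of_le_toReal vKA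
      have e2 : ENNReal.ofReal (3 / 4) ≤ volume (L ∩ B) := ENNReal.ofReal_le_of_le_toReal vLB
      calc ENNReal.ofReal (lam ^ n / 4) * volume S
          ≤ ENNReal.ofReal (lam ^ n / 4) * ENNReal.ofReal (3 / 2) := by gcongr
        _ = ENNReal.ofReal (lam ^ n * (3 / 8)) := by
            rw [← ENNReal.ofReal_mul (by positivity)]; congr 1; ring
        _ < ENNReal.ofReal (lam ^ n * (3 / 4) * (3 / 4)) := by
            have : 0 < lam ^ n := by positivity
            rw [ENNReal.ofReal_lt_ofReal_iff (by positivity)]; linarith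
        _ = ENNReal.ofReal (lam ^ n) * ENNReal.ofReal (3 / 4) * ENNReal.ofReal (3 / 4) := by
            rw [ENNReal.ofReal_mul (by positivity), ENNReal.ofReal_mul (by positivity)]
        _ ≤ _ := by gcongr)
  set W := {x | x ∈ K ∩ A ∧ lam⁻¹ • (w - (1 - lam) • x) ∈ L ∩ B} with hW
  have fW : volume W ≠ ⊤ :=
    measure_ne_top_of_subset (fun x hx => hx.1.1 : W ⊆ K) fK
  have hWv : lam ^ n / 4 < volume.real W :=
    (ENNReal.ofReal_lt_iff_lt_toReal (by positivity) fW).1 hw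
  have hsplit : ∀ x, w = (1 - lam) • x + lam • lam⁻¹ • (w - (1 - lam) • x) := fun x => by
    rw [smul_inv_smul₀ h0.ne']; abel
  refine ⟨w, ?_, ?_⟩
  · obtain ⟨x, hx⟩ : W.Nonempty := by
      rw [Set.nonempty_iff_ne_empty]; intro h
      rw [h] at hWv; simp at hWv
      have : 0 < lam ^ n := by positivity
      linarith
    rw [hsplit x]
    exact Set.add_mem_add (Set.smul_mem_smul_set hx.1.1) (Set.smul_mem_smul_set hx.2.1)
  rintro _ ⟨_, ⟨_, ⟨a, ha, rfl⟩, _, ⟨b, hb, rfl⟩, rfl⟩, rfl⟩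
  by_contra hcon
  set f : (Fin n → ℝ) → (Fin n → ℝ) := fun x => (1 - t) • a + t • x with hf
  set c' := t * lam⁻¹ * (1 - lam) with hc'
  have hc'0 : 0 < c' := by positivity
  set v0 : Fin n → ℝ := (1 - t) • b + (t * lam⁻¹) • w with hv0
  have hg : ∀ x, v0 + (-c') • x = (1 - t) • b + t • lam⁻¹ • (w - (1 - lam) • x) := by
    intro x
    simp only [hv0, hc', smul_sub, smul_smul, neg_smul]
    rw [← mul_assoc]; abel
  have hcover : W ⊆ {x | f x ∈ K \ A} ∪ {x | v0 + (-c') • x ∈ L \ B} := by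
    intro x hx
    have m1 : f x ∈ K := hKc ha hx.1.1 (by linarith) ht0.le (by ring)
    have m2 : v0 + (-c') • x ∈ L := by
      rw [hg]; exact hLc hb hx.2.1 (by linarith) ht0.le (by ring)
    by_contra hx'
    simp only [Set.mem_union, Set.mem_ofPred_eq, Set.mem_sdiff, m1, m2, true_and, not_or,
      not_not] at hx'
    refine hcon ⟨_, Set.smul_mem_smul_set hx'.1, _, Set.smul_mem_smul_set hx'.2, ?_⟩
    dsimp only
    rw [hg]
    conv_rhs => rw [hsplit x]
    simp only [hf]
    module
  have fKA : volume (K \ A) ≠ ⊤ := measure_ne_top_of_subset Set.sdiff_subset fK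
  have fLB : volume (L \ B) ≠ ⊤ := measure_ne_top_of_subset Set.sdiff_subset fL
  have e1 := volume_affine_preimage ht0.ne' ((1 - t) • a) (K \ A)
  have e2 := volume_affine_preimage (c := -c') (by linarith [hc'0] : -c' ≠ 0) v0 (L \ B)
  have e1' : volume.real {x | f x ∈ K \ A} = (t ^ n)⁻¹ * volume.real (K \ A) := by
    rw [measureReal_def, e1, ENNReal.toReal_mul, ENNReal.toReal_ofReal (abs_nonneg _),
      abs_of_pos (by positivity), measureReal_def]
  have e2' : volume.real {x | v0 + (-c') • x ∈ L \ B} = (c' ^ n)⁻¹ * volume.real (L \ B) := by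
    rw [measureReal_def, e2, ENNReal.toReal_mul, ENNReal.toReal_ofReal (abs_nonneg _),
      abs_inv, abs_pow, abs_neg, abs_of_pos hc'0, measureReal_def]
  have hle : volume.real W ≤ (t ^ n)⁻¹ * γ + (c' ^ n)⁻¹ * γ := by
    calc volume.real W ≤ volume.real ({x | f x ∈ K \ A} ∪ {x | v0 + (-c') • x ∈ L \ B}) := by
          refine measureReal_mono hcover (measure_union_ne_top ?_ ?_)
          · rw [e1]; finiteness
          · rw [e2]; finiteness
      _ ≤ _ := measureReal_union_le _ _
      _ ≤ _ := by rw [e1', e2']; gcongr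
  have e3 : (c' ^ n)⁻¹ = (t ^ n)⁻¹ * (lam / (1 - lam)) ^ n := by
    rw [hc', ← inv_pow, ← inv_pow, ← mul_pow]; congr 1; field_simp
  have htn : 0 < t ^ n := by positivity
  rw [e3] at hle
  have : t ^ n * volume.real W ≤ γ * (1 + (lam / (1 - lam)) ^ n) := by
    calc t ^ n * volume.real W ≤ t ^ n * ((t ^ n)⁻¹ * γ + (t ^ n)⁻¹ * (lam / (1 - lam)) ^ n * γ) := by
          gcongr
      _ = _ := by field_simp
  nlinarith

/-- A point whose combinations with `B` mostly stay in the sumset of the cores cannot be far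
outside `K`. -/
theorem outlier_le {n : ℕ} {B S K L Z : Set (Fin n → ℝ)} {lam γ t ζ : ℝ}
    (h0 : 0 < lam) (hL : IsCompact L) (hLc : Convex ℝ L) (hLne : L.Nonempty)
    (hZ : IsCompact Z) {u : (Fin n → ℝ) →L[ℝ] ℝ}
    (hZu : suppFn Z u ≤ (1 - lam) * suppFn K u + lam * suppFn L u)
    (fS : volume S ≠ ⊤) (hSv : volume.real (S \ Z) ≤ ζ)
    (hLB : volume.real (L \ B) ≤ γ) (ht0 : 0 ≤ t) (ht1 : t ≤ 1)
    (hcap : ζ / lam ^ n + γ < t ^ n * volume.real L) {x : Fin n → ℝ}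
    (hx : ∀ b ∈ B, (1 - lam) • x + lam • b ∈ S) :
    (1 - lam) * u x ≤ (1 - lam) * suppFn K u + lam * (t * wid L u) := by
  have fL := (hL.measure_lt_top (μ := volume)).ne
  set c := (suppFn Z u - (1 - lam) * u x) / lam with hc
  have hlc : lam * c = suppFn Z u - (1 - lam) * u x := by rw [hc]; field_simp
  suffices suppFn L u - t * wid L u ≤ c by
    have := mul_le_mul_of_nonneg_left this h0.le
    rw [hlc] at this
    linarith
  refine le_of_forall_gt_imp_ge_of_dense fun c' hc' => ?_
  have hcov : L ∩ {y | c' ≤ u y} ⊆ {y | (1 - lam) • x + lam • y ∈ S \ Z} ∪ (L \ B) := by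
    intro y hy
    by_cases hyB : y ∈ B
    · refine Or.inl ⟨hx y hyB, fun hyZ => ?_⟩
      have := le_suppFn hZ u hyZ
      rw [map_add, map_smul, map_smul, smul_eq_mul, smul_eq_mul] at this
      have i1 : lam * c < lam * u y := mul_lt_mul_of_pos_left (hc'.trans_le hy.2) h0
      linarith
    · exact Or.inr ⟨hy.1, hyB⟩
  have e1 := volume_affine_preimage h0.ne' ((1 - lam) • x) (S \ Z)
  have fSZ : volume (S \ Z) ≠ ⊤ := measure_ne_top_of_subset Set.sdiff_subset fS
  have e1' : volume.real {y | (1 - lam) • x + lam • y ∈ S \ Z} =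
      (lam ^ n)⁻¹ * volume.real (S \ Z) := by
    rw [measureReal_def, e1, ENNReal.toReal_mul, ENNReal.toReal_ofReal (abs_nonneg _),
      abs_of_pos (by positivity), measureReal_def]
  have hle : volume.real (L ∩ {y | c' ≤ u y}) ≤ ζ / lam ^ n + γ := by
    calc volume.real (L ∩ {y | c' ≤ u y}) ≤ _ := by
          refine measureReal_mono hcov (measure_union_ne_top ?_
            (measure_ne_top_of_subset Set.sdiff_subset fL))
          rw [e1]; finiteness
      _ ≤ _ := measureReal_union_le _ _
      _ ≤ _ := by
        rw [e1', div_eq_inv_mul]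
        gcongr
  have := lt_of_volume_cap_lt hL hLc hLne u ht0 ht1 (D := suppFn L u - c') (by
    rw [sub_sub_cancel]; exact hle.trans_lt hcap)
  linarith

theorem suppFn_combination_le {n : ℕ} {K L : Set (Fin n → ℝ)} {lam : ℝ} (h0 : 0 ≤ lam)
    (h1 : lam ≤ 1) (hK : IsCompact K) (hL : IsCompact L) (hKne : K.Nonempty) (hLne : L.Nonempty)
    (u : (Fin n → ℝ) →L[ℝ] ℝ) :
    suppFn ((1 - lam) • K + lam • L) u ≤ (1 - lam) * suppFn K u + lam * suppFn L u := by
  refine suppFn_le (hKne.smul_set.add hLne.smul_set) u ?_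
  rintro _ ⟨_, ⟨x, hx, rfl⟩, _, ⟨y, hy, rfl⟩, rfl⟩
  simp only [map_add, map_smul, smul_eq_mul]
  have i1 := mul_le_mul_of_nonneg_left (le_suppFn hK u hx) (by linarith : 0 ≤ 1 - lam)
  have i2 := mul_le_mul_of_nonneg_left (le_suppFn hL u hy) h0
  linarith

theorem brunn_minkowski_of_volume_eq {n : ℕ} {K L S : Set (Fin n → ℝ)} {lam V : ℝ} (h0 : 0 < lam)
    (h1 : lam < 1) (hK : MeasurableSet K) (hL : MeasurableSet L) (hS : MeasurableSet S)
    (H : (1 - lam) • K + lam • L ⊆ S) (hKV : ENNReal.ofReal V ≤ volume K)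
    (hLV : ENNReal.ofReal V ≤ volume L) : ENNReal.ofReal V ≤ volume S := by
  have h1' : 0 < 1 - lam := by linarith
  refine le_trans ?_ (brunn_minkowski h0 h1 hK hL hS H)
  calc ENNReal.ofReal V = ENNReal.ofReal V ^ (1 - lam) * ENNReal.ofReal V ^ lam := by
        rw [← ENNReal.rpow_add_of_nonneg _ _ h1'.le h0.le, sub_add_cancel, ENNReal.rpow_one]
    _ ≤ _ := by gcongr

set_option maxHeartbeats 800000 in
/-- From convex cores of `A` and `B` to a convex set containing translates of both. -/
theorem exists_convex_superset {k : ℕ} {A B S K L : Set (Fin (k + 1) → ℝ)}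
    {lam τ δ γ s t ζ d κ V : ℝ} (hτ : 0 < τ) (h0 : τ ≤ lam) (h1 : τ ≤ 1 - lam)
    (hA : MeasurableSet A) (hB : MeasurableSet B) (hS : MeasurableSet S)
    (H : (1 - lam) • A + lam • B ⊆ S) (hδ0 : 0 ≤ δ) (hδ1 : δ ≤ 1 / 2)
    (hSv : volume S ≤ ENNReal.ofReal (1 + δ))
    (hK : IsCompact K) (hL : IsCompact L) (hKc : Convex ℝ K) (hLc : Convex ℝ L)
    (hKA : volume.real (K \ A) ≤ γ) (hLB : volume.real (L \ B) ≤ γ)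
    (hKV : volume.real K = V) (hLV : volume.real L = V) (hVγ : 3 / 4 + γ ≤ V)
    (hs0 : 0 < s) (hs1 : s < 1)
    (hcap : γ * (1 + (1 / τ) ^ (k + 1)) ≤ s ^ (k + 1) * (τ ^ (k + 1) / 4))
    (hd0 : 0 ≤ d) (hd : 1 + δ ≤ (1 - s) ^ (k + 1) * (V * (1 + d)))
    (hκ0 : 0 < κ) (hκ1 : κ ≤ 1 / 8) (hdκ : d < τ ^ 2 * κ ^ (2 * k + 4) / 2)
    (hζ : 1 + δ - (1 - s) ^ (k + 1) * V ≤ ζ) (ht0 : 0 ≤ t) (ht1 : t ≤ 1)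
    (hcap' : ζ / τ ^ (k + 1) + γ < t ^ (k + 1) * V) :
    ∃ (P : Set (Fin (k + 1) → ℝ)) (b : Fin (k + 1) → ℝ), Convex ℝ P ∧ IsCompact P ∧ A ⊆ P ∧
      B + {b} ⊆ P ∧
      volume.real P = (1 + (k + 2) * (10 * κ + 2 * t / τ)) ^ (k + 1) * V := by
  have hl0 : 0 < lam := by linarith
  have hl1 : 0 < 1 - lam := by linarith
  have hl1' : lam < 1 := by linarith
  have hγ0 : 0 ≤ γ := measureReal_nonneg.trans hKA
  have hV : 0 < V := by linarith
  have hKne : K.Nonempty := by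
    rw [Set.nonempty_iff_ne_empty]; rintro rfl; simp at hKV; linarith
  have hLne : L.Nonempty := by
    rw [Set.nonempty_iff_ne_empty]; rintro rfl; simp at hLV; linarith
  have hτ1 : τ ≤ 1 := by linarith
  have fK := (hK.measure_lt_top (μ := volume)).ne
  have fL := (hL.measure_lt_top (μ := volume)).ne
  have fS : volume S ≠ ⊤ := ne_top_of_le_ne_top ENNReal.ofReal_ne_top hSv
  have hSv' : volume.real S ≤ 1 + δ := ENNReal.toReal_le_of_le_ofReal (by linarith) hSv
  set Z := (1 - lam) • K + lam • L with hZ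
  have hZc : IsCompact Z := (hK.smul _).add (hL.smul _)
  have fZ := (hZc.measure_lt_top (μ := volume)).ne
  have hratio : ∀ x y : ℝ, 0 < x → x ≤ 1 → τ ≤ y → (x / y) ^ (k + 1) ≤ (1 / τ) ^ (k + 1) := by
    intro x y hx hx1 hy
    have : 0 < y := hτ.trans_le hy
    gcongr
  obtain ⟨w, hwZ, hw⟩ := exists_homothety_subset hl0 hl1' hA hB hS H
    (hSv.trans (ENNReal.ofReal_le_ofReal (by linarith))) hK hL hKc hLc hKA hLB
    (hVγ.trans hKV.ge) (hVγ.trans hLV.ge) hs0 hs1.le (by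
      calc γ * (1 + (lam / (1 - lam)) ^ (k + 1)) ≤ γ * (1 + (1 / τ) ^ (k + 1)) := by
            have := hratio lam (1 - lam) hl0 hl1'.le h1
            gcongr
        _ ≤ _ := hcap
        _ ≤ _ := by gcongr)
  set Z' := (fun x => s • w + (1 - s) • x) '' Z with hZ'
  have hZ'v : volume.real Z' = (1 - s) ^ (k + 1) * volume.real Z :=
    volume_real_affine_image (by linarith) _ _
  have hZ'S : Z' ⊆ S := hw.trans H
  have hZconv : Convex ℝ Z := (hKc.smul _).add (hLc.smul _)
  have hZ'Z : Z' ⊆ Z := by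
    rintro _ ⟨x, hx, rfl⟩
    exact hZconv hwZ hx hs0.le (by linarith) (by ring)
  have hs' : 0 < (1 - s) ^ (k + 1) := by
    have : 0 < 1 - s := by linarith
    positivity
  have hZV : V ≤ volume.real Z :=
    (ENNReal.ofReal_le_iff_le_toReal fZ).1 (brunn_minkowski_of_volume_eq hl0 hl1' hK.measurableSet
      hL.measurableSet hZc.measurableSet subset_rfl (ENNReal.ofReal_le_of_le_toReal hKV.ge)
      (ENNReal.ofReal_le_of_le_toReal hLV.ge))
  have hZ'S' : volume.real Z' ≤ volume.real S := measureReal_mono hZ'S fS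
  have hZd : volume.real Z ≤ V * (1 + d) := by
    rw [hZ'v] at hZ'S'
    exact le_of_mul_le_mul_left (hZ'S'.trans (hSv'.trans hd)) hs'
  have hSZ : volume.real (S \ Z) ≤ ζ := by
    have e := measureReal_inter_add_sdiff (μ := volume) (s := S) hZc.measurableSet fS
    have i1 : volume.real Z' ≤ volume.real (S ∩ Z) :=
      measureReal_mono (Set.subset_inter hZ'S hZ'Z)
        (measure_ne_top_of_subset Set.inter_subset_left fS)
    have i2 : (1 - s) ^ (k + 1) * V ≤ (1 - s) ^ (k + 1) * volume.real Z := by gcongr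
    linarith
  have hζ0 : 0 ≤ ζ := measureReal_nonneg.trans hSZ
  have hdκ' : d < lam * (1 - lam) * κ ^ (2 * k + 4) / 2 := by
    refine hdκ.trans_le ?_
    rw [sq]; gcongr
  have hwid : ∀ u, wid L u ≤ 2 * wid K u := fun u =>
    wid_le_two_mul hl0 hl1' hκ0 hκ1 hK hL hLc hV hKV hLV hZd hdκ' u
  have hswap : Z = (1 - (1 - lam)) • L + (1 - lam) • K := by
    rw [hZ, sub_sub_cancel, add_comm (lam • L)]
  have hcapA : ζ / lam ^ (k + 1) + γ < t ^ (k + 1) * volume.real L := by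
    rw [hLV]
    refine lt_of_le_of_lt ?_ hcap'
    gcongr
  have hcapB : ζ / (1 - lam) ^ (k + 1) + γ < t ^ (k + 1) * volume.real K := by
    rw [hKV]
    refine lt_of_le_of_lt ?_ hcap'
    gcongr
  have hAout : ∀ x ∈ A, ∀ u, u x ≤ suppFn K u + t / τ * (2 * wid K u) := by
    intro x hx u
    have := outlier_le hl0 hL hLc hLne hZc
      (suppFn_combination_le hl0.le hl1'.le hK hL hKne hLne u) fS hSZ hLB ht0 ht1 hcapA (x := x)
      (fun b hb => H (Set.add_mem_add (Set.smul_mem_smul_set hx) (Set.smul_mem_smul_set hb)))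
    have hw0 := wid_nonneg hL hLne u
    have e : lam * (t * wid L u) ≤ (1 - lam) * (t / τ * (2 * wid K u)) := by
      calc lam * (t * wid L u) ≤ 1 * (t * wid L u) := by gcongr
        _ = τ * (t / τ * wid L u) := by field_simp
        _ ≤ (1 - lam) * (t / τ * (2 * wid K u)) := by
          gcongr; exact hwid u
    refine le_of_mul_le_mul_left (this.trans ?_) hl1
    linarith
  have hBout : ∀ y ∈ B, ∀ u, u y ≤ suppFn L u + t / τ * wid K u := by
    intro y hy u
    have := outlier_le (lam := 1 - lam) (K := L) (L := K) (B := A) (S := S) (Z := Z) hl1 hK hKc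
      hKne hZc
      (by rw [hswap]; exact suppFn_combination_le hl1.le (by linarith) hL hK hLne hKne u)
      fS hSZ hKA ht0 ht1 hcapB (x := y)
      (fun b hb => H (by
        rw [sub_sub_cancel, add_comm (lam • y)]
        exact Set.add_mem_add (Set.smul_mem_smul_set hb) (Set.smul_mem_smul_set hy)))
    rw [sub_sub_cancel] at this
    have hw0 := wid_nonneg hK hKne u
    have e : (1 - lam) * (t * wid K u) ≤ lam * (t / τ * wid K u) := by
      calc (1 - lam) * (t * wid K u) ≤ 1 * (t * wid K u) := by gcongr; linarith
        _ = τ * (t / τ * wid K u) := by field_simp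
        _ ≤ lam * (t / τ * wid K u) := by gcongr
    refine le_of_mul_le_mul_left (this.trans ?_) hl0
    linarith
  set b := V⁻¹ • ((∫ x in K, x) - ∫ x in L, x) with hb
  have hsupp : ∀ u : (Fin (k + 1) → ℝ) →L[ℝ] ℝ,
      suppFn L u + u b ≤ suppFn K u + 10 * κ * wid K u := fun u =>
    suppFn_add_le hl0 hl1' hκ0 hκ1 hK hL hLc hV hKV hLV hZd hdκ' hd0 u
  obtain ⟨z, -, hz⟩ := exists_center hK hKc hKne
  set T := 10 * κ + 2 * t / τ with hT
  have hT0 : 0 ≤ T := by positivity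
  have hTe : 2 * t / τ = t / τ * 2 := by ring
  have htτ : 0 ≤ t / τ := by positivity
  refine ⟨(fun y => (-(((k + 1 : ℕ) + 1) * T)) • z + (1 + ((k + 1 : ℕ) + 1) * T) • y) '' K, b,
    ?_, hK.image (by fun_prop), ?_, ?_, ?_⟩
  · rw [← Set.image_image (fun y => (-(((k + 1 : ℕ) + 1) * T)) • z + y)
      (fun y => (1 + ((k + 1 : ℕ) + 1) * T) • y)]
    exact (hKc.smul _).translate _
  · intro x hx
    refine mem_dilation_of_le hK hKc hKne hT0 hz fun u => (hAout x hx u).trans ?_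
    have := wid_nonneg hK hKne u
    have := mul_nonneg hκ0.le this
    rw [hT, hTe, add_mul]; linarith
  · rintro _ ⟨y, hy, _, rfl, rfl⟩
    refine mem_dilation_of_le hK hKc hKne hT0 hz fun u => ?_
    have := wid_nonneg hK hKne u
    have i1 := hBout y hy u
    have i2 := hsupp u
    have := mul_nonneg htτ this
    rw [map_add, hT, hTe, add_mul]; linarith
  · rw [volume_real_affine_image (by positivity), hKV]
    push_cast; ring

theorem one_add_pow_le_of_small {y : ℝ} (n : ℕ) (hy : 0 ≤ y) (hny : n * y ≤ 1 / 2) :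
    (1 + y) ^ n ≤ 1 + 2 * (n * y) := by
  rcases Nat.eq_zero_or_pos n with rfl | hn
  · simp
  have hy1 : y ≤ 1 := by
    have : (1 : ℝ) ≤ n := by exact_mod_cast hn
    nlinarith
  have h1 := one_add_mul_le_pow (by linarith : (-2 : ℝ) ≤ -y) n
  have h2 : (1 + y) ^ n * (1 + -y) ^ n ≤ 1 := by
    rw [← mul_pow]
    exact pow_le_one₀ (by nlinarith) (by nlinarith)
  have h3 : 0 < (1 + y) ^ n := by positivity
  have h4 : (1 + y) ^ n * (1 - n * y) ≤ 1 :=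
    (mul_le_mul_of_nonneg_left (by linarith) h3.le).trans h2
  have h5 : 0 ≤ (n : ℝ) * y := by positivity
  nlinarith

theorem exists_isCompact_subset_volume_ge {n : ℕ} {A : Set (Fin n → ℝ)} (hA : MeasurableSet A)
    (vA : volume A = 1) {δ : ℝ} (hδ : 0 < δ) :
    ∃ A' ⊆ A, IsCompact A' ∧ 1 - δ ≤ volume.real A' ∧ volume.real A' ≤ 1 := by
  obtain ⟨A', hA', hc, hv⟩ := hA.exists_lt_isCompact (μ := volume) (r := ENNReal.ofReal (1 - δ)) (by
    rw [vA, ENNReal.ofReal_lt_one]; linarith)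
  have f := (hc.measure_lt_top (μ := volume)).ne
  refine ⟨A', hA', hc, (ENNReal.ofReal_le_iff_le_toReal f).1 hv.le, ?_⟩
  have := measure_mono (μ := volume) hA'
  rw [vA] at this
  exact ENNReal.toReal_le_of_le_ofReal zero_le_one (by simpa using this)

/-- A convex core of `A` all of whose parameters are powers of a small number `ξ`. -/
theorem exists_core_of_small {k : ℕ} {A' : Set (Fin (k + 1) → ℝ)} {ξ a w : ℝ}
    (hξ0 : 0 < ξ) (hξ : ξ * (1024 * (k + 2) ^ 2 * 2 ^ ((k + 2) * (k + 1))) ≤ 1)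
    (ha0 : 0 < a) (ha1 : a ≤ 1) (hw : w = (a * ξ ^ 2) ^ (k + 1) * ξ) (hA : IsCompact A')
    (hp : ∀ s : ℝ, 0 ≤ s → s ≤ 1 → pairDefect A' s ≤ ENNReal.ofReal (w ^ 4 * ξ ^ 4))
    (hA0 : 1 - w ≤ volume.real A') (hA1 : volume.real A' ≤ 1) :
    ∃ C : Set (Fin (k + 1) → ℝ), IsCompact C ∧ Convex ℝ C ∧
      volume.real (C \ A') ≤ w ^ 2 * ξ ^ 2 ∧ 1 - a * ξ ≤ volume.real C := by
  set D : ℝ := 2 ^ ((k + 2) * (k + 1)) with hD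
  have hD1 : 1 ≤ D := one_le_pow₀ (by norm_num)
  have hDk : (2 : ℝ) ^ (k + 1) ≤ D := pow_le_pow_right₀ (by norm_num) (by nlinarith)
  have hk0 : (0 : ℝ) ≤ k := by positivity
  have hkk : (1 : ℝ) ≤ (k + 2) ^ 2 := by nlinarith
  have hξD : 1024 * (ξ * D) ≤ 1 := by
    refine le_trans ?_ hξ
    have : 0 ≤ ξ * D * ((k + 2 : ℝ) ^ 2 - 1) := by
      apply mul_nonneg (by positivity); linarith
    linarith
  have hξk : 1024 * (ξ * (k + 2) ^ 2) ≤ 1 := by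
    refine le_trans ?_ hξ
    have : 0 ≤ ξ * (k + 2 : ℝ) ^ 2 * (D - 1) := by
      apply mul_nonneg (by positivity); linarith
    linarith
  have hξ1 : 1024 * ξ ≤ 1 := by
    have : ξ ≤ ξ * D := le_mul_of_one_le_right hξ0.le hD1
    linarith
  have hw0 : 0 < w := by rw [hw]; positivity
  have haξ : a * ξ ^ 2 ≤ ξ := by
    have : a * ξ ^ 2 ≤ 1 * ξ ^ 2 := by gcongr
    nlinarith
  have hwa : w ≤ a * ξ ^ 2 * ξ := by
    rw [hw]
    have : (a * ξ ^ 2) ^ (k + 1) ≤ a * ξ ^ 2 :=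
      pow_le_of_le_one (by positivity) (by linarith) (by omega)
    gcongr
  have hw1 : w ≤ ξ := by nlinarith
  have hpow : ((2 : ℝ) ^ (k + 1 + 1)) ^ (k + 1) = D := by rw [hD, ← pow_mul]
  obtain ⟨C, hC, hCc, hCA, hCv⟩ := exists_core hA (ε := w ^ 4 * ξ ^ 4) (η := w ^ 2 * ξ) (q := w)
    (t := a * ξ ^ 2) (γ := w ^ 2 * ξ ^ 2) (by positivity) (by positivity)
    (by
      rw [hpow, div_pow, le_div_iff₀ (by positivity)]
      have : (2 * (ξ * D)) ^ 2 ≤ 1 := pow_le_one₀ (by positivity) (by linarith)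
      calc 4 * (w ^ 4 * ξ ^ 4) * D ^ 2 = w ^ 4 * ξ ^ 2 * (2 * (ξ * D)) ^ 2 := by ring
        _ ≤ w ^ 4 * ξ ^ 2 * 1 := by gcongr
        _ = _ := by ring)
    hp
    (by
      rw [hpow, div_div_eq_mul_div, div_le_iff₀ (by positivity)]
      calc w ^ 4 * ξ ^ 4 * D = w ^ 2 * w ^ 2 * ξ ^ 3 * (ξ * D) := by ring
        _ ≤ w ^ 2 * w ^ 2 * ξ ^ 3 * 1 := by gcongr; linarith [mul_pos hξ0 (by positivity : 0 < D)]
        _ = _ := by ring)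
    (by
      have e1 : w ^ 4 * ξ ^ 4 ≤ w ^ 2 * ξ := by
        have i1 : w ^ 2 ≤ 1 := pow_le_one₀ hw0.le (by linarith)
        have i2 : ξ ^ 3 ≤ 1 := pow_le_one₀ hξ0.le (by linarith)
        calc w ^ 4 * ξ ^ 4 = w ^ 2 * ξ * (w ^ 2 * ξ ^ 3) := by ring
          _ ≤ w ^ 2 * ξ * (1 * 1) := by gcongr
          _ = _ := by ring
      have e2 : 2 ^ (k + 1) * (w ^ 2 * ξ) ≤ w ^ 2 * (ξ * D) := by
        calc 2 ^ (k + 1) * (w ^ 2 * ξ) ≤ D * (w ^ 2 * ξ) := by gcongr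
          _ = _ := by ring
      have e3 : 0 < w ^ 2 := by positivity
      nlinarith)
    hw0 (by linarith) (by positivity) (by linarith)
    (by
      have e1 : w ^ 2 * ξ ^ 2 ≤ w := by
        have i2 : ξ ^ 2 ≤ 1 := pow_le_one₀ hξ0.le (by linarith)
        calc w ^ 2 * ξ ^ 2 = w * (w * ξ ^ 2) := by ring
          _ ≤ w * (1 * 1) := by gcongr; linarith
          _ = w := by ring
      have e2 : (2 : ℝ) ^ (k + 1 + 3) = 8 * 2 ^ (k + 1) := by rw [pow_add]; ring
      have e3 : 0 < (a * ξ ^ 2) ^ (k + 1) := by positivity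
      calc (w + w ^ 2 * ξ ^ 2) * 2 ^ (k + 1 + 3) ≤ (w + w) * (8 * D) := by
            rw [e2]; gcongr
        _ = (a * ξ ^ 2) ^ (k + 1) * (16 * (ξ * D)) := by rw [hw]; ring
        _ < (a * ξ ^ 2) ^ (k + 1) * 1 := by
            apply mul_lt_mul_of_pos_left _ e3; linarith
        _ = _ := mul_one _)
    (by linarith) hA1
  refine ⟨C, hC, hCc, hCA, ?_⟩
  have hC0 : 0 ≤ volume.real C := measureReal_nonneg
  have hsm : ((k + 1 : ℕ) : ℝ) * (((k + 1 : ℕ) + 1) * (a * ξ ^ 2)) ≤ a * ξ / 1024 := by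
    push_cast
    calc ((k : ℝ) + 1) * ((k + 1 + 1) * (a * ξ ^ 2)) ≤ (k + 2) * ((k + 2) * (a * ξ ^ 2)) := by
          rw [show (k : ℝ) + 1 + 1 = k + 2 by ring]
          gcongr
          linarith
      _ = a * ξ * (ξ * (k + 2) ^ 2) := by ring
      _ ≤ a * ξ * (1 / 1024) := by gcongr; linarith
      _ = _ := by ring
  have haξ' : a * ξ ≤ ξ := mul_le_of_le_one_left hξ0.le ha1
  have hb := one_add_pow_le_of_small (k + 1) (y := ((k + 1 : ℕ) + 1) * (a * ξ ^ 2)) (by positivity)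
    (hsm.trans (by linarith))
  have hb' : (1 + ((k + 1 : ℕ) + 1) * (a * ξ ^ 2)) ^ (k + 1) ≤ 1 + a * ξ / 512 := by
    refine hb.trans ?_
    linarith
  have h1 : 1 - w ≤ w + (1 + a * ξ / 512) * volume.real C := by
    refine hA0.trans (hCv.trans ?_)
    gcongr
  have hwa' : w ≤ a * ξ / 1024 := by
    have : a * ξ ^ 2 * ξ = a * ξ * (ξ * ξ) := by ring
    have : a * ξ * (ξ * ξ) ≤ a * ξ * (1 / 1024) := by
      gcongr; nlinarith
    linarith
  have hpos : 0 < a * ξ := by positivity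
  by_contra! hcon
  nlinarith

/-- Size relations between the parameters `ξ`, `a`, `w` of the convex cores. -/
theorem core_parameter_bounds {k : ℕ} {τ ξ a w : ℝ} (hτ : 0 < τ) (hτ2 : τ ≤ 1 / 2) (hξ0 : 0 < ξ)
    (hξ : ξ * (1024 * (k + 2) ^ 2 * 2 ^ ((k + 2) * (k + 1))) ≤ τ ^ (2 * (k + 1) + 2))
    (ha : a = (ξ ^ 5) ^ (2 * k + 4) * ξ) (hw : w = (a * ξ ^ 2) ^ (k + 1) * ξ) :
    1024 * (ξ * (k + 2) ^ 2) ≤ τ ^ (2 * (k + 1) + 2) ∧ 1024 * ξ ≤ τ ^ (2 * (k + 1) + 2) ∧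
      τ ^ (2 * (k + 1) + 2) ≤ τ ^ 2 ∧ 1024 * ξ ≤ 1 ∧ ξ ^ 2 ≤ ξ / 1024 ∧ 0 < a ∧ a ≤ ξ ∧ 0 < w ∧
      w ≤ a * ξ / 1024 ∧ w ≤ 1 ∧ w ^ 4 * ξ ^ 6 ≤ w ∧ w ^ 4 * ξ ^ 6 ≤ 1 / 2 ∧
      w ^ 2 * ξ ^ 2 ≤ ξ / 1024 := by
  set D : ℝ := 2 ^ ((k + 2) * (k + 1)) with hD
  have hD1 : 1 ≤ D := one_le_pow₀ (by norm_num)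
  have hk0 : (0 : ℝ) ≤ k := by positivity
  have hkk : (1 : ℝ) ≤ (k + 2) ^ 2 := by nlinarith
  have hτ' : τ ^ (2 * (k + 1) + 2) ≤ τ ^ 2 :=
    pow_le_pow_of_le_one hτ.le (by linarith) (by omega)
  have hξk : 1024 * (ξ * (k + 2) ^ 2) ≤ τ ^ (2 * (k + 1) + 2) := by
    refine le_trans ?_ hξ
    have : 0 ≤ ξ * (k + 2 : ℝ) ^ 2 * (D - 1) := by
      apply mul_nonneg (by positivity); linarith
    linarith
  have hξτ : 1024 * ξ ≤ τ ^ (2 * (k + 1) + 2) := by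
    refine le_trans ?_ hξk
    have : ξ ≤ ξ * (k + 2 : ℝ) ^ 2 := le_mul_of_one_le_right hξ0.le hkk
    linarith
  have hτ4 : τ ^ 2 ≤ 1 / 4 := by nlinarith
  have hξ1 : 1024 * ξ ≤ 1 := by linarith
  have ha0 : 0 < a := by rw [ha]; positivity
  have hξ5 : ξ ^ 5 ≤ 1 := pow_le_one₀ hξ0.le (by linarith)
  have haξ : a ≤ ξ := by
    rw [ha]
    exact mul_le_of_le_one_left hξ0.le (pow_le_one₀ (by positivity) hξ5)
  have ha1 : a ≤ 1 := by linarith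
  have hw0 : 0 < w := by rw [hw]; positivity
  have hwa : w ≤ a * ξ ^ 2 * ξ := by
    have : (a * ξ ^ 2) ^ (k + 1) ≤ a * ξ ^ 2 :=
      pow_le_of_le_one (by positivity) (by nlinarith) (by omega)
    rw [hw]; gcongr
  have hξ2 : ξ ^ 2 ≤ ξ / 1024 := by nlinarith
  have hwa2 : w ≤ a * ξ / 1024 := by
    calc w ≤ a * ξ ^ 2 * ξ := hwa
      _ ≤ a * ξ ^ 2 * 1 := by gcongr; linarith
      _ ≤ a * (ξ / 1024) := by rw [mul_one]; gcongr
      _ = _ := by ring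
  have hw1 : w ≤ 1 := by nlinarith
  have hδ0 : 0 < w ^ 4 * ξ ^ 6 := by positivity
  have hδw : w ^ 4 * ξ ^ 6 ≤ w := by
    have i1 : w ^ 3 ≤ 1 := pow_le_one₀ hw0.le hw1
    have i2 : ξ ^ 6 ≤ 1 := pow_le_one₀ hξ0.le (by linarith)
    calc w ^ 4 * ξ ^ 6 = w * (w ^ 3 * ξ ^ 6) := by ring
      _ ≤ w * (1 * 1) := by gcongr
      _ = w := by ring
  have hδ1 : w ^ 4 * ξ ^ 6 ≤ 1 / 2 := by nlinarith
  have hγ : w ^ 2 * ξ ^ 2 ≤ ξ / 1024 := by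
    have : w ^ 2 ≤ 1 := pow_le_one₀ hw0.le hw1
    calc w ^ 2 * ξ ^ 2 ≤ 1 * (ξ / 1024) := by gcongr
      _ = _ := one_mul _
  exact ⟨hξk, hξτ, hτ', hξ1, hξ2, ha0, haξ, hw0, hwa2, hw1, hδw, hδ1, hγ⟩

set_option maxHeartbeats 1000000 in
theorem exists_cores_of_small {k : ℕ} {A B S : Set (Fin (k + 1) → ℝ)} {lam τ ξ a w : ℝ}
    (hτ : 0 < τ) (hτ2 : τ ≤ 1 / 2) (h0 : τ ≤ lam) (h1 : τ ≤ 1 - lam) (hA : MeasurableSet A)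
    (hB : MeasurableSet B) (vA : volume A = 1) (vB : volume B = 1) (hS : MeasurableSet S)
    (H : (1 - lam) • A + lam • B ⊆ S) (hξ0 : 0 < ξ)
    (hξ : ξ * (1024 * (k + 2) ^ 2 * 2 ^ ((k + 2) * (k + 1))) ≤ τ ^ (2 * (k + 1) + 2))
    (ha : a = (ξ ^ 5) ^ (2 * k + 4) * ξ) (hw : w = (a * ξ ^ 2) ^ (k + 1) * ξ)
    (hSv : volume S ≤ ENNReal.ofReal (1 + w ^ 4 * ξ ^ 6)) :
    ∃ (K L : Set (Fin (k + 1) → ℝ)) (V : ℝ), IsCompact K ∧ IsCompact L ∧ Convex ℝ K ∧ Convex ℝ L ∧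
      volume.real K = V ∧ volume.real L = V ∧ volume.real (K \ A) ≤ w ^ 2 * ξ ^ 2 ∧
      volume.real (L \ B) ≤ w ^ 2 * ξ ^ 2 ∧ 1 - a * ξ ≤ V ∧ V ≤ 1 + ξ / 1024 := by
  obtain ⟨hξk, hξτ, hτ', hξ1, hξ2, ha0, haξ, hw0, hwa2, hw1, hδw, hδ1, hγ⟩ :=
    core_parameter_bounds hτ hτ2 hξ0 hξ ha hw
  have ha1 : a ≤ 1 := by linarith
  have hδ0 : 0 < w ^ 4 * ξ ^ 6 := by positivity
  have hτ4 : τ ^ 2 ≤ 1 / 4 := by nlinarith only [hτ, hτ2]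
  have hdef : 135 * (w ^ 4 * ξ ^ 6) / τ ^ (2 * (k + 1) + 2) ≤ w ^ 4 * ξ ^ 4 := by
    rw [div_le_iff₀ (by positivity)]
    have : 135 * ξ ^ 2 ≤ τ ^ (2 * (k + 1) + 2) := by linarith
    calc 135 * (w ^ 4 * ξ ^ 6) = w ^ 4 * ξ ^ 4 * (135 * ξ ^ 2) := by ring
      _ ≤ _ := by gcongr
  obtain ⟨A', hA'A, hA', hA0, hA1⟩ := exists_isCompact_subset_volume_ge hA vA hδ0
  obtain ⟨B', hB'B, hB', hB0, hB1⟩ := exists_isCompact_subset_volume_ge hB vB hδ0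
  have hsub : (1 - lam) • A' + lam • B' ⊆ S :=
    (Set.add_subset_add (Set.smul_set_mono hA'A) (Set.smul_set_mono hB'B)).trans H
  have hξ' : ξ * (1024 * (k + 2) ^ 2 * 2 ^ ((k + 2) * (k + 1))) ≤ 1 := by linarith
  obtain ⟨K₀, hK₀, hK₀c, hK₀A, hK₀V⟩ := exists_core_of_small hξ0 hξ' ha0 ha1 hw hA'
    (fun s hs0 hs1 => (pairDefect_le_of_sumset hτ h0 h1 hA' hB' hS hsub hδ0.le hδ1 hA0 hA1 hB0
      hSv hs0 hs1).trans (ENNReal.ofReal_le_ofReal hdef)) (by linarith) hA1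
  obtain ⟨L₀, hL₀, hL₀c, hL₀B, hL₀V⟩ := exists_core_of_small hξ0 hξ' ha0 ha1 hw hB'
    (fun s hs0 hs1 => (pairDefect_le_of_sumset (lam := 1 - lam) (A := B') (B := A') hτ h1
      (by linarith) hB' hA' hS (by rw [sub_sub_cancel, add_comm (lam • B')]; exact hsub)
      hδ0.le hδ1 hB0 hB1 hA0 hSv hs0 hs1).trans (ENNReal.ofReal_le_ofReal hdef)) (by linarith) hB1
  set V := min (volume.real K₀) (volume.real L₀) with hV
  have hVl : 1 - a * ξ ≤ V := le_min hK₀V hL₀V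
  have haξ1 : a * ξ ≤ ξ := mul_le_of_le_one_left hξ0.le ha1
  have hV0 : 0 < V := by linarith
  have hVu : V ≤ 1 + ξ / 1024 := by
    have e := measureReal_inter_add_sdiff (μ := volume) (s := K₀) hA'.measurableSet
      (hK₀.measure_lt_top (μ := volume)).ne
    have : volume.real (K₀ ∩ A') ≤ volume.real A' :=
      measureReal_mono Set.inter_subset_right (hA'.measure_lt_top (μ := volume)).ne
    linarith [min_le_left (volume.real K₀) (volume.real L₀)]
  obtain ⟨K, hKK, hK, hKc, hKV⟩ := exists_subset_volume_eq (by omega) hK₀ hK₀c hV0 (min_le_left _ _)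
  obtain ⟨L, hLL, hL, hLc, hLV⟩ := exists_subset_volume_eq (by omega) hL₀ hL₀c hV0
    (min_le_right _ _)
  have hKA : volume.real (K \ A) ≤ w ^ 2 * ξ ^ 2 := (measureReal_mono (fun x hx =>
    ⟨hKK hx.1, fun h => hx.2 (hA'A h)⟩ : K \ A ⊆ K₀ \ A')
    (measure_ne_top_of_subset Set.sdiff_subset (hK₀.measure_lt_top (μ := volume)).ne)).trans hK₀A
  have hLB : volume.real (L \ B) ≤ w ^ 2 * ξ ^ 2 := (measureReal_mono (fun x hx =>
    ⟨hLL hx.1, fun h => hx.2 (hB'B h)⟩ : L \ B ⊆ L₀ \ B')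
    (measure_ne_top_of_subset Set.sdiff_subset (hL₀.measure_lt_top (μ := volume)).ne)).trans hL₀B
  exact ⟨K, L, V, hK, hL, hKc, hLc, hKV, hLV, hKA, hLB, hVl, hVu⟩

set_option maxHeartbeats 1000000 in
theorem stability_of_small_aux {k : ℕ} {A B S : Set (Fin (k + 1) → ℝ)} {lam τ ξ a w : ℝ}
    (hτ : 0 < τ) (hτ2 : τ ≤ 1 / 2) (h0 : τ ≤ lam) (h1 : τ ≤ 1 - lam) (hA : MeasurableSet A)
    (hB : MeasurableSet B) (vA : volume A = 1) (vB : volume B = 1) (hS : MeasurableSet S)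
    (H : (1 - lam) • A + lam • B ⊆ S) (hξ0 : 0 < ξ)
    (hξ : ξ * (1024 * (k + 2) ^ 2 * 2 ^ ((k + 2) * (k + 1))) ≤ τ ^ (2 * (k + 1) + 2))
    (ha : a = (ξ ^ 5) ^ (2 * k + 4) * ξ) (hw : w = (a * ξ ^ 2) ^ (k + 1) * ξ)
    (hSv : volume S ≤ ENNReal.ofReal (1 + w ^ 4 * ξ ^ 6)) :
    ∃ (P : Set (Fin (k + 1) → ℝ)) (b : Fin (k + 1) → ℝ), Convex ℝ P ∧ IsCompact P ∧ A ⊆ P ∧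
      B + {b} ⊆ P ∧ volume.real P ≤ 1 + ξ / 2 := by
  obtain ⟨hξk, hξτ, hτ', hξ1, hξ2, ha0, haξ, hw0, hwa2, hw1, hδw, hδ1, hγ⟩ :=
    core_parameter_bounds hτ hτ2 hξ0 hξ ha hw
  have ha1 : a ≤ 1 := by linarith
  have hδ0 : 0 < w ^ 4 * ξ ^ 6 := by positivity
  have hτ4 : τ ^ 2 ≤ 1 / 4 := by nlinarith only [hτ, hτ2]
  have hk0 : (0 : ℝ) ≤ k := by positivity
  have hξ5 : ξ ^ 5 ≤ 1 := pow_le_one₀ hξ0.le (by linarith)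
  obtain ⟨K, L, V, hK, hL, hKc, hLc, hKV, hLV, hKA, hLB, hVl, hVu⟩ :=
    exists_cores_of_small hτ hτ2 h0 h1 hA hB vA vB hS H hξ0 hξ ha hw hSv
  have haξ1 : a * ξ ≤ ξ := mul_le_of_le_one_left hξ0.le ha1
  have hV0 : 0 < V := by linarith
  have hs2 : a * ξ ^ 2 ≤ 1 / 1024 := by
    calc a * ξ ^ 2 ≤ 1 * (ξ / 1024) := by gcongr
      _ ≤ _ := by linarith
  have hs : 1 - a * ξ / 1024 ≤ (1 - a * ξ ^ 2) ^ (k + 1) := by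
    have h2 := one_add_mul_le_pow (by linarith : (-2 : ℝ) ≤ -(a * ξ ^ 2)) (k + 1)
    rw [← sub_eq_add_neg] at h2
    refine le_trans ?_ h2
    push_cast
    have i1 : ((k : ℝ) + 1) * ξ ≤ 1 / 1024 := by
      have : ((k : ℝ) + 1) * ξ ≤ (k + 2) ^ 2 * ξ := by
        gcongr; nlinarith only [hk0]
      linarith
    have : a * ξ * (((k : ℝ) + 1) * ξ) ≤ a * ξ * (1 / 1024) := by gcongr
    linarith
  have hsV : 1 - 2 * (a * ξ) ≤ (1 - a * ξ ^ 2) ^ (k + 1) * V := by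
    have : 0 < a * ξ := by positivity
    calc 1 - 2 * (a * ξ) ≤ (1 - a * ξ / 1024) * (1 - a * ξ) := by nlinarith only [this]
      _ ≤ _ := by gcongr <;> linarith
  have hτn : τ ^ (2 * (k + 1) + 2) ≤ τ ^ (k + 1) * τ ^ (k + 1) := by
    rw [← pow_add]; exact pow_le_pow_of_le_one hτ.le (by linarith) (by omega)
  have hτn1 : τ ^ (k + 1) ≤ 1 := pow_le_one₀ hτ.le (by linarith)
  have hτn0 : 0 < τ ^ (k + 1) := by positivity
  have hξτ1 : 1024 * ξ ≤ τ := by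
    have : τ ^ 2 ≤ τ := by nlinarith only [hτ, hτ2]
    linarith
  obtain ⟨P, b, hP, hPc, hAP, hBP, hPV⟩ := exists_convex_superset (s := a * ξ ^ 2) (d := a) (ζ := a)
    (κ := ξ ^ 5) (t := ξ ^ 5) hτ h0 h1 hA hB hS H hδ0.le hδ1 hSv hK hL hKc hLc hKA hLB hKV hLV
    (by linarith) (by positivity) (by linarith)
    (by
      have e1 : w ^ 2 * ξ ^ 2 ≤ w := by
        have i2 : ξ ^ 2 ≤ 1 := pow_le_one₀ hξ0.le (by linarith)
        calc w ^ 2 * ξ ^ 2 = w * (w * ξ ^ 2) := by ring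
          _ ≤ w * (1 * 1) := by gcongr
          _ = w := by ring
      have e2 : (1 / τ) ^ (k + 1) = 1 / τ ^ (k + 1) := by rw [div_pow, one_pow]
      have e3 : 1 + 1 / τ ^ (k + 1) ≤ 2 / τ ^ (k + 1) := by
        rw [le_div_iff₀ hτn0, add_mul, div_mul_cancel₀ _ hτn0.ne']; linarith
      have e4 : ξ * (2 / τ ^ (k + 1)) ≤ τ ^ (k + 1) / 4 := by
        rw [mul_div_assoc', div_le_iff₀ hτn0]; linarith
      calc w ^ 2 * ξ ^ 2 * (1 + (1 / τ) ^ (k + 1)) ≤ w * (2 / τ ^ (k + 1)) := by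
            rw [e2]; gcongr
        _ = (a * ξ ^ 2) ^ (k + 1) * (ξ * (2 / τ ^ (k + 1))) := by rw [hw]; ring
        _ ≤ _ := by gcongr)
    ha0.le
    (by
      have e1 : (1 - 2 * (a * ξ)) * (1 + a) ≤ (1 - a * ξ ^ 2) ^ (k + 1) * V * (1 + a) := by
        gcongr
      rw [← mul_assoc]
      refine le_trans ?_ e1
      have : a * (a * ξ) ≤ 1 * (a * ξ) := by gcongr
      have : a * (1024 * ξ) ≤ a * 1 := by gcongr
      linarith)
    (by positivity)
    (by
      have : ξ ^ 5 ≤ ξ := pow_le_of_le_one hξ0.le (by linarith) (by omega)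
      linarith)
    (by
      have : 0 < (ξ ^ 5) ^ (2 * k + 4) := by positivity
      have := mul_le_mul_of_nonneg_left (hξτ.trans hτ') this.le
      have : 0 < (ξ ^ 5) ^ (2 * k + 4) * ξ := by positivity
      rw [ha]
      linarith)
    (by
      have : a * (1024 * ξ) ≤ a * 1 := by gcongr
      linarith)
    (by positivity) (pow_le_one₀ hξ0.le (by linarith))
    (by
      have e : a ≤ (ξ ^ 5) ^ (k + 1) * ξ := by
        rw [ha]
        exact mul_le_mul_of_nonneg_right
          (pow_le_pow_of_le_one (by positivity) hξ5 (by omega)) hξ0.le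
      have e0 : 0 < (ξ ^ 5) ^ (k + 1) := by positivity
      have e1 : w ^ 2 * ξ ^ 2 ≤ a := by
        have i2 : ξ ^ 2 ≤ 1 := pow_le_one₀ hξ0.le (by linarith)
        have i3 : w ≤ a := by
          have := mul_le_mul_of_nonneg_left (by linarith : ξ ≤ 1) ha0.le
          linarith
        calc w ^ 2 * ξ ^ 2 = w * (w * ξ ^ 2) := by ring
          _ ≤ w * (1 * 1) := by gcongr
          _ ≤ a := by linarith
      have e2 : a / τ ^ (k + 1) ≤ (ξ ^ 5) ^ (k + 1) * (1 / 1024) := by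
        rw [div_le_iff₀ hτn0]
        refine e.trans ?_
        rw [mul_assoc]
        gcongr
        have := mul_le_of_le_one_left hτn0.le hτn1
        linarith
      have e3 : a ≤ (ξ ^ 5) ^ (k + 1) * (1 / 1024) := by
        refine e.trans ?_
        gcongr
        linarith
      have e4 : (ξ ^ 5) ^ (k + 1) * (1 / 2) ≤ (ξ ^ 5) ^ (k + 1) * V := by
        gcongr; linarith
      linarith)
  refine ⟨P, b, hP, hPc, hAP, hBP, ?_⟩
  rw [hPV]
  have hT : 10 * ξ ^ 5 + 2 * ξ ^ 5 / τ ≤ ξ ^ 3 := by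
    have e1 : 2 * ξ ^ 5 / τ ≤ ξ ^ 4 := by
      rw [div_le_iff₀ hτ]
      have : ξ ^ 4 * (1024 * ξ) ≤ ξ ^ 4 * τ := by gcongr
      linarith [pow_pos hξ0 5]
    have e2 : ξ ^ 3 * (ξ * (10 * ξ + 1)) ≤ ξ ^ 3 * 1 := by
      gcongr; nlinarith only [hξ0, hξ1]
    linarith
  have hsm : ((k + 1 : ℕ) : ℝ) * (((k : ℝ) + 2) * ξ ^ 3) ≤ ξ / 1024 := by
    push_cast
    calc ((k : ℝ) + 1) * ((k + 2) * ξ ^ 3) ≤ (k + 2) * ((k + 2) * ξ ^ 3) := by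
          gcongr
          linarith
      _ = ξ ^ 2 * (ξ * (k + 2) ^ 2) := by ring
      _ ≤ ξ / 1024 * 1 := by gcongr; linarith
      _ = _ := by ring
  have hb := one_add_pow_le_of_small (k + 1) (y := ((k : ℝ) + 2) * ξ ^ 3) (by positivity)
    (hsm.trans (by linarith))
  calc (1 + ((k : ℝ) + 2) * (10 * ξ ^ 5 + 2 * ξ ^ 5 / τ)) ^ (k + 1) * V
      ≤ (1 + ((k : ℝ) + 2) * ξ ^ 3) ^ (k + 1) * V := by gcongr
    _ ≤ (1 + ξ / 512) * (1 + ξ / 1024) := by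
        gcongr
        linarith
    _ ≤ 1 + ξ / 2 := by nlinarith only [hξ0, hξ1]

/-- If `|(1 - λ)A + λB| ≤ 1 + ξ^m` with `ξ` small, then `A` and a translate of `B` lie in a
common compact convex set of volume at most `1 + ξ/2`. -/
theorem stability_of_small {k : ℕ} {A B S : Set (Fin (k + 1) → ℝ)} {lam τ ξ : ℝ}
    (hτ : 0 < τ) (hτ2 : τ ≤ 1 / 2) (h0 : τ ≤ lam) (h1 : τ ≤ 1 - lam) (hA : MeasurableSet A)
    (hB : MeasurableSet B) (vA : volume A = 1) (vB : volume B = 1) (hS : MeasurableSet S)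
    (H : (1 - lam) • A + lam • B ⊆ S) (hξ0 : 0 < ξ)
    (hξ : ξ * (1024 * (k + 2) ^ 2 * 2 ^ ((k + 2) * (k + 1))) ≤ τ ^ (2 * (k + 1) + 2))
    (hSv : volume S ≤ ENNReal.ofReal (1 + ξ ^ (4 * ((10 * k + 23) * (k + 1) + 1) + 6))) :
    ∃ (P : Set (Fin (k + 1) → ℝ)) (b : Fin (k + 1) → ℝ), Convex ℝ P ∧ IsCompact P ∧ A ⊆ P ∧
      B + {b} ⊆ P ∧ volume.real P ≤ 1 + ξ / 2 := by
  refine stability_of_small_aux hτ hτ2 h0 h1 hA hB vA vB hS H hξ0 hξ rfl rfl (hSv.trans_eq ?_)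
  have e : 4 * ((10 * k + 23) * (k + 1) + 1) + 6 =
      ((5 * (2 * k + 4) + 1 + 2) * (k + 1) + 1) * 4 + 6 := by ring
  rw [e, pow_add, pow_mul, pow_succ (ξ) ((5 * (2 * k + 4) + 1 + 2) * (k + 1)),
    pow_mul ξ (5 * (2 * k + 4) + 1 + 2), pow_add ξ (5 * (2 * k + 4) + 1), pow_succ ξ (5 * _),
    pow_mul ξ 5]

theorem neg_log_div_self_ge {τ : ℝ} (hτ : 0 < τ) (hτ2 : τ ≤ 1 / 2) :
    1 ≤ -Real.log τ / τ ∧ -Real.log τ ≤ -Real.log τ / τ := by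
  have h1 : Real.log τ ≤ -Real.log 2 := by
    rw [← Real.log_inv]
    exact Real.log_le_log hτ (by rw [← one_div]; exact hτ2)
  have h2 := Real.log_two_gt_d9
  rw [le_div_iff₀ hτ, le_div_iff₀ hτ]
  constructor <;> nlinarith

theorem le_FJM {n : ℕ} (hn : 2 ≤ n) {τ : ℝ} (hτ : 0 < τ) (hτ2 : τ ≤ 1 / 2) :
    1024 * (n : ℝ) ^ 4 * -Real.log τ ≤ FJM n τ := by
  obtain ⟨h1, h2⟩ := neg_log_div_self_ge hτ hτ2
  have hlog : Real.log τ ≤ 0 := Real.log_nonpos hτ.le (by linarith)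
  have hn1 : (1 : ℝ) ≤ n := by exact_mod_cast (by omega : 1 ≤ n)
  have e9 : 3 ^ 2 ≤ 3 ^ n := Nat.pow_le_pow_right (by norm_num) hn
  have e10 : 3 ^ 4 ≤ 3 ^ (n + 2) := Nat.pow_le_pow_right (by norm_num) (by omega)
  have i1 : (1024 : ℝ) ≤ 2 ^ (3 ^ (n + 2)) := by
    rw [show (1024 : ℝ) = 2 ^ 10 by norm_num]
    exact pow_le_pow_right₀ (by norm_num) (by omega)
  have i2 : (n : ℝ) ^ 4 ≤ (n : ℝ) ^ (3 ^ n) := pow_le_pow_right₀ hn1 (by omega)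
  have i3 : -Real.log τ ≤ (-Real.log τ / τ) ^ (3 ^ n) :=
    h2.trans (le_self_pow₀ h1 (by omega))
  rw [FJM, abs_of_nonpos hlog, mul_div_assoc, ← div_pow]
  gcongr
  linarith

theorem FJsigma_le {n : ℕ} (hn : 2 ≤ n) {τ : ℝ} (hτ : 0 < τ) (hτ2 : τ ≤ 1 / 2) :
    FJsigma n τ ≤ 1 / (1024 * (n : ℝ) ^ 4) := by
  obtain ⟨h1, h2⟩ := neg_log_div_self_ge hτ hτ2
  have hlog : Real.log τ ≤ 0 := Real.log_nonpos hτ.le (by linarith)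
  have hn1 : (1 : ℝ) ≤ n := by exact_mod_cast (by omega : 1 ≤ n)
  have e9 : 3 ^ 2 ≤ 3 ^ n := Nat.pow_le_pow_right (by norm_num) hn
  have e10 : 3 ^ 3 ≤ 3 ^ (n + 1) := Nat.pow_le_pow_right (by norm_num) (by omega)
  have i1 : (1024 : ℝ) ≤ 2 ^ (3 ^ (n + 1)) := by
    rw [show (1024 : ℝ) = 2 ^ 10 by norm_num]
    exact pow_le_pow_right₀ (by norm_num) (by omega)
  have i2 : (n : ℝ) ^ 4 ≤ (n : ℝ) ^ (3 ^ n) := pow_le_pow_right₀ hn1 (by omega)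
  have i3 : 1 ≤ (-Real.log τ / τ) ^ (3 ^ n) := one_le_pow₀ h1
  have e : FJsigma n τ =
      1 / (2 ^ (3 ^ (n + 1)) * (n : ℝ) ^ (3 ^ n) * (-Real.log τ / τ) ^ (3 ^ n)) := by
    rw [FJsigma, abs_of_nonpos hlog, div_pow, mul_div_assoc', one_div_div]
  rw [e]
  apply one_div_le_one_div_of_le (by positivity)
  calc 1024 * (n : ℝ) ^ 4 = 1024 * (n : ℝ) ^ 4 * 1 := (mul_one _).symm
    _ ≤ _ := by gcongr

/-- The `m`-th root of `δ ≤ exp (-M_n(τ))` is small enough for `stability_of_small`. -/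
theorem rpow_mul_le_of_le_exp_neg_FJM {k : ℕ} (hk : 1 ≤ k) {τ δ : ℝ} (hτ : 0 < τ)
    (hτ2 : τ ≤ 1 / 2) (hδ0 : 0 < δ) (hδ : δ ≤ Real.exp (-FJM (k + 1) τ)) {m : ℕ} (hm0 : 0 < m)
    (hm : m ≤ 69 * (k + 1) ^ 2) :
    δ ^ (1 / (m : ℝ)) * (1024 * (k + 2) ^ 2 * 2 ^ ((k + 2) * (k + 1))) ≤
      τ ^ (2 * (k + 1) + 2) := by
  set R : ℕ := 10 + 2 * (k + 1) + (k + 2) * (k + 1) with hR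
  have hlog : Real.log τ ≤ 0 := Real.log_nonpos hτ.le (by linarith)
  have hmR : m * (R + (2 * (k + 1) + 2)) ≤ 1024 * (k + 1) ^ 4 := by
    have : R + (2 * (k + 1) + 2) ≤ 10 * (k + 1) ^ 2 := by rw [hR]; nlinarith
    calc m * (R + (2 * (k + 1) + 2)) ≤ 69 * (k + 1) ^ 2 * (10 * (k + 1) ^ 2) :=
          Nat.mul_le_mul hm this
      _ = 690 * (k + 1) ^ 4 := by ring
      _ ≤ _ := by gcongr; norm_num
  have hm0' : (0 : ℝ) < m := by exact_mod_cast hm0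
  have h1 : δ ^ (1 / (m : ℝ)) ≤ τ ^ (R + (2 * (k + 1) + 2)) := by
    have hM := le_FJM (n := k + 1) (by omega) hτ hτ2
    have hmR' : (m : ℝ) * (R + (2 * (k + 1) + 2) : ℕ) ≤ 1024 * ((k + 1 : ℕ) : ℝ) ^ 4 := by
      exact_mod_cast hmR
    calc δ ^ (1 / (m : ℝ)) ≤ (τ ^ ((R + (2 * (k + 1) + 2)) * m)) ^ (1 / (m : ℝ)) := by
          apply Real.rpow_le_rpow hδ0.le _ (by positivity)
          refine hδ.trans ?_
          rw [← Real.rpow_natCast, Real.rpow_def_of_pos hτ]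
          apply Real.exp_le_exp.2
          have := mul_le_mul_of_nonneg_right hmR' (neg_nonneg.2 hlog)
          push_cast at this hM ⊢
          linarith
      _ = _ := by
          rw [pow_mul, one_div]
          exact Real.pow_rpow_inv_natCast (by positivity) hm0.ne'
  have h2 : (1024 * (k + 2) ^ 2 * 2 ^ ((k + 2) * (k + 1)) : ℝ) ≤ 2 ^ R := by
    have : ((k : ℝ) + 2) ≤ 2 ^ (k + 1) := by
      exact_mod_cast (Nat.lt_two_pow_self : k + 1 < 2 ^ (k + 1))
    calc (1024 * (k + 2) ^ 2 * 2 ^ ((k + 2) * (k + 1)) : ℝ)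
        ≤ 2 ^ 10 * (2 ^ (k + 1)) ^ 2 * 2 ^ ((k + 2) * (k + 1)) := by gcongr; norm_num
      _ = 2 ^ R := by rw [← pow_mul, ← pow_add, ← pow_add, hR, mul_comm 2 (k + 1)]
  calc δ ^ (1 / (m : ℝ)) * (1024 * (k + 2) ^ 2 * 2 ^ ((k + 2) * (k + 1)))
      ≤ τ ^ (R + (2 * (k + 1) + 2)) * 2 ^ R := by gcongr
    _ = (2 * τ) ^ R * τ ^ (2 * (k + 1) + 2) := by rw [pow_add, mul_pow]; ring
    _ ≤ 1 * τ ^ (2 * (k + 1) + 2) := by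
        gcongr
        exact pow_le_one₀ (by positivity) (by linarith)
    _ = _ := one_mul _

theorem exists_compact_convex_superset_volume_eq_one {n : ℕ} {A : Set (Fin n → ℝ)}
    (vA : volume A = 1) {ε : ℝ} (hε : 0 < ε)
    (h : ∀ ξ : ℝ, 0 < ξ → ξ ≤ ε → ∃ P : Set (Fin n → ℝ), Convex ℝ P ∧ IsCompact P ∧ A ⊆ P ∧
      volume.real P ≤ 1 + ξ / 2) :
    ∃ K : Set (Fin n → ℝ), Convex ℝ K ∧ IsCompact K ∧ A ⊆ K ∧ volume.real K = 1 := by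
  have hsub : ∀ P : Set (Fin n → ℝ), Convex ℝ P → IsCompact P → A ⊆ P →
      closure (convexHull ℝ A) ⊆ P := fun P hP hPc hA =>
    closure_minimal (convexHull_min hA hP) hPc.isClosed
  have hAK : A ⊆ closure (convexHull ℝ A) := (subset_convexHull ℝ A).trans subset_closure
  obtain ⟨P, hP, hPc, hAP, -⟩ := h ε hε le_rfl
  have hK : IsCompact (closure (convexHull ℝ A)) :=
    hPc.of_isClosed_subset isClosed_closure (hsub P hP hPc hAP)
  refine ⟨_, (convex_convexHull ℝ A).closure, hK, hAK, le_antisymm ?_ ?_⟩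
  · refine le_of_forall_pos_le_add fun ξ hξ => ?_
    obtain ⟨Q, hQ, hQc, hAQ, hQv⟩ := h (min ξ ε) (lt_min hξ hε) (min_le_right _ _)
    have := measureReal_mono (μ := volume) (hsub Q hQ hQc hAQ) hQc.measure_lt_top.ne
    have := min_le_left ξ ε
    linarith
  · have := measureReal_mono (μ := volume) hAK hK.measure_lt_top.ne
    rwa [measureReal_def, vA, ENNReal.toReal_one] at this

/-- The equality case of the Brunn–Minkowski inequality for measurable sets of volume one. -/
theorem exists_convex_of_volume_le_one {k : ℕ} {A B S : Set (Fin (k + 1) → ℝ)} {lam : ℝ}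
    (h0 : 0 < lam) (h1 : lam < 1) (hA : MeasurableSet A) (hB : MeasurableSet B)
    (vA : volume A = 1) (vB : volume B = 1) (hS : MeasurableSet S)
    (H : (1 - lam) • A + lam • B ⊆ S) (hSv : volume S ≤ 1) :
    ∃ (K : Set (Fin (k + 1) → ℝ)) (b : Fin (k + 1) → ℝ), Convex ℝ K ∧ IsCompact K ∧ A ⊆ K ∧
      B + {b} ⊆ K ∧ volume.real K = 1 := by
  set τ := min lam (1 - lam)
  have hτ : 0 < τ := lt_min h0 (by linarith)
  have hτ2 : τ ≤ 1 / 2 := by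
    linarith [min_le_left lam (1 - lam), min_le_right lam (1 - lam)]
  have hc : (0 : ℝ) < 1024 * (k + 2) ^ 2 * 2 ^ ((k + 2) * (k + 1)) := by positivity
  have hmain : ∀ ξ : ℝ, 0 < ξ →
      ξ ≤ τ ^ (2 * (k + 1) + 2) / (1024 * (k + 2) ^ 2 * 2 ^ ((k + 2) * (k + 1))) →
      ∃ (P : Set (Fin (k + 1) → ℝ)) (b : Fin (k + 1) → ℝ), Convex ℝ P ∧ IsCompact P ∧ A ⊆ P ∧
      B + {b} ⊆ P ∧ volume.real P ≤ 1 + ξ / 2 := fun ξ hξ0 hξ =>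
    stability_of_small hτ hτ2 (min_le_left _ _) (min_le_right _ _) hA hB vA vB hS H hξ0
      ((le_div_iff₀ hc).1 hξ) (hSv.trans (by
        rw [ENNReal.one_le_ofReal]
        linarith [pow_pos hξ0 (4 * ((10 * k + 23) * (k + 1) + 1) + 6)]))
  have hε : 0 < τ ^ (2 * (k + 1) + 2) / (1024 * (k + 2) ^ 2 * 2 ^ ((k + 2) * (k + 1))) := by
    positivity
  obtain ⟨K, hKc, hK, hAK, hKV⟩ := exists_compact_convex_superset_volume_eq_one vA hε
    (fun ξ hξ0 hξ => by
      obtain ⟨P, b, hP, hPc, hAP, -, hPv⟩ := hmain ξ hξ0 hξ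
      exact ⟨P, hP, hPc, hAP, hPv⟩)
  obtain ⟨L, hLc, hL, hBL, hLV⟩ := exists_compact_convex_superset_volume_eq_one vB hε
    (fun ξ hξ0 hξ => by
      obtain ⟨P, b, hP, hPc, -, hBP, hPv⟩ := hmain ξ hξ0 hξ
      refine ⟨(fun x => x + b) ⁻¹' P, hP.translate_preimage_left b,
        (Homeomorph.addRight b).isCompact_preimage.2 hPc, fun x hx => hBP ⟨x, hx, b, rfl, rfl⟩, ?_⟩
      rwa [measureReal_def, measure_preimage_add_right])
  have hsd : ∀ {A K : Set (Fin (k + 1) → ℝ)}, MeasurableSet A → volume A = 1 → A ⊆ K →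
      IsCompact K → volume.real K = 1 → volume.real (K \ A) ≤ 0 := by
    intro A K hA vA hAK hK hKV
    have := measureReal_inter_add_sdiff (μ := volume) (s := K) hA hK.measure_lt_top.ne
    rw [Set.inter_eq_self_of_subset_right hAK, hKV, measureReal_def volume A, vA,
      ENNReal.toReal_one] at this
    linarith
  have hZ : IsCompact ((1 - lam) • K + lam • L) := (hK.smul _).add (hL.smul _)
  have hZV : volume.real ((1 - lam) • K + lam • L) ≤ 1 * (1 + 0) := by
    have hlim : Filter.Tendsto
        (fun t : ℝ => (1 - t) ^ (k + 1) * volume.real ((1 - lam) • K + lam • L))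
        (nhdsWithin 0 (Set.Ioi 0)) (nhds ((1 - 0) ^ (k + 1) *
          volume.real ((1 - lam) • K + lam • L))) := by
      apply Filter.Tendsto.mono_left _ nhdsWithin_le_nhds
      exact (by fun_prop : Continuous fun t : ℝ =>
        (1 - t) ^ (k + 1) * volume.real ((1 - lam) • K + lam • L)).tendsto 0
    rw [sub_zero, one_pow, one_mul] at hlim
    rw [add_zero, one_mul]
    refine le_of_tendsto hlim ?_
    filter_upwards [Ioo_mem_nhdsGT (zero_lt_one (α := ℝ))] with t ht
    obtain ⟨w, -, hw⟩ := exists_homothety_subset (γ := 0) h0 h1 hA hB hS H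
      (hSv.trans (by rw [ENNReal.one_le_ofReal]; norm_num)) hK hL hKc hLc
      (hsd hA vA hAK hK hKV) (hsd hB vB hBL hL hLV) (by rw [hKV]; norm_num)
      (by rw [hLV]; norm_num) ht.1 ht.2.le (by rw [zero_mul]; have := ht.1; positivity)
    have e := volume_real_affine_image (n := k + 1) (by linarith [ht.2] : 0 ≤ 1 - t) (t • w)
      ((1 - lam) • K + lam • L)
    rw [← e, ← ENNReal.toReal_one]
    exact ENNReal.toReal_mono ENNReal.one_ne_top ((measure_mono (hw.trans H)).trans hSv)
  have hKne : K.Nonempty := by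
    rw [Set.nonempty_iff_ne_empty]; rintro rfl; simp at hKV
  obtain ⟨z, hz, hzK⟩ := exists_center hK hKc hKne
  refine ⟨K, (1 : ℝ)⁻¹ • ((∫ x in K, x) - ∫ x in L, x), hKc, hK, hAK, ?_, hKV⟩
  rintro _ ⟨x, hx, _, rfl, rfl⟩
  have hmem := mem_dilation_of_le hK hKc hKne le_rfl hzK
    (x := x + (1 : ℝ)⁻¹ • ((∫ x in K, x) - ∫ x in L, x)) (fun u => by
    rw [zero_mul, add_zero, map_add]
    refine (add_le_add_left (le_suppFn hL u (hBL hx)) _).trans ?_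
    have hlim : Filter.Tendsto (fun κ : ℝ => suppFn K u + 10 * κ * wid K u)
        (nhdsWithin 0 (Set.Ioi 0)) (nhds (suppFn K u + 10 * 0 * wid K u)) := by
      apply Filter.Tendsto.mono_left _ nhdsWithin_le_nhds
      exact (by fun_prop : Continuous fun κ : ℝ => suppFn K u + 10 * κ * wid K u).tendsto 0
    rw [mul_zero, zero_mul, add_zero] at hlim
    refine ge_of_tendsto hlim ?_
    filter_upwards [Ioo_mem_nhdsGT (by norm_num : (0 : ℝ) < 1 / 8)] with κ hκ
    have := hκ.1
    have : 0 < 1 - lam := by linarith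
    exact suppFn_add_le h0 h1 hκ.1 hκ.2.le hK hL hLc one_pos hKV hLV hZV (by positivity) le_rfl u)
  simpa using hmem

/-- Converting a bound on the volume of a common superset into a bound on the differences. -/
theorem volume_sdiff_le {n : ℕ} {A P : Set (Fin n → ℝ)} (hA : MeasurableSet A)
    (vA : volume A = 1) (hP : IsCompact P) (a : Fin n → ℝ) (hAP : A + {a} ⊆ P) {ξ : ℝ}
    (hPv : volume.real P ≤ 1 + ξ) : volume (P \ (A + {a})) ≤ ENNReal.ofReal ξ := by
  have hm : MeasurableSet (A + {a}) := by
    rw [Set.add_singleton, Set.image_add_right]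
    exact measurable_add_const _ hA
  have hv : volume.real (A + {a}) = 1 := by
    rw [measureReal_def, Set.add_singleton, Set.image_add_right, measure_preimage_add_right, vA,
      ENNReal.toReal_one]
  have hf := hP.measure_lt_top (μ := volume)
  have := measureReal_inter_add_sdiff (μ := volume) (s := P) hm hf.ne
  rw [Set.inter_eq_self_of_subset_right hAP, hv] at this
  rw [← ENNReal.ofReal_toReal (measure_ne_top_of_subset Set.sdiff_subset hf.ne)]
  apply ENNReal.ofReal_le_ofReal
  rw [← measureReal_def]
  linarith

/-- **Figalli–Jerison stability of Brunn–Minkowski without convexity.** Let `n ≥ 2`.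
There is `N_n > 0`, depending only on `n`, such that for all measurable `A, B ⊂ ℝⁿ`
with `|A| = |B| = 1`, all `λ ∈ (0,1)` with `τ = min{λ, 1−λ}` and
`S = (1−λ)A + λB`, if `|S| ≤ 1 + δ` for some `δ ≤ e^{−M_n(τ)}`, then there exist a
convex `K ⊂ ℝⁿ` and translations `a, b` with `A + a ⊆ K`, `B + b ⊆ K` and
`|K \ (A + a)| + |K \ (B + b)| ≤ τ^{−N_n} δ^{σ_n(τ)}`. -/
theorem figalli_jerison_stability (n : ℕ) (hn : 2 ≤ n) :
    ∃ N : ℝ, 0 < N ∧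
      ∀ (A B : Set (Fin n → ℝ)), MeasurableSet A → MeasurableSet B →
        volume A = 1 → volume B = 1 →
        ∀ lam : ℝ, lam ∈ Set.Ioo (0 : ℝ) 1 →
        ∀ δ : ℝ, δ ≤ Real.exp (-(FJM n (min lam (1 - lam)))) →
        volume ((1 - lam) • A + lam • B) ≤ ENNReal.ofReal (1 + δ) →
        ∃ (K : Set (Fin n → ℝ)) (a b : Fin n → ℝ), Convex ℝ K ∧
          A + {a} ⊆ K ∧ B + {b} ⊆ K ∧
          volume (K \ (A + {a})) + volume (K \ (B + {b}))
            ≤ ENNReal.ofReal ((min lam (1 - lam)) ^ (-N)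
                * δ ^ (FJsigma n (min lam (1 - lam)))) := by
  obtain ⟨k, rfl⟩ : ∃ k, n = k + 1 := ⟨n - 1, by omega⟩
  refine ⟨1, one_pos, fun A B hA hB vA vB lam ⟨h0, h1⟩ δ hδ hv => ?_⟩
  set S := toMeasurable volume ((1 - lam) • A + lam • B) with hSdef
  have hS : MeasurableSet S := measurableSet_toMeasurable _ _
  have H : (1 - lam) • A + lam • B ⊆ S := subset_toMeasurable _ _
  have hSv : volume S ≤ ENNReal.ofReal (1 + δ) := by rwa [hSdef, measure_toMeasurable]
  set τ := min lam (1 - lam) with hτdef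
  have hτ : 0 < τ := lt_min h0 (by linarith)
  have hτ2 : τ ≤ 1 / 2 := by
    linarith [min_le_left lam (1 - lam), min_le_right lam (1 - lam)]
  have hδ0 : 0 ≤ δ := by
    have := (brunn_minkowski_of_volume_eq (V := 1) h0 h1 hA hB hS H (by simp [vA])
      (by simp [vB])).trans hSv
    have := (ENNReal.ofReal_le_ofReal_iff' ).1 this
    rcases this with h | h <;> linarith
  have hA0 : A + {0} = A := by simp
  rcases hδ0.eq_or_lt with rfl | hδ0
  · obtain ⟨K, b, hK, hKc, hAK, hBK, hKV⟩ := exists_convex_of_volume_le_one h0 h1 hA hB vA vB hS H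
      (by simpa using hSv)
    rw [← hA0] at hAK
    refine ⟨K, 0, b, hK, hAK, hBK, ?_⟩
    have e1 := volume_sdiff_le hA vA hKc 0 hAK (ξ := 0) (by linarith)
    have e2 := volume_sdiff_le hB vB hKc b hBK (ξ := 0) (by linarith)
    rw [ENNReal.ofReal_zero] at e1 e2
    exact (add_le_add e1 e2).trans (by simp)
  · have hm0 : 0 < 4 * ((10 * k + 23) * (k + 1) + 1) + 6 := by omega
    have hm : 4 * ((10 * k + 23) * (k + 1) + 1) + 6 ≤ 69 * (k + 1) ^ 2 := by nlinarith
    have hk : 1 ≤ k := by omega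
    have hm0' : (0 : ℝ) < ((4 * ((10 * k + 23) * (k + 1) + 1) + 6 : ℕ) : ℝ) := by
      exact_mod_cast hm0
    have hξ := rpow_mul_le_of_le_exp_neg_FJM hk hτ hτ2 hδ0 hδ hm0 hm
    have hpow : (δ ^ (1 / ((4 * ((10 * k + 23) * (k + 1) + 1) + 6 : ℕ) : ℝ))) ^
        (4 * ((10 * k + 23) * (k + 1) + 1) + 6) = δ := by
      rw [one_div]
      exact Real.rpow_inv_natCast_pow hδ0.le hm0.ne'
    have hσ : FJsigma (k + 1) τ ≤ 1 / ((4 * ((10 * k + 23) * (k + 1) + 1) + 6 : ℕ) : ℝ) := by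
      refine (FJsigma_le hn hτ hτ2).trans (one_div_le_one_div_of_le hm0' ?_)
      have : 4 * ((10 * k + 23) * (k + 1) + 1) + 6 ≤ 1024 * (k + 1) ^ 4 := by
        refine hm.trans ?_
        gcongr <;> omega
      exact_mod_cast this
    obtain ⟨P, b, hP, hPc, hAP, hBP, hPv⟩ := stability_of_small hτ hτ2 (min_le_left _ _)
      (min_le_right _ _) hA hB vA vB hS H (Real.rpow_pos_of_pos hδ0 _) hξ (by rwa [hpow])
    rw [← hA0] at hAP
    refine ⟨P, 0, b, hP, hAP, hBP, (add_le_add (volume_sdiff_le hA vA hPc 0 hAP hPv)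
      (volume_sdiff_le hB vB hPc b hBP hPv)).trans ?_⟩
    have hδ1 : δ ≤ 1 := hδ.trans (Real.exp_le_one_iff.2 (neg_nonpos.2 (by
      rw [FJM]; positivity)))
    have i1 := Real.rpow_le_rpow_of_exponent_ge hδ0 hδ1 hσ
    have i2 : 1 ≤ τ ^ (-1 : ℝ) :=
      Real.one_le_rpow_of_pos_of_le_one_of_nonpos hτ (by linarith) (by norm_num)
    rw [← ENNReal.ofReal_add (by positivity) (by positivity), add_halves]
    exact ENNReal.ofReal_le_ofReal
      (i1.trans (le_mul_of_one_le_left (Real.rpow_nonneg hδ0.le _) i2))
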